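/- For all integers k ≥ 2, 1 ≤ d ≤ k−1, every μ > 0 and every strictly 1-balanced k-graph F, there exists C > 0 with the following property. Let G be an n-vertex k-graph with δ_d(G) ≥ (th_d(til_F) + μ)·binom(n−d, k−d), suppose p ≥ C·(log n)^{1/e(F)}·n^{−1/d_1(F)} and v(F) divides n. Then the random sparsification G_p contains a perfect F-tiling with high probability. -/

import Mathlib

/-- `G` is a `k`-uniform hypergraph on vertex set `Fin n`. -/
def IsHG (k n : ℕ) (G : Finset (Finset (Fin n))) : Prop := ∀ e ∈ G, e.card = k

/-- Minimum `d`-degree of `G` is at least `m` (as a real number):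
every `d`-set of vertices lies in at least `m` edges. -/
def MinDegGE {n : ℕ} (G : Finset (Finset (Fin n))) (d : ℕ) (m : ℝ) : Prop :=
  ∀ S : Finset (Fin n), S.card = d → m ≤ ((G.filter (fun e => S ⊆ e)).card : ℝ)

open Classical in
/-- The probability that the random sparsification of the edge set `G`,
keeping each edge independently with probability `p`, satisfies `Q`. -/
noncomputable def sparsProb {α : Type*} [DecidableEq α] (G : Finset α) (p : ℝ)
    (Q : Finset α → Prop) : ℝ :=
  ∑ E ∈ G.powerset, if Q E then p ^ E.card * (1 - p) ^ (G.card - E.card) else 0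

/-- The edge set `E` on `Fin n` contains a perfect `F`-tiling, where `F` is a
hypergraph on `Fin m`: vertex-disjoint copies of `F` covering every vertex. -/
def HasPerfectTiling (m n : ℕ) (F : Finset (Finset (Fin m)))
    (E : Finset (Finset (Fin n))) : Prop :=
  ∃ T : Finset (Fin m → Fin n),
    (∀ φ ∈ T, Function.Injective φ ∧ ∀ e ∈ F, e.image φ ∈ E) ∧
    (∀ v : Fin n, ∃ φ ∈ T, v ∈ Finset.image φ Finset.univ) ∧
    (∀ φ ∈ T, ∀ ψ ∈ T, φ ≠ ψ →
      Disjoint (Finset.image φ Finset.univ) (Finset.image ψ Finset.univ))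

/-- The 1-density `d₁(F) = e(F)/(v(F)-1)`. -/
noncomputable def oneDensity (m : ℕ) (F : Finset (Finset (Fin m))) : ℝ :=
  (F.card : ℝ) / ((m : ℝ) - 1)

/-- `F` is strictly 1-balanced: every proper subgraph `(V', E')` with at least
one edge has strictly smaller 1-density. -/
def StrictlyOneBalanced (m : ℕ) (F : Finset (Finset (Fin m))) : Prop :=
  ∀ (V' : Finset (Fin m)) (E' : Finset (Finset (Fin m))),
    E' ⊆ F → (∀ e ∈ E', e ⊆ V') → E'.Nonempty →
    ¬(V' = Finset.univ ∧ E' = F) →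
    (E'.card : ℝ) / ((V'.card : ℝ) - 1) < oneDensity m F

/-- The minimum `d`-degree threshold for perfect `F`-tilings. -/
noncomputable def tilingThreshold (k d m : ℕ) (F : Finset (Finset (Fin m))) : ℝ :=
  sInf {δ : ℝ | 0 ≤ δ ∧ δ ≤ 1 ∧ ∀ μ : ℝ, 0 < μ → ∃ n₀ : ℕ, ∀ n, n₀ ≤ n → m ∣ n →
    ∀ G : Finset (Finset (Fin n)), IsHG k n G →
      MinDegGE G d ((δ + μ) * (((n - d).choose (k - d) : ℕ) : ℝ)) →
      HasPerfectTiling m n F G}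

set_option linter.unusedSectionVars false

/-! ### Random subsets of a finite set -/

section RandomSubset

variable {α : Type*} [DecidableEq α]

/-- Expectation of `f W`, where `W` is a random subset of `s` with density `p`. -/
noncomputable def rexp (s : Finset α) (p : ℝ) (f : Finset α → ℝ) : ℝ :=
  ∑ W ∈ s.powerset, p ^ W.card * (1 - p) ^ (s.card - W.card) * f W

lemma rexp_empty (p : ℝ) (f : Finset α → ℝ) : rexp ∅ p f = f ∅ := by
  simp [rexp]

lemma rexp_insert {s : Finset α} {a : α} (ha : a ∉ s) (p : ℝ) (f : Finset α → ℝ) :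
    rexp (insert a s) p f = p * rexp s p (fun W => f (insert a W)) + (1 - p) * rexp s p f := by
  unfold rexp
  rw [Finset.sum_powerset_insert ha, add_comm, Finset.mul_sum, Finset.mul_sum]
  congr 1
  · refine Finset.sum_congr rfl fun W hW => ?_
    have hW' := Finset.mem_powerset.1 hW
    have haW : a ∉ W := fun h => ha (hW' h)
    rw [Finset.card_insert_of_notMem haW, Finset.card_insert_of_notMem ha, pow_succ,
      Nat.add_sub_add_right]
    ring
  · refine Finset.sum_congr rfl fun W hW => ?_
    have hW' := Finset.mem_powerset.1 hW
    have hc := Finset.card_le_card hW'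
    rw [Finset.card_insert_of_notMem ha, Nat.succ_sub hc, pow_succ]
    ring

lemma rexp_congr {s : Finset α} {p : ℝ} {f g : Finset α → ℝ} (h : ∀ W, W ⊆ s → f W = g W) :
    rexp s p f = rexp s p g :=
  Finset.sum_congr rfl fun W hW => by rw [h W (Finset.mem_powerset.1 hW)]

lemma rexp_mono {s : Finset α} {p : ℝ} (h0 : 0 ≤ p) (h1 : p ≤ 1) {f g : Finset α → ℝ}
    (h : ∀ W, W ⊆ s → f W ≤ g W) : rexp s p f ≤ rexp s p g :=
  Finset.sum_le_sum fun W hW => mul_le_mul_of_nonneg_left (h W (Finset.mem_powerset.1 hW))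
    (mul_nonneg (pow_nonneg h0 _) (pow_nonneg (sub_nonneg.2 h1) _))

lemma rexp_add (s : Finset α) (p : ℝ) (f g : Finset α → ℝ) :
    rexp s p (fun W => f W + g W) = rexp s p f + rexp s p g := by
  simp only [rexp, mul_add, Finset.sum_add_distrib]

lemma rexp_const_mul (s : Finset α) (p c : ℝ) (f : Finset α → ℝ) :
    rexp s p (fun W => c * f W) = c * rexp s p f := by
  simp only [rexp, Finset.mul_sum]
  exact Finset.sum_congr rfl fun W _ => by ring

lemma rexp_mul_const (s : Finset α) (p c : ℝ) (f : Finset α → ℝ) :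
    rexp s p (fun W => f W * c) = rexp s p f * c := by
  simp only [mul_comm _ c, rexp_const_mul]

lemma rexp_sum {ι : Type*} (I : Finset ι) (s : Finset α) (p : ℝ) (f : ι → Finset α → ℝ) :
    rexp s p (fun W => ∑ i ∈ I, f i W) = ∑ i ∈ I, rexp s p (f i) := by
  simp only [rexp, Finset.mul_sum]
  exact Finset.sum_comm

lemma rexp_const (s : Finset α) (p c : ℝ) : rexp s p (fun _ => c) = c := by
  induction s using Finset.induction_on with
  | empty => simp [rexp_empty]
  | insert a s ha ih => rw [rexp_insert ha, ih]; ring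

lemma rexp_sub (s : Finset α) (p : ℝ) (f g : Finset α → ℝ) :
    rexp s p (fun W => f W - g W) = rexp s p f - rexp s p g := by
  simp only [rexp, mul_sub, Finset.sum_sub_distrib]

lemma rexp_nonneg {s : Finset α} {p : ℝ} (h0 : 0 ≤ p) (h1 : p ≤ 1) {f : Finset α → ℝ}
    (h : ∀ W, W ⊆ s → 0 ≤ f W) : 0 ≤ rexp s p f := by
  simpa [rexp_const] using rexp_mono h0 h1 (f := fun _ => 0) h

/-- Conditioning on the random set containing `Y`. -/
lemma rexp_superset (s : Finset α) (p : ℝ) (Y : Finset α) (hY : Y ⊆ s) (f : Finset α → ℝ) :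
    rexp s p (fun W => if Y ⊆ W then f W else 0)
      = p ^ Y.card * rexp s p (fun W => f (W ∪ Y)) := by
  induction s using Finset.induction_on generalizing Y f with
  | empty =>
    obtain rfl := Finset.subset_empty.1 hY
    simp [rexp_empty]
  | insert a s ha ih =>
    rw [rexp_insert ha, rexp_insert ha]
    by_cases haY : a ∈ Y
    · have hY' : Y.erase a ⊆ s := Finset.subset_insert_iff.1 hY
      have h1 : rexp s p (fun W => if Y ⊆ insert a W then f (insert a W) else 0)
          = p ^ (Y.erase a).card * rexp s p (fun W => f (W ∪ Y)) := by
        rw [← (rexp_congr (s := s) (p := p)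
          (f := fun W => if Y.erase a ⊆ W then f (insert a W) else 0) fun W _ => ?_),
          ih _ hY' (fun W => f (insert a W))]
        · congr 1
          refine rexp_congr fun W _ => ?_
          congr 1
          ext x
          by_cases hx : x = a <;> simp [hx, haY]
        · simp only [Finset.subset_insert_iff]
      have h2 : rexp s p (fun W => if Y ⊆ W then f W else 0) = 0 := by
        rw [rexp_congr (g := fun _ => 0) fun W hW => ?_, rexp_const]
        rw [if_neg fun h => ha (hW (h haY))]
      have h3 : rexp s p (fun W => f (insert a W ∪ Y)) = rexp s p (fun W => f (W ∪ Y)) := by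
        refine rexp_congr fun W _ => ?_
        congr 1
        ext x
        by_cases hx : x = a <;> simp [hx, haY]
      rw [h1, h2, h3, ← Finset.card_erase_add_one haY, pow_succ]
      ring
    · have hY' : Y ⊆ s := (Finset.subset_insert_iff_of_notMem haY).1 hY
      have h1 : rexp s p (fun W => if Y ⊆ insert a W then f (insert a W) else 0)
          = p ^ Y.card * rexp s p (fun W => f (insert a W ∪ Y)) := by
        simp only [Finset.subset_insert_iff_of_notMem haY, Finset.insert_union]
        exact ih Y hY' (fun W => f (insert a W))
      rw [h1, ih Y hY']
      ring

lemma rexp_subset_prob (s : Finset α) (p : ℝ) (Y : Finset α) (hY : Y ⊆ s) :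
    rexp s p (fun W => if Y ⊆ W then 1 else 0) = p ^ Y.card := by
  rw [rexp_superset s p Y hY (fun _ => 1), rexp_const, mul_one]

/-- Harris' inequality for two decreasing functions. -/
lemma rexp_mul_le_of_antitone {s : Finset α} {p : ℝ} (h0 : 0 ≤ p) (h1 : p ≤ 1)
    {f g : Finset α → ℝ} (hf : Antitone f) (hg : Antitone g) :
    rexp s p f * rexp s p g ≤ rexp s p (fun W => f W * g W) := by
  induction s using Finset.induction_on generalizing f g with
  | empty => simp [rexp_empty]
  | insert a s ha ih =>
    rw [rexp_insert ha, rexp_insert ha, rexp_insert ha]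
    have hm : ∀ W W' : Finset α, W ≤ W' → insert a W ≤ insert a W' :=
      fun W W' h => Finset.insert_subset_insert a h
    have i1 := ih (f := fun W => f (insert a W)) (g := fun W => g (insert a W))
      (fun W W' h => hf (hm W W' h)) (fun W W' h => hg (hm W W' h))
    have i0 := ih hf hg
    have df : rexp s p (fun W => f (insert a W)) ≤ rexp s p f :=
      rexp_mono h0 h1 fun W _ => hf (Finset.subset_insert a W)
    have dg : rexp s p (fun W => g (insert a W)) ≤ rexp s p g :=
      rexp_mono h0 h1 fun W _ => hg (Finset.subset_insert a W)
    have hq : 0 ≤ 1 - p := sub_nonneg.2 h1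
    nlinarith [mul_le_mul_of_nonneg_left i1 h0, mul_le_mul_of_nonneg_left i0 hq,
      mul_nonneg (mul_nonneg h0 hq) (mul_nonneg (sub_nonneg.2 df) (sub_nonneg.2 dg))]

/-- The union of two independent random subsets is a random subset. -/
lemma rexp_union (s : Finset α) (p q : ℝ) (f : Finset α → ℝ) :
    rexp s p (fun W => rexp s q (fun W' => f (W ∪ W'))) = rexp s (p + q - p * q) f := by
  induction s using Finset.induction_on generalizing f with
  | empty => simp [rexp_empty]
  | insert a s ha ih =>
    rw [rexp_insert ha, rexp_insert ha]
    simp only [rexp_insert ha, rexp_add, rexp_const_mul, Finset.insert_union,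
      Finset.union_insert, Finset.insert_idem]
    rw [ih (fun W => f (insert a W)), ih f]
    ring

lemma rexp_mono_prob {s : Finset α} {p q : ℝ} (h0 : 0 ≤ p) (hpq : p ≤ q) (h1 : q ≤ 1)
    {f : Finset α → ℝ} (hf : Monotone f) : rexp s p f ≤ rexp s q f := by
  rcases eq_or_lt_of_le (hpq.trans h1) with rfl | hp
  · rw [le_antisymm h1 hpq]
  have hp' : 0 < 1 - p := sub_pos.2 hp
  set x := (q - p) / (1 - p) with hx
  have hx0 : 0 ≤ x := div_nonneg (sub_nonneg.2 hpq) hp'.le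
  have hx1 : x ≤ 1 := (div_le_one hp').2 (by linarith)
  have hq : q = p + x - p * x := by
    have : x * (1 - p) = q - p := div_mul_cancel₀ _ hp'.ne'
    linarith
  rw [hq, ← rexp_union]
  refine rexp_mono h0 (hpq.trans h1) fun W _ => ?_
  calc f W = rexp s x (fun _ => f W) := (rexp_const _ _ _).symm
    _ ≤ _ := rexp_mono hx0 hx1 fun W' _ => hf Finset.subset_union_left

/-- Exponential moment of the size of the intersection with a fixed set. -/
lemma rexp_two_pow_card (s A : Finset α) (hA : A ⊆ s) (p : ℝ) :
    rexp s p (fun W => (2 : ℝ) ^ (W ∩ A).card) = (1 + p) ^ A.card := by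
  induction s using Finset.induction_on generalizing A with
  | empty =>
    obtain rfl := Finset.subset_empty.1 hA
    simp [rexp_empty]
  | insert a s ha ih =>
    rw [rexp_insert ha]
    by_cases haA : a ∈ A
    · have hA' : A.erase a ⊆ s := Finset.subset_insert_iff.1 hA
      have e1 : rexp s p (fun W => (2 : ℝ) ^ (insert a W ∩ A).card)
          = (1 + p) ^ (A.erase a).card * 2 := by
        rw [← ih _ hA', ← rexp_mul_const]
        refine rexp_congr fun W hW => ?_
        have : insert a W ∩ A = insert a (W ∩ A.erase a) := by
          ext x; by_cases hx : x = a <;> simp [hx, haA]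
        rw [this, Finset.card_insert_of_notMem (by simp), pow_succ]
      have e2 : rexp s p (fun W => (2 : ℝ) ^ (W ∩ A).card) = (1 + p) ^ (A.erase a).card := by
        rw [← ih _ hA']
        refine rexp_congr fun W hW => ?_
        have : W ∩ A = W ∩ A.erase a := by
          ext x
          by_cases hx : x = a
          · subst hx
            have hxW : x ∉ W := fun h => ha (hW h)
            simp [hxW]
          · simp [hx]
        rw [this]
      rw [e1, e2, ← Finset.card_erase_add_one haA, pow_succ]
      ring
    · have hA' : A ⊆ s := (Finset.subset_insert_iff_of_notMem haA).1 hA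
      simp only [Finset.insert_inter_of_notMem haA]
      rw [ih A hA']
      ring

lemma sparsProb_eq_rexp (G : Finset α) (p : ℝ) (Q : Finset α → Prop) [DecidablePred Q] :
    sparsProb G p Q = rexp G p (fun E => if Q E then 1 else 0) := by
  unfold sparsProb rexp
  refine Finset.sum_congr rfl fun E _ => ?_
  by_cases h : Q E <;> simp [h]

end RandomSubset

/-! ### Spread families -/

section Spread

variable {α ι : Type*} [DecidableEq α]

/-- One round of exposure: all but little of the mass of a spread family has small
minimum fragments with respect to a random set. -/
lemma spread_round (s : Finset α) (I : Finset ι) (μ : ι → ℝ) (M : ι → Finset α) (κ p β : ℝ)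
    (r' : ℕ) (hμ : ∀ i ∈ I, 0 ≤ μ i) (hM : ∀ i ∈ I, M i ⊆ s) (hp0 : 0 < p) (hp1 : p ≤ 1)
    (hκ : 0 ≤ κ)
    (hspread : ∀ S, S ⊆ s → ∑ i ∈ I with S ⊆ M i, μ i ≤ κ ^ S.card) (hβ0 : 0 ≤ β)
    (hβ : ∀ i ∈ I, ∑ Z ∈ (M i).powerset with r' < Z.card, (κ / p) ^ Z.card ≤ β) :
    ∃ T : Finset α → ι → Finset α,
      (∀ W, ∀ i ∈ I, T W i ⊆ M i ∧ ∃ j ∈ I, M j ⊆ W ∪ T W i) ∧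
      rexp s p (fun W => ∑ i ∈ I with r' < (T W i).card, μ i) ≤ β := by
  classical
  have hex : ∀ W : Finset α, ∀ i : ι, ∃ j, i ∈ I → j ∈ I ∧ M j ⊆ W ∪ M i ∧
      ∀ j' ∈ I, M j' ⊆ W ∪ M i → (M j \ W).card ≤ (M j' \ W).card := by
    intro W i
    by_cases hi : i ∈ I
    · obtain ⟨j, hj, hmin⟩ := Finset.exists_min_image (I.filter fun j => M j ⊆ W ∪ M i)
        (fun j => (M j \ W).card)
        ⟨i, Finset.mem_filter.2 ⟨hi, Finset.subset_union_right⟩⟩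
      rw [Finset.mem_filter] at hj
      exact ⟨j, fun _ => ⟨hj.1, hj.2, fun j' h1 h2 => hmin j' (Finset.mem_filter.2 ⟨h1, h2⟩)⟩⟩
    · exact ⟨i, fun h => absurd h hi⟩
  choose j hj using hex
  refine ⟨fun W i => M (j W i) \ W, fun W i hi => ⟨?_, j W i, (hj W i hi).1, ?_⟩, ?_⟩
  · exact (sdiff_le_iff (α := Finset α)).2 (hj W i hi).2.1
  · intro x hx
    by_cases h : x ∈ W <;> simp [h, hx]
  set T : Finset α → ι → Finset α := fun W i => M (j W i) \ W with hT
  have hTM : ∀ W, ∀ i ∈ I, T W i ⊆ M i := fun W i hi =>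
    (sdiff_le_iff (α := Finset α)).2 (hj W i hi).2.1
  let adm : Finset α → Finset (Finset α) := fun W => (I.image (T W)).filter fun Z => r' < Z.card
  let A : Finset α → Finset (Finset α) := fun Y =>
    if h : ∃ i ∈ I, M i ⊆ Y then (M h.choose).powerset.filter fun Z => r' < Z.card else ∅
  have step1 : rexp s p (fun W => ∑ i ∈ I with r' < (T W i).card, μ i)
      ≤ rexp s p (fun W => ∑ Z ∈ adm W, κ ^ Z.card) := by
    refine rexp_mono hp0.le hp1 fun W _ => ?_
    rw [← Finset.sum_fiberwise_of_maps_to (t := adm W) (g := T W)]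
    · refine Finset.sum_le_sum fun Z hZ => ?_
      obtain ⟨hZ1, hZ2⟩ := Finset.mem_filter.1 hZ
      obtain ⟨i, hi, rfl⟩ := Finset.mem_image.1 hZ1
      refine le_trans ?_ (hspread (T W i) ((hTM W i hi).trans (hM i hi)))
      refine Finset.sum_le_sum_of_subset_of_nonneg ?_ fun k hk _ => hμ k (Finset.mem_filter.1 hk).1
      intro k hk
      simp only [Finset.mem_filter] at hk ⊢
      exact ⟨hk.1.1, hk.2 ▸ hTM W k hk.1.1⟩
    · intro i hi
      rw [Finset.mem_filter] at hi
      exact Finset.mem_filter.2 ⟨Finset.mem_image_of_mem _ hi.1, hi.2⟩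
  have key : ∀ W, W ⊆ s → ∀ Z ∈ adm W, Disjoint W Z ∧ W ∪ Z ⊆ s ∧ Z ∈ A (W ∪ Z) := by
    intro W hW Z hZ
    obtain ⟨hZ1, hZ2⟩ := Finset.mem_filter.1 hZ
    obtain ⟨i, hi, rfl⟩ := Finset.mem_image.1 hZ1
    refine ⟨Finset.disjoint_sdiff, Finset.union_subset hW ((hTM W i hi).trans (hM i hi)), ?_⟩
    have hY : ∃ k ∈ I, M k ⊆ W ∪ T W i := ⟨j W i, (hj W i hi).1, by
      intro x hx
      by_cases h : x ∈ W <;> simp [hT, h, hx]⟩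
    simp only [A, dif_pos hY, Finset.mem_filter, Finset.mem_powerset]
    refine ⟨?_, hZ2⟩
    obtain ⟨hk, hkY⟩ := hY.choose_spec
    have hsub : M hY.choose \ W ⊆ T W i := (sdiff_le_iff (α := Finset α)).2 hkY
    have hle := (hj W i hi).2.2 hY.choose hk
      (hkY.trans (Finset.union_subset_union_right (hTM W i hi)))
    exact (Finset.eq_of_subset_of_card_le hsub hle).superset.trans Finset.sdiff_subset
  have step2 : rexp s p (fun W => ∑ Z ∈ adm W, κ ^ Z.card)
      ≤ rexp s p (fun Y => ∑ Z ∈ A Y, (κ / p) ^ Z.card) := by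
    unfold rexp
    simp only [Finset.mul_sum]
    rw [Finset.sum_sigma', Finset.sum_sigma']
    set P := s.powerset.sigma adm
    set P' := s.powerset.sigma A
    have hinj : Set.InjOn (fun x : (_ : Finset α) × Finset α =>
        (⟨x.1 ∪ x.2, x.2⟩ : (_ : Finset α) × Finset α)) P := by
      rintro ⟨W, Z⟩ h ⟨W', Z'⟩ h' he
      simp only [Finset.mem_coe, P, Finset.mem_sigma, Finset.mem_powerset] at h h'
      simp only [Sigma.mk.injEq, heq_eq_eq] at he
      obtain ⟨he1, rfl⟩ := he
      have d1 := (key W h.1 Z h.2).1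
      have d2 := (key W' h'.1 Z h'.2).1
      have : W = W' := by
        rw [← Finset.union_sdiff_cancel_right d1, ← Finset.union_sdiff_cancel_right d2, he1]
      rw [this]
    have hq : 0 ≤ 1 - p := sub_nonneg.2 hp1
    have hq1 : 1 - p ≤ 1 := by linarith
    calc ∑ x ∈ P, p ^ x.1.card * (1 - p) ^ (s.card - x.1.card) * κ ^ x.2.card
        ≤ ∑ x ∈ P, p ^ (x.1 ∪ x.2).card * (1 - p) ^ (s.card - (x.1 ∪ x.2).card)
            * (κ / p) ^ x.2.card := by
          refine Finset.sum_le_sum ?_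
          rintro ⟨W, Z⟩ h
          simp only [P, Finset.mem_sigma, Finset.mem_powerset] at h
          have hd := (key W h.1 Z h.2).1
          simp only [Finset.card_union_of_disjoint hd]
          have e : p ^ (W.card + Z.card) * (1 - p) ^ (s.card - (W.card + Z.card))
              * (κ / p) ^ Z.card
              = p ^ W.card * (1 - p) ^ (s.card - (W.card + Z.card)) * κ ^ Z.card := by
            rw [pow_add, div_pow]
            field_simp
          rw [e]
          refine mul_le_mul_of_nonneg_right (mul_le_mul_of_nonneg_left
            (pow_le_pow_of_le_one hq hq1 (by omega)) (pow_nonneg hp0.le _)) (pow_nonneg hκ _)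
      _ = ∑ x ∈ P.image (fun x : (_ : Finset α) × Finset α =>
              (⟨x.1 ∪ x.2, x.2⟩ : (_ : Finset α) × Finset α)),
            p ^ x.1.card * (1 - p) ^ (s.card - x.1.card) * (κ / p) ^ x.2.card := by
          rw [Finset.sum_image hinj]
      _ ≤ _ := by
          refine Finset.sum_le_sum_of_subset_of_nonneg ?_ fun x _ _ => by positivity
          intro y hy
          obtain ⟨⟨W, Z⟩, h, rfl⟩ := Finset.mem_image.1 hy
          simp only [P, Finset.mem_sigma, Finset.mem_powerset] at h
          simp only [P', Finset.mem_sigma, Finset.mem_powerset]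
          exact (key W h.1 Z h.2).2
  refine (step1.trans step2).trans ?_
  calc _ ≤ rexp s p (fun _ => β) := by
        refine rexp_mono hp0.le hp1 fun Y _ => ?_
        by_cases h : ∃ i ∈ I, M i ⊆ Y
        · simp only [A, dif_pos h]
          exact hβ _ h.choose_spec.1
        · simpa only [A, dif_neg h, Finset.sum_empty] using hβ0
    _ = β := rexp_const _ _ _

lemma sum_powerset_pow_card (A : Finset α) (x : ℝ) :
    ∑ Z ∈ A.powerset, x ^ Z.card = (1 + x) ^ A.card := by
  rw [add_comm, ← Finset.sum_pow_mul_eq_add_pow x 1 A]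
  simp

/-- The density used after `J` halving rounds followed by one round of density `q`. -/
noncomputable def roundsDensity (κ q : ℝ) : ℕ → ℝ
  | 0 => q
  | J + 1 => 16 * κ + roundsDensity κ q J - 16 * κ * roundsDensity κ q J

lemma roundsDensity_mem {κ q : ℝ} (hκ : 0 ≤ κ) (hκ1 : 16 * κ ≤ 1) (hq : 0 ≤ q) (hq1 : q ≤ 1)
    (J : ℕ) : 0 ≤ roundsDensity κ q J ∧ roundsDensity κ q J ≤ 1 ∧
      roundsDensity κ q J ≤ 16 * κ * J + q := by
  induction J with
  | zero => simp [roundsDensity, hq, hq1]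
  | succ J ih =>
    obtain ⟨h0, h1, h2⟩ := ih
    simp only [roundsDensity]
    push_cast
    refine ⟨?_, ?_, ?_⟩ <;>
      nlinarith [mul_nonneg (sub_nonneg.2 hκ1) (sub_nonneg.2 h1), mul_nonneg hκ h0,
        mul_nonneg (sub_nonneg.2 hκ1) h0]

open Classical in
/-- Iterating `spread_round`. -/
lemma spread_rounds (s : Finset α) (κ q : ℝ) (R : ℕ) (hκ : 0 < κ) (hκ1 : 16 * κ ≤ 1)
    (hq : 0 < q) (hq1 : q ≤ 1) (J : ℕ) (I : Finset ι) (μ : ι → ℝ) (M : ι → Finset α)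
    (hμ : ∀ i ∈ I, 0 ≤ μ i) (hM : ∀ i ∈ I, M i ⊆ s) (hcard : ∀ i ∈ I, (M i).card ≤ 2 ^ J * R)
    (hspread : ∀ S, S ⊆ s → ∑ i ∈ I with S ⊆ M i, μ i ≤ κ ^ S.card) :
    ∑ i ∈ I, μ i ≤ rexp s (roundsDensity κ q J) (fun W => if ∃ i ∈ I, M i ⊆ W then 1 else 0)
      + (J * (1 / 2) ^ R + ((1 + κ / q) ^ R - 1)) := by
  induction J generalizing I M with
  | zero =>
    have hx : 0 ≤ κ / q := by positivity
    obtain ⟨T, hT1, hT2⟩ := spread_round s I μ M κ q ((1 + κ / q) ^ R - 1) 0 hμ hM hq hq1 hκ.le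
      hspread (sub_nonneg.2 (one_le_pow₀ (by linarith))) (by
        intro i hi
        have h1 := sum_powerset_pow_card (M i) (κ / q)
        rw [← Finset.sum_filter_add_sum_filter_not _ (fun Z : Finset α => 0 < Z.card)] at h1
        have h2 : ∑ Z ∈ (M i).powerset with ¬ 0 < Z.card, (κ / q) ^ Z.card = 1 := by
          rw [show (M i).powerset.filter (fun Z => ¬ 0 < Z.card) = {∅} by
            ext Z
            simp only [Finset.mem_filter, Finset.mem_powerset, Finset.mem_singleton,
              Finset.card_pos, Finset.not_nonempty_iff_eq_empty]
            exact ⟨fun h => h.2, fun h => ⟨h ▸ Finset.empty_subset _, h⟩⟩]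
          simp
        have h3 : (1 + κ / q) ^ (M i).card ≤ (1 + κ / q) ^ R :=
          pow_le_pow_right₀ (by linarith) (by simpa using hcard i hi)
        linarith)
    have htot : ∑ i ∈ I, μ i ≤ 1 := by simpa using hspread ∅ (Finset.empty_subset _)
    calc ∑ i ∈ I, μ i = rexp s q (fun _ => ∑ i ∈ I, μ i) := (rexp_const _ _ _).symm
      _ ≤ rexp s q (fun W => (if ∃ i ∈ I, M i ⊆ W then 1 else 0)
            + ∑ i ∈ I with 0 < (T W i).card, μ i) := by
          refine rexp_mono hq.le hq1 fun W _ => ?_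
          split_ifs with h
          · have : 0 ≤ ∑ i ∈ I with 0 < (T W i).card, μ i :=
              Finset.sum_nonneg fun i hi => hμ i (Finset.mem_filter.1 hi).1
            linarith
          · rw [zero_add, Finset.filter_true_of_mem]
            intro i hi
            by_contra h0
            obtain ⟨j, hj, hjW⟩ := (hT1 W i hi).2
            rw [Finset.card_pos, Finset.not_nonempty_iff_eq_empty] at h0
            exact h ⟨j, hj, by simpa [h0] using hjW⟩
      _ ≤ _ := by
          rw [rexp_add]
          simp only [roundsDensity, Nat.cast_zero, zero_mul, zero_add]
          linarith
  | succ J ih =>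
    have hp0 : (0 : ℝ) < 16 * κ := by positivity
    have hpow : ((1 : ℝ) / 4) ^ (2 ^ J * R) ≤ (1 / 2) ^ R :=
      calc ((1 : ℝ) / 4) ^ (2 ^ J * R) ≤ (1 / 2) ^ (2 ^ J * R) :=
            pow_le_pow_left₀ (by norm_num) (by norm_num) _
        _ ≤ (1 / 2) ^ R := pow_le_pow_of_le_one (by norm_num) (by norm_num)
            (Nat.le_mul_of_pos_left R (by positivity))
    obtain ⟨T, hT1, hT2⟩ := spread_round s I μ M κ (16 * κ) ((1 / 2) ^ R) (2 ^ J * R) hμ hM hp0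
      hκ1 hκ.le hspread (by positivity) (by
        intro i hi
        have hx : κ / (16 * κ) = 1 / 16 := by field_simp
        rw [hx]
        have hc := hcard i hi
        calc ∑ Z ∈ (M i).powerset with 2 ^ J * R < Z.card, ((1 : ℝ) / 16) ^ Z.card
            ≤ ∑ Z ∈ (M i).powerset with 2 ^ J * R < Z.card, ((1 : ℝ) / 16) ^ (2 ^ J * R) :=
              Finset.sum_le_sum fun Z hZ => pow_le_pow_of_le_one (by norm_num) (by norm_num)
                (Finset.mem_filter.1 hZ).2.le
          _ ≤ ∑ Z ∈ (M i).powerset, ((1 : ℝ) / 16) ^ (2 ^ J * R) :=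
              Finset.sum_le_sum_of_subset_of_nonneg (Finset.filter_subset _ _)
                fun _ _ _ => by positivity
          _ = 2 ^ (M i).card * (1 / 16) ^ (2 ^ J * R) := by simp [Finset.card_powerset]
          _ ≤ 2 ^ (2 * (2 ^ J * R)) * (1 / 16) ^ (2 ^ J * R) := by
              refine mul_le_mul_of_nonneg_right (pow_le_pow_right₀ (by norm_num) ?_)
                (by positivity)
              rw [pow_succ] at hc
              linarith
          _ = (1 / 4) ^ (2 ^ J * R) := by
              rw [pow_mul, ← mul_pow]; norm_num
          _ ≤ _ := hpow)
    have hmem := roundsDensity_mem hκ.le hκ1 hq.le hq1 J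
    simp only [roundsDensity]
    rw [← rexp_union]
    set E : ℝ := J * (1 / 2) ^ R + ((1 + κ / q) ^ R - 1) with hE
    calc ∑ i ∈ I, μ i = rexp s (16 * κ) (fun _ => ∑ i ∈ I, μ i) := (rexp_const _ _ _).symm
      _ ≤ rexp s (16 * κ) (fun W => (rexp s (roundsDensity κ q J)
            (fun W' => if ∃ i ∈ I, M i ⊆ W ∪ W' then 1 else 0) + E)
            + ∑ i ∈ I with 2 ^ J * R < (T W i).card, μ i) := by
          refine rexp_mono hp0.le hκ1 fun W _ => ?_
          rw [← Finset.sum_filter_add_sum_filter_not I (fun i => 2 ^ J * R < (T W i).card),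
            add_comm]
          refine add_le_add_left ?_ _
          refine (ih (I.filter fun i => ¬ 2 ^ J * R < (T W i).card) (T W)
            (fun i hi => hμ i (Finset.mem_filter.1 hi).1)
            (fun i hi => ((hT1 W i (Finset.mem_filter.1 hi).1).1).trans
              (hM i (Finset.mem_filter.1 hi).1))
            (fun i hi => not_lt.1 (Finset.mem_filter.1 hi).2) ?_).trans ?_
          · intro S hS
            refine le_trans ?_ (hspread S hS)
            refine Finset.sum_le_sum_of_subset_of_nonneg ?_
              fun i hi _ => hμ i (Finset.mem_filter.1 hi).1
            intro i hi
            simp only [Finset.mem_filter] at hi ⊢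
            exact ⟨hi.1.1, hi.2.trans (hT1 W i hi.1.1).1⟩
          · refine add_le_add_left (rexp_mono hmem.1 hmem.2.1 fun W' _ => ?_) _
            split_ifs with h1 h2 h2
            · exact le_rfl
            · obtain ⟨i, hi, hiW⟩ := h1
              obtain ⟨j, hj, hjW⟩ := (hT1 W i (Finset.mem_filter.1 hi).1).2
              exact absurd ⟨j, hj, hjW.trans (Finset.union_subset_union_right hiW)⟩ h2
            · exact zero_le_one
            · exact le_rfl
      _ ≤ _ := by
          rw [rexp_add, rexp_add, rexp_const]
          push_cast
          linarith

open Classical in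
/-- A `κ`-spread probability measure on sets of size at most `2 ^ J` has a member inside
a random set of density at least `17 J κ`. -/
lemma spread_lemma (s : Finset α) (κ q : ℝ) (J : ℕ) (hJ : 0 < J) (hκ : 0 < κ)
    (hq : 17 * J * κ ≤ q) (hq1 : q ≤ 1) (I : Finset ι) (μ : ι → ℝ) (M : ι → Finset α)
    (hμ : ∀ i ∈ I, 0 ≤ μ i) (hμ1 : ∑ i ∈ I, μ i = 1)
    (hM : ∀ i ∈ I, M i ⊆ s) (hcard : ∀ i ∈ I, (M i).card ≤ 2 ^ J)
    (hspread : ∀ S, S ⊆ s → ∑ i ∈ I with S ⊆ M i, μ i ≤ κ ^ S.card) :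
    1 - (J * (1 / 2) ^ (Nat.sqrt J) + ((1 + 1 / (J : ℝ)) ^ (Nat.sqrt J) - 1))
      ≤ rexp s q (fun W => if ∃ i ∈ I, M i ⊆ W then 1 else 0) := by
  have hJ' : (1 : ℝ) ≤ J := by exact_mod_cast hJ
  have hJκ : J * κ ≤ 1 := by nlinarith [mul_pos (lt_of_lt_of_le one_pos hJ') hκ]
  have hκ1 : 16 * κ ≤ 1 := by nlinarith
  have hJκ0 : 0 < J * κ := by positivity
  have hR : 0 < Nat.sqrt J := Nat.sqrt_pos.2 hJ
  have h := spread_rounds s κ (J * κ) (Nat.sqrt J) hκ hκ1 hJκ0 hJκ J I μ M hμ hM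
    (fun i hi => (hcard i hi).trans (Nat.le_mul_of_pos_right _ hR)) hspread
  have hmem := roundsDensity_mem hκ.le hκ1 hJκ0.le hJκ J
  have hmono := rexp_mono_prob (s := s) hmem.1 (hmem.2.2.trans (by linarith)) hq1
    (f := fun W => if ∃ i ∈ I, M i ⊆ W then 1 else 0) (by
      intro W W' hW
      dsimp only
      split_ifs with h1 h2 h2
      · exact le_rfl
      · obtain ⟨i, hi, hiW⟩ := h1
        exact absurd ⟨i, hi, hiW.trans hW⟩ h2
      · exact zero_le_one
      · exact le_rfl)
  have hx : κ / (J * κ) = 1 / (J : ℝ) := by field_simp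
  rw [hμ1, hx] at h
  linarith

end Spread

/-! ### Coupling random families of copies with random sets of edges -/

section Coupling

variable {β : Type*} [DecidableEq β]

/-- The copies in `σ` are all contained in `W` and those in `B` are not. -/
def TestResult (σ B : Finset (Finset β)) (W : Finset β) : Prop :=
  σ.biUnion id ⊆ W ∧ ∀ b ∈ B, ¬ b ⊆ W

/-- The total conditional probability of the copies that interact with `c`,
given that all copies in `σ` are present. -/
noncomputable def interaction (𝓒 : Finset (Finset β)) (p : ℝ) (σ : Finset (Finset β))
    (c : Finset β) : ℝ :=
  ∑ b ∈ 𝓒 with b ∉ σ ∧ b ≠ c ∧ ¬ b ∩ c ⊆ σ.biUnion id, p ^ (b \ (σ.biUnion id ∪ c)).card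

open Classical in
/-- Probability of a test result. -/
noncomputable def testProb (G : Finset β) (p : ℝ) (σ B : Finset (Finset β)) : ℝ :=
  rexp G p fun W => if TestResult σ B W then 1 else 0

open Classical in
lemma testProb_eq (G : Finset β) (p : ℝ) (σ B : Finset (Finset β)) (hσ : σ.biUnion id ⊆ G) :
    testProb G p σ B = p ^ (σ.biUnion id).card *
      rexp G p fun W => if ∀ b ∈ B, ¬ b ⊆ W ∪ σ.biUnion id then 1 else 0 := by
  rw [testProb, ← rexp_superset G p _ hσ (fun W => if ∀ b ∈ B, ¬ b ⊆ W then (1 : ℝ) else 0)]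
  refine rexp_congr fun W _ => ?_
  by_cases hA : σ.biUnion id ⊆ W <;> by_cases hB : ∀ b ∈ B, ¬ b ⊆ W <;>
    simp [TestResult, hA, hB]

lemma testProb_nonneg (G : Finset β) {p : ℝ} (h0 : 0 ≤ p) (h1 : p ≤ 1)
    (σ B : Finset (Finset β)) : 0 ≤ testProb G p σ B :=
  rexp_nonneg h0 h1 fun W _ => by positivity

lemma testResult_insert_left {σ B : Finset (Finset β)} {c W : Finset β} :
    TestResult (insert c σ) B W ↔ TestResult σ B W ∧ c ⊆ W := by
  simp only [TestResult, Finset.biUnion_insert, Finset.union_subset_iff, id]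
  tauto

lemma testResult_insert_right {σ B : Finset (Finset β)} {c W : Finset β} :
    TestResult σ (insert c B) W ↔ TestResult σ B W ∧ ¬ c ⊆ W := by
  simp only [TestResult, Finset.forall_mem_insert]
  tauto

open Classical in
lemma testProb_split (G : Finset β) (p : ℝ) (σ B : Finset (Finset β)) (c : Finset β) :
    testProb G p σ B = testProb G p (insert c σ) B + testProb G p σ (insert c B) := by
  rw [testProb, testProb, testProb, ← rexp_add]
  refine rexp_congr fun W _ => ?_
  simp only [testResult_insert_left, testResult_insert_right]
  by_cases h : TestResult σ B W <;> by_cases h' : c ⊆ W <;> simp [h, h']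

open Classical in
lemma testProb_insert_ge {G : Finset β} {p : ℝ} (h0 : 0 ≤ p) (h1 : p ≤ 1)
    {𝓒 σ B : Finset (Finset β)} {c : Finset β} (hG : ∀ b ∈ 𝓒, b ⊆ G) (hc : c ∈ 𝓒)
    (hσ : σ ⊆ 𝓒) (hB : ∀ b ∈ B, b ∈ 𝓒 ∧ b ∉ σ ∧ b ≠ c)
    (hinter : interaction 𝓒 p σ c ≤ 1 / 2) :
    p ^ c.card / 2 * testProb G p σ B ≤ testProb G p (insert c σ) B := by
  have hR : σ.biUnion id ⊆ G := Finset.biUnion_subset.2 fun b hb => hG b (hσ hb)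
  have hR' : (insert c σ).biUnion id ⊆ G := Finset.biUnion_subset.2 fun b hb =>
    (Finset.mem_insert.1 hb).elim (fun h => h ▸ hG c hc) fun h => hG b (hσ h)
  rw [testProb_eq G p σ B hR, testProb_eq G p _ B hR']
  have hRc : (insert c σ).biUnion id = σ.biUnion id ∪ c := by
    rw [Finset.biUnion_insert, Finset.union_comm]; rfl
  rw [hRc] at hR' ⊢
  set R := σ.biUnion id with hRdef
  set f0 : Finset β → ℝ := fun W => if ∀ b ∈ B, b ∩ c ⊆ R → ¬ b ⊆ W ∪ (R ∪ c) then 1 else 0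
    with hf0
  set f1 : Finset β → ℝ := fun W => if ∀ b ∈ B, ¬ b ∩ c ⊆ R → ¬ b ⊆ W ∪ (R ∪ c) then 1 else 0
    with hf1
  have anti0 : Antitone f0 := by
    intro W W' hW
    simp only [hf0]
    have := Finset.union_subset_union_left (t := R ∪ c) hW
    split_ifs with ha hb <;> norm_num
    exact hb fun b hb h1 h2 => ha b hb h1 (h2.trans this)
  have anti1 : Antitone f1 := by
    intro W W' hW
    simp only [hf1]
    have := Finset.union_subset_union_left (t := R ∪ c) hW
    split_ifs with ha hb <;> norm_num
    exact hb fun b hb h1 h2 => ha b hb h1 (h2.trans this)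
  have hprod : rexp G p (fun W => if ∀ b ∈ B, ¬ b ⊆ W ∪ (R ∪ c) then (1 : ℝ) else 0)
      = rexp G p (fun W => f0 W * f1 W) := by
    refine rexp_congr fun W _ => ?_
    simp only [hf0, hf1]
    rw [ite_zero_mul_ite_zero, mul_one]
    refine if_congr ⟨fun ha => ⟨fun b hb _ => ha b hb, fun b hb _ => ha b hb⟩,
      fun ha b hb => ?_⟩ rfl rfl
    by_cases h : b ∩ c ⊆ R
    exacts [ha.1 b hb h, ha.2 b hb h]
  have hle0 : rexp G p (fun W => if ∀ b ∈ B, ¬ b ⊆ W ∪ R then (1 : ℝ) else 0) ≤ rexp G p f0 := by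
    refine rexp_mono h0 h1 fun W _ => ?_
    simp only [hf0]
    split_ifs with ha hb <;> norm_num
    refine hb fun b hb hbc hsub => ha b hb fun x hx => ?_
    have := hsub hx
    simp only [Finset.mem_union] at this ⊢
    rcases this with h | h | h
    · exact .inl h
    · exact .inr h
    · exact .inr (hbc (Finset.mem_inter.2 ⟨hx, h⟩))
  have hle1 : 1 / 2 ≤ rexp G p f1 := by
    have : 1 - interaction 𝓒 p σ c ≤ rexp G p f1 := by
      have e1 : interaction 𝓒 p σ c = ∑ b ∈ 𝓒 with b ∉ σ ∧ b ≠ c ∧ ¬ b ∩ c ⊆ R,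
          rexp G p (fun W => if b \ (R ∪ c) ⊆ W then 1 else 0) := by
        refine Finset.sum_congr rfl fun b hb => ?_
        rw [rexp_subset_prob]
        exact Finset.sdiff_subset.trans (hG b (Finset.mem_filter.1 hb).1)
      have e2 : 1 - interaction 𝓒 p σ c = rexp G p (fun W => 1 -
          ∑ b ∈ 𝓒 with b ∉ σ ∧ b ≠ c ∧ ¬ b ∩ c ⊆ R, if b \ (R ∪ c) ⊆ W then 1 else 0) := by
        rw [e1, rexp_sub, rexp_const, rexp_sum]
      rw [e2]
      refine rexp_mono h0 h1 fun W _ => ?_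
      simp only [hf1]
      split_ifs with ha
      · have : 0 ≤ ∑ b ∈ 𝓒 with b ∉ σ ∧ b ≠ c ∧ ¬ b ∩ c ⊆ R,
          (if b \ (R ∪ c) ⊆ W then (1 : ℝ) else 0) := Finset.sum_nonneg fun b _ => by positivity
        linarith
      · push Not at ha
        obtain ⟨b, hb, hbc, hbW⟩ := ha
        have hmem : b ∈ {b ∈ 𝓒 | b ∉ σ ∧ b ≠ c ∧ ¬ b ∩ c ⊆ R} :=
          Finset.mem_filter.2 ⟨(hB b hb).1, (hB b hb).2.1, (hB b hb).2.2, hbc⟩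
        have := Finset.single_le_sum (f := fun b => if b \ (R ∪ c) ⊆ W then (1 : ℝ) else 0)
          (fun b _ => by positivity) hmem
        have hbW' : b \ (R ∪ c) ⊆ W := by
          intro x hx
          rw [Finset.mem_sdiff] at hx
          exact (Finset.mem_union.1 (hbW hx.1)).resolve_right hx.2
        simp only [hbW', if_true] at this
        linarith
    linarith
  rw [hprod]
  have hH := rexp_mul_le_of_antitone (s := G) h0 h1 anti0 anti1
  have hf0n : 0 ≤ rexp G p (fun W => if ∀ b ∈ B, ¬ b ⊆ W ∪ R then (1 : ℝ) else 0) :=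
    rexp_nonneg h0 h1 fun W _ => by positivity
  have hpow : p ^ R.card * p ^ c.card ≤ p ^ (R ∪ c).card := by
    rw [← pow_add]
    exact pow_le_pow_of_le_one h0 h1 (Finset.card_union_le _ _)
  calc p ^ c.card / 2 * (p ^ R.card * rexp G p _)
      = (p ^ R.card * p ^ c.card) *
        (rexp G p (fun W => if ∀ b ∈ B, ¬ b ⊆ W ∪ R then (1 : ℝ) else 0) * (1 / 2)) := by ring
    _ ≤ p ^ (R ∪ c).card * (rexp G p f0 * rexp G p f1) := by
        gcongr
        exact hf0n.trans hle0
    _ ≤ _ := by gcongr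

open Classical in
/-- Probability of two test results, in independent random sets, that moreover together
contain a family satisfying `Q`. -/
noncomputable def jointProb (G : Finset β) (p : ℝ) (Q : Finset (Finset β) → Prop)
    (σ₁ B₁ σ₂ B₂ : Finset (Finset β)) : ℝ :=
  rexp G p fun W₁ => rexp G p fun W₂ =>
    if TestResult σ₁ B₁ W₁ ∧ TestResult σ₂ B₂ W₂ ∧ ∃ S, Q S ∧ ∀ c ∈ S, c ⊆ W₁ ∨ c ⊆ W₂
    then 1 else 0

open Classical in
lemma jointProb_split_left (G : Finset β) (p : ℝ) (Q : Finset (Finset β) → Prop)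
    (σ₁ B₁ σ₂ B₂ : Finset (Finset β)) (c : Finset β) :
    jointProb G p Q σ₁ B₁ σ₂ B₂ =
      jointProb G p Q (insert c σ₁) B₁ σ₂ B₂ + jointProb G p Q σ₁ (insert c B₁) σ₂ B₂ := by
  rw [jointProb, jointProb, jointProb, ← rexp_add]
  refine rexp_congr fun W _ => ?_
  rw [← rexp_add]
  refine rexp_congr fun W' _ => ?_
  simp only [testResult_insert_left, testResult_insert_right]
  by_cases h : TestResult σ₁ B₁ W <;> by_cases h' : c ⊆ W <;> simp [h, h']

open Classical in
lemma jointProb_split_right (G : Finset β) (p : ℝ) (Q : Finset (Finset β) → Prop)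
    (σ₁ B₁ σ₂ B₂ : Finset (Finset β)) (c : Finset β) :
    jointProb G p Q σ₁ B₁ σ₂ B₂ =
      jointProb G p Q σ₁ B₁ (insert c σ₂) B₂ + jointProb G p Q σ₁ B₁ σ₂ (insert c B₂) := by
  rw [jointProb, jointProb, jointProb, ← rexp_add]
  refine rexp_congr fun W _ => ?_
  rw [← rexp_add]
  refine rexp_congr fun W' _ => ?_
  simp only [testResult_insert_left, testResult_insert_right]
  by_cases h : TestResult σ₂ B₂ W' <;> by_cases h' : c ⊆ W' <;> simp [h, h']

open Classical in
lemma testProb_mul_le_jointProb {G : Finset β} {p : ℝ} (h0 : 0 ≤ p) (h1 : p ≤ 1) {e : ℕ}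
    {𝓒 : Finset (Finset β)} (hG : ∀ b ∈ 𝓒, b ⊆ G) (hcard : ∀ b ∈ 𝓒, b.card = e)
    (Q Good : Finset (Finset β) → Prop) (hanti : ∀ S T, S ⊆ T → Good T → Good S)
    (hgood : ∀ σ₁ σ₂ c, σ₁ ⊆ 𝓒 → σ₂ ⊆ 𝓒 → Disjoint σ₁ σ₂ → c ∈ 𝓒 → c ∉ σ₁ → c ∉ σ₂ →
      Good (insert c (σ₁ ∪ σ₂)) →
      interaction 𝓒 p σ₁ c ≤ 1 / 2 ∨ interaction 𝓒 p σ₂ c ≤ 1 / 2)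
    (L : Finset (Finset β)) : ∀ (_ : L ⊆ 𝓒) (σ₁ B₁ σ₂ B₂ : Finset (Finset β)),
      σ₁ ⊆ 𝓒 → σ₂ ⊆ 𝓒 → B₁ ⊆ 𝓒 → B₂ ⊆ 𝓒 → Disjoint σ₁ σ₂ → Disjoint B₁ σ₁ → Disjoint B₂ σ₂ →
      Disjoint L σ₁ → Disjoint L σ₂ → Disjoint L B₁ → Disjoint L B₂ →
      testProb G p σ₁ B₁ * testProb G p σ₂ B₂ *
        rexp L (p ^ e / 2) (fun ξ => if Q (σ₁ ∪ σ₂ ∪ ξ) ∧ Good (σ₁ ∪ σ₂ ∪ ξ) then 1 else 0) ≤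
      jointProb G p Q σ₁ B₁ σ₂ B₂ := by
  have hπ0 : 0 ≤ p ^ e / 2 := by positivity
  have hπ1 : p ^ e / 2 ≤ 1 := by
    have := pow_le_one₀ (n := e) h0 h1
    linarith
  induction L using Finset.induction_on with
  | empty =>
    intro _ σ₁ B₁ σ₂ B₂ _ _ _ _ _ _ _ _ _ _ _
    rw [rexp_empty, Finset.union_empty]
    split_ifs with hQ
    · rw [mul_one, testProb, testProb, ← rexp_mul_const, jointProb]
      refine rexp_mono h0 h1 fun W₁ _ => ?_
      rw [← rexp_const_mul]
      refine rexp_mono h0 h1 fun W₂ _ => ?_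
      split_ifs with ha hb hc hd <;> norm_num
      refine hc ⟨ha, hb, σ₁ ∪ σ₂, hQ.1, fun c hc => ?_⟩
      rcases Finset.mem_union.1 hc with h | h
      · exact .inl ((Finset.subset_biUnion_of_mem id h).trans ha.1)
      · exact .inr ((Finset.subset_biUnion_of_mem id h).trans hb.1)
    · rw [mul_zero]
      exact rexp_nonneg h0 h1 fun W₁ _ => rexp_nonneg h0 h1 fun W₂ _ => by positivity
  | insert c L hcL ih =>
    intro hL σ₁ B₁ σ₂ B₂ hσ₁ hσ₂ hB₁ hB₂ hσ hd₁ hd₂ hLσ₁ hLσ₂ hLB₁ hLB₂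
    obtain ⟨hcC, hLC⟩ := Finset.insert_subset_iff.1 hL
    rw [Finset.disjoint_insert_left] at hLσ₁ hLσ₂ hLB₁ hLB₂
    have hrec := fun π : ℝ => rexp_insert hcL π
      (fun ξ => if Q (σ₁ ∪ σ₂ ∪ ξ) ∧ Good (σ₁ ∪ σ₂ ∪ ξ) then (1 : ℝ) else 0)
    rw [hrec]
    set g0 := rexp L (p ^ e / 2)
      (fun ξ => if Q (σ₁ ∪ σ₂ ∪ ξ) ∧ Good (σ₁ ∪ σ₂ ∪ ξ) then (1 : ℝ) else 0) with hg0
    set g1 := rexp L (p ^ e / 2) (fun ξ => if Q (σ₁ ∪ σ₂ ∪ insert c ξ) ∧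
      Good (σ₁ ∪ σ₂ ∪ insert c ξ) then (1 : ℝ) else 0) with hg1
    have hg0n : 0 ≤ g0 := rexp_nonneg hπ0 hπ1 fun W _ => by positivity
    have ht₁ := testProb_nonneg G h0 h1 σ₁ B₁
    have ht₂ := testProb_nonneg G h0 h1 σ₂ B₂
    by_cases hskip : g1 ≤ g0
    · refine le_trans ?_ (ih hLC σ₁ B₁ σ₂ B₂ hσ₁ hσ₂ hB₁ hB₂ hσ hd₁ hd₂ hLσ₁.2 hLσ₂.2 hLB₁.2
        hLB₂.2)
      refine mul_le_mul_of_nonneg_left ?_ (mul_nonneg ht₁ ht₂)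
      nlinarith
    · have hG' : Good (insert c (σ₁ ∪ σ₂)) := by
        by_contra hbad
        refine hskip ?_
        have : g1 = 0 := by
          refine (rexp_congr fun W _ => ?_).trans (rexp_const L (p ^ e / 2) 0)
          rw [if_neg]
          rintro ⟨_, h⟩
          refine hbad (hanti _ _ ?_ h)
          rw [Finset.union_insert]
          exact Finset.insert_subset_insert _ Finset.subset_union_left
        rw [this]; exact hg0n
      have hfin : ∀ x t : ℝ, p ^ e / 2 * t ≤ x →
          t * (p ^ e / 2 * g1 + (1 - p ^ e / 2) * g0) ≤ x * g1 + (t - x) * g0 := by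
        intro x t hx
        nlinarith
      rcases hgood σ₁ σ₂ c hσ₁ hσ₂ hσ hcC hLσ₁.1 hLσ₂.1 hG' with hi | hi
      · have key := testProb_insert_ge (B := B₁) h0 h1 hG hcC hσ₁ (fun b hb =>
          ⟨hB₁ hb, Finset.disjoint_left.1 hd₁ hb, fun h => hLB₁.1 (h ▸ hb)⟩) hi
        rw [hcard c hcC] at key
        have i1 := ih hLC (insert c σ₁) B₁ σ₂ B₂ (Finset.insert_subset hcC hσ₁) hσ₂ hB₁ hB₂
          (Finset.disjoint_insert_left.2 ⟨hLσ₂.1, hσ⟩)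
          (Finset.disjoint_insert_right.2 ⟨hLB₁.1, hd₁⟩) hd₂
          (Finset.disjoint_insert_right.2 ⟨hcL, hLσ₁.2⟩) hLσ₂.2 hLB₁.2 hLB₂.2
        have i2 := ih hLC σ₁ (insert c B₁) σ₂ B₂ hσ₁ hσ₂ (Finset.insert_subset hcC hB₁) hB₂ hσ
          (Finset.disjoint_insert_left.2 ⟨hLσ₁.1, hd₁⟩) hd₂ hLσ₁.2 hLσ₂.2
          (Finset.disjoint_insert_right.2 ⟨hcL, hLB₁.2⟩) hLB₂.2
        have hu : ∀ ξ, insert c σ₁ ∪ σ₂ ∪ ξ = σ₁ ∪ σ₂ ∪ insert c ξ := fun ξ => by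
          ext; simp
        simp only [hu] at i1
        rw [← hg1] at i1
        rw [← hg0] at i2
        rw [jointProb_split_left G p Q σ₁ B₁ σ₂ B₂ c]
        have hs := testProb_split G p σ₁ B₁ c
        have := mul_le_mul_of_nonneg_left (hfin _ _ key) ht₂
        have e2 : testProb G p σ₁ (insert c B₁) =
          testProb G p σ₁ B₁ - testProb G p (insert c σ₁) B₁ := by linarith
        rw [e2] at i2
        linarith
      · have key := testProb_insert_ge (B := B₂) h0 h1 hG hcC hσ₂ (fun b hb =>
          ⟨hB₂ hb, Finset.disjoint_left.1 hd₂ hb, fun h => hLB₂.1 (h ▸ hb)⟩) hi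
        rw [hcard c hcC] at key
        have i1 := ih hLC σ₁ B₁ (insert c σ₂) B₂ hσ₁ (Finset.insert_subset hcC hσ₂) hB₁ hB₂
          (Finset.disjoint_insert_right.2 ⟨hLσ₁.1, hσ⟩) hd₁
          (Finset.disjoint_insert_right.2 ⟨hLB₂.1, hd₂⟩) hLσ₁.2
          (Finset.disjoint_insert_right.2 ⟨hcL, hLσ₂.2⟩) hLB₁.2 hLB₂.2
        have i2 := ih hLC σ₁ B₁ σ₂ (insert c B₂) hσ₁ hσ₂ hB₁ (Finset.insert_subset hcC hB₂) hσ
          hd₁ (Finset.disjoint_insert_left.2 ⟨hLσ₂.1, hd₂⟩) hLσ₁.2 hLσ₂.2 hLB₁.2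
          (Finset.disjoint_insert_right.2 ⟨hcL, hLB₂.2⟩)
        have hu : ∀ ξ, σ₁ ∪ insert c σ₂ ∪ ξ = σ₁ ∪ σ₂ ∪ insert c ξ := fun ξ => by
          ext; simp
        simp only [hu] at i1
        rw [← hg1] at i1
        rw [← hg0] at i2
        rw [jointProb_split_right G p Q σ₁ B₁ σ₂ B₂ c]
        have hs := testProb_split G p σ₂ B₂ c
        have := mul_le_mul_of_nonneg_left (hfin _ _ key) ht₁
        have e2 : testProb G p σ₂ (insert c B₂) =
          testProb G p σ₂ B₂ - testProb G p (insert c σ₂) B₂ := by linarith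
        rw [e2] at i2
        linarith

open Classical in
/-- A random family of copies with density `p ^ e / 2` that satisfies `Q` and is well-behaved
can be realised inside a random edge set of density `2 * p - p ^ 2`. -/
theorem rexp_copies_le_rexp_edges {G : Finset β} {p : ℝ} (h0 : 0 ≤ p) (h1 : p ≤ 1) {e : ℕ}
    {𝓒 : Finset (Finset β)} (hG : ∀ b ∈ 𝓒, b ⊆ G) (hcard : ∀ b ∈ 𝓒, b.card = e)
    (Q Good : Finset (Finset β) → Prop) (hanti : ∀ S T, S ⊆ T → Good T → Good S)
    (hgood : ∀ σ₁ σ₂ c, σ₁ ⊆ 𝓒 → σ₂ ⊆ 𝓒 → Disjoint σ₁ σ₂ → c ∈ 𝓒 → c ∉ σ₁ → c ∉ σ₂ →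
      Good (insert c (σ₁ ∪ σ₂)) →
      interaction 𝓒 p σ₁ c ≤ 1 / 2 ∨ interaction 𝓒 p σ₂ c ≤ 1 / 2) :
    rexp 𝓒 (p ^ e / 2) (fun S => if Q S ∧ Good S then 1 else 0) ≤
      rexp G (2 * p - p ^ 2) (fun W => if ∃ S, Q S ∧ ∀ c ∈ S, c ⊆ W then 1 else 0) := by
  have key := testProb_mul_le_jointProb h0 h1 hG hcard Q Good hanti hgood 𝓒 subset_rfl
    ∅ ∅ ∅ ∅ (by simp) (by simp) (by simp) (by simp) (by simp) (by simp) (by simp) (by simp)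
    (by simp) (by simp) (by simp)
  have ht : testProb G p ∅ ∅ = 1 := by
    refine (rexp_congr fun W _ => ?_).trans (rexp_const G p 1)
    simp [TestResult]
  simp only [ht, one_mul, Finset.empty_union] at key
  refine key.trans ?_
  rw [show 2 * p - p ^ 2 = p + p - p * p by ring, ← rexp_union]
  refine rexp_mono h0 h1 fun W₁ _ => rexp_mono h0 h1 fun W₂ _ => ?_
  split_ifs with ha hb <;> norm_num
  obtain ⟨_, _, S, hQ, hS⟩ := ha
  exact hb ⟨S, hQ, fun c hc => (hS c hc).elim (fun h => h.trans Finset.subset_union_left)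
    fun h => h.trans Finset.subset_union_right⟩

end Coupling

/-! ### A local lemma for random bijections -/

section Bijections

variable {A V : Type*} [Fintype A] [Fintype V] [DecidableEq A] [DecidableEq V]

/-- The bijection `σ` extends the partial assignment `T`. -/
def Agrees (T : Finset (A × V)) (σ : A ≃ V) : Prop := ∀ x ∈ T, σ x.1 = x.2

/-- Two partial assignments share a position or a value. -/
def Touches (T B : Finset (A × V)) : Prop := ∃ x ∈ T, ∃ y ∈ B, x.1 = y.1 ∨ x.2 = y.2

open Classical in
/-- The number of bijections that extend `T` and do not extend any element of `𝓑`. -/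
noncomputable def bijCount (T : Finset (A × V)) (𝓑 : Finset (Finset (A × V))) : ℕ :=
  (Finset.univ.filter fun σ : A ≃ V => Agrees T σ ∧ ∀ B ∈ 𝓑, ¬ Agrees B σ).card

lemma bijCount_anti_right (T : Finset (A × V)) {𝓑 𝓑' : Finset (Finset (A × V))} (h : 𝓑' ⊆ 𝓑) :
    bijCount T 𝓑 ≤ bijCount T 𝓑' := by
  classical
  refine Finset.card_le_card fun σ hσ => ?_
  simp only [Finset.mem_filter, Finset.mem_univ, true_and] at hσ ⊢
  exact ⟨hσ.1, fun B hB => hσ.2 B (h hB)⟩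

lemma bijCount_insert_right (𝓑 : Finset (Finset (A × V))) (B : Finset (A × V)) :
    bijCount ∅ 𝓑 = bijCount ∅ (insert B 𝓑) + bijCount B 𝓑 := by
  classical
  rw [bijCount, bijCount, bijCount, ← Finset.card_union_of_disjoint]
  · congr 1
    ext σ
    have : Agrees ∅ σ := fun x hx => absurd hx (Finset.notMem_empty x)
    simp only [Finset.mem_filter, Finset.mem_univ, true_and, Finset.mem_union,
      Finset.forall_mem_insert]
    tauto
  · rw [Finset.disjoint_left]
    intro σ
    simp only [Finset.mem_filter, Finset.mem_univ, true_and, Finset.forall_mem_insert]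
    tauto

/-- Swapping values bounds the number of extensions of one more pair. -/
lemma bijCount_insert_left_mul_le {T : Finset (A × V)} {a : A} {v : V}
    (ha : ∀ x ∈ T, x.1 ≠ a) {𝓑 : Finset (Finset (A × V))}
    (hB : ∀ B ∈ 𝓑, ∀ y ∈ B, y.1 ≠ a ∧ y.2 ≠ v) :
    bijCount (insert (a, v) T) 𝓑 * (Fintype.card A - T.card) ≤ bijCount T 𝓑 := by
  classical
  have hcard : Fintype.card A - T.card ≤ (Finset.univ \ T.image Prod.fst).card := by
    rw [Finset.card_univ_sdiff]
    exact Nat.sub_le_sub_left Finset.card_image_le _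
  refine (Nat.mul_le_mul_left _ hcard).trans ?_
  rw [bijCount, bijCount, ← Finset.card_product]
  refine Finset.card_le_card_of_injOn (fun z => (Equiv.swap a z.2).trans z.1) ?_ ?_
  · rintro ⟨σ, b⟩ hz
    simp only [Finset.coe_product, Set.mem_prod, Finset.mem_coe, Finset.mem_filter,
      Finset.mem_univ, true_and, Finset.mem_sdiff, Finset.mem_image, not_exists, not_and] at hz
    obtain ⟨⟨hT, hσ⟩, hb⟩ := hz
    have hav : σ a = v := hT _ (Finset.mem_insert_self _ _)
    simp only [Finset.mem_coe, Finset.mem_filter, Finset.mem_univ, true_and]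
    refine ⟨fun x hx => ?_, fun B hBm hag => hσ B hBm fun y hy => ?_⟩
    · rw [Equiv.trans_apply, Equiv.swap_apply_of_ne_of_ne (ha x hx) (hb x hx)]
      exact hT x (Finset.mem_insert_of_mem hx)
    · have h1 := hag y hy
      rw [Equiv.trans_apply] at h1
      by_cases hyb : y.1 = b
      · rw [hyb, Equiv.swap_apply_right, hav] at h1
        exact absurd h1.symm (hB B hBm y hy).2
      · rwa [Equiv.swap_apply_of_ne_of_ne (hB B hBm y hy).1 hyb] at h1
  · rintro ⟨σ, b⟩ hz ⟨σ', b'⟩ hz' h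
    simp only [Finset.coe_product, Set.mem_prod, Finset.mem_coe, Finset.mem_filter,
      Finset.mem_univ, true_and] at hz hz' h
    have hav : σ a = v := hz.1.1 _ (Finset.mem_insert_self _ _)
    have hav' : σ' a = v := hz'.1.1 _ (Finset.mem_insert_self _ _)
    have h1 := congrArg (fun τ : A ≃ V => τ.symm v) h
    have e1 : ((Equiv.swap a b).trans σ).symm v = b := by
      rw [Equiv.symm_apply_eq, Equiv.trans_apply, Equiv.swap_apply_right, hav]
    have e2 : ((Equiv.swap a b').trans σ').symm v = b' := by
      rw [Equiv.symm_apply_eq, Equiv.trans_apply, Equiv.swap_apply_right, hav']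
    simp only [e1, e2] at h1
    subst h1
    refine Prod.ext ?_ rfl
    ext x
    have := congrArg (fun τ : A ≃ V => τ (Equiv.swap a b x)) h
    simpa using this

/-- Partial assignments that are injective. -/
def PartialInj (T : Finset (A × V)) : Prop := ∀ x ∈ T, ∀ y ∈ T, x.1 = y.1 → x = y

lemma bijCount_mul_descFactorial_le {T : Finset (A × V)} (hT : PartialInj T)
    {𝓑 : Finset (Finset (A × V))} (hB : ∀ B ∈ 𝓑, ¬ Touches T B) :
    bijCount T 𝓑 * (Fintype.card A).descFactorial T.card ≤ bijCount ∅ 𝓑 := by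
  classical
  induction T using Finset.induction_on with
  | empty => simp
  | insert x T hx ih =>
    obtain ⟨a, v⟩ := x
    rw [Finset.card_insert_of_notMem hx, Nat.descFactorial_succ, ← mul_assoc]
    refine le_trans (Nat.mul_le_mul_right _ (bijCount_insert_left_mul_le ?_ ?_)) (ih ?_ ?_)
    · intro y hy h
      have := hT _ (Finset.mem_insert_of_mem hy) _ (Finset.mem_insert_self _ _) h
      exact hx (this ▸ hy)
    · intro B hBm y hy
      have := hB B hBm
      simp only [Touches, not_exists, not_and, not_or] at this
      have := this _ (Finset.mem_insert_self _ _) y hy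
      exact ⟨fun h => this.1 h.symm, fun h => this.2 h.symm⟩
    · exact fun y hy z hz => hT y (Finset.mem_insert_of_mem hy) z (Finset.mem_insert_of_mem hz)
    · rintro B hBm ⟨y, hy, z, hz, h⟩
      exact hB B hBm ⟨y, Finset.mem_insert_of_mem hy, z, hz, h⟩

/-- The probability that a random bijection extends a given partial injection of size `#T`. -/
noncomputable def assignWeight (T : Finset (A × V)) : ℝ :=
  (((Fintype.card A).descFactorial T.card : ℕ) : ℝ)⁻¹

lemma assignWeight_nonneg (T : Finset (A × V)) : 0 ≤ assignWeight T := by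
  unfold assignWeight; positivity

lemma PartialInj.card_le {T : Finset (A × V)} (hT : PartialInj T) : T.card ≤ Fintype.card A := by
  classical
  rw [← Finset.card_univ (α := A), ← Finset.card_image_of_injOn (f := Prod.fst) (s := T)
    (fun x hx y hy h => hT x hx y hy h)]
  exact Finset.card_le_univ _

lemma bijCount_le_assignWeight_mul {T : Finset (A × V)} (hT : PartialInj T)
    {𝓑 : Finset (Finset (A × V))} (hB : ∀ B ∈ 𝓑, ¬ Touches T B) :
    (bijCount T 𝓑 : ℝ) ≤ assignWeight T * bijCount ∅ 𝓑 := by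
  have hpos : (0 : ℝ) < ((Fintype.card A).descFactorial T.card : ℕ) := by
    exact_mod_cast Nat.descFactorial_pos.2 hT.card_le
  rw [assignWeight, inv_mul_eq_div, le_div_iff₀ hpos]
  exact_mod_cast bijCount_mul_descFactorial_le hT hB

lemma bijCount_empty_ge (𝓡 𝓝 : Finset (Finset (A × V))) :
    (bijCount ∅ 𝓡 : ℝ) - ∑ B ∈ 𝓝, (bijCount B 𝓡 : ℝ) ≤ bijCount ∅ (𝓝 ∪ 𝓡) := by
  classical
  induction 𝓝 using Finset.induction_on with
  | empty => simp
  | insert B 𝓝 hB ih =>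
    rw [Finset.sum_insert hB, Finset.insert_union]
    have h1 := bijCount_insert_right (𝓝 ∪ 𝓡) B
    have h2 := bijCount_anti_right B (Finset.subset_union_right (s₁ := 𝓝) (s₂ := 𝓡))
    have h1' : (bijCount ∅ (𝓝 ∪ 𝓡) : ℝ) =
      bijCount ∅ (insert B (𝓝 ∪ 𝓡)) + bijCount B (𝓝 ∪ 𝓡) := by exact_mod_cast h1
    have h2' : (bijCount B (𝓝 ∪ 𝓡) : ℝ) ≤ bijCount B 𝓡 := by exact_mod_cast h2
    linarith

open Classical in
/-- Total weight of the elements of `𝓑` touching `T`. -/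
noncomputable def touchWeight (𝓑 : Finset (Finset (A × V))) (T : Finset (A × V)) : ℝ :=
  ∑ B ∈ 𝓑 with Touches T B, assignWeight B

section LocalLemma

variable {𝓑 : Finset (Finset (A × V))}

lemma bijCount_le_two_mul (hinj : ∀ B ∈ 𝓑, PartialInj B)
    (hw : ∀ B ∈ 𝓑, touchWeight 𝓑 B ≤ 1 / 4) (N : ℕ) :
    ∀ 𝓑' ⊆ 𝓑, 𝓑'.card ≤ N → ∀ B ∈ 𝓑,
      (bijCount B 𝓑' : ℝ) ≤ 2 * assignWeight B * bijCount ∅ 𝓑' := by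
  classical
  induction N with
  | zero =>
    intro 𝓑' _ hc B hB
    obtain rfl : 𝓑' = ∅ := Finset.card_eq_zero.1 (Nat.le_zero.1 hc)
    have h1 := bijCount_le_assignWeight_mul (𝓑 := ∅) (hinj B hB) (by simp)
    have h2 : 0 ≤ assignWeight B * (bijCount ∅ (∅ : Finset (Finset (A × V))) : ℝ) :=
      mul_nonneg (assignWeight_nonneg B) (Nat.cast_nonneg _)
    linarith
  | succ N ih =>
    intro 𝓑' hsub hc B hB
    set 𝓝 := 𝓑'.filter fun B' => Touches B B' with h𝓝
    set 𝓡 := 𝓑'.filter fun B' => ¬ Touches B B' with h𝓡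
    have hunion : 𝓝 ∪ 𝓡 = 𝓑' := Finset.filter_union_filter_not_eq _ _
    have h1 : (bijCount B 𝓑' : ℝ) ≤ bijCount B 𝓡 := by
      exact_mod_cast bijCount_anti_right B (Finset.filter_subset _ _)
    have h2 := bijCount_le_assignWeight_mul (𝓑 := 𝓡) (hinj B hB)
      (fun B' hB' => (Finset.mem_filter.1 hB').2)
    have hge : (1 / 2 : ℝ) * bijCount ∅ 𝓡 ≤ bijCount ∅ 𝓑' := by
      rcases 𝓝.eq_empty_or_nonempty with he | hne
      · rw [he, Finset.empty_union] at hunion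
        rw [hunion]
        have : (0 : ℝ) ≤ bijCount ∅ 𝓑' := Nat.cast_nonneg _
        linarith
      · have hcard : 𝓡.card ≤ N := by
          have : 𝓝.card + 𝓡.card = 𝓑'.card := Finset.card_filter_add_card_filter_not _
          have := hne.card_pos
          omega
        have h3 := bijCount_empty_ge 𝓡 𝓝
        rw [hunion] at h3
        have h4 : ∑ B' ∈ 𝓝, (bijCount B' 𝓡 : ℝ) ≤
            ∑ B' ∈ 𝓝, 2 * assignWeight B' * bijCount ∅ 𝓡 :=
          Finset.sum_le_sum fun B' hB' => ih 𝓡 ((Finset.filter_subset _ _).trans hsub) hcard B'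
            (hsub (Finset.mem_filter.1 hB').1)
        have h5 : ∑ B' ∈ 𝓝, assignWeight B' ≤ 1 / 4 := by
          refine le_trans ?_ (hw B hB)
          exact Finset.sum_le_sum_of_subset_of_nonneg (Finset.filter_subset_filter _ hsub)
            fun _ _ _ => assignWeight_nonneg _
        have h6 : ∑ B' ∈ 𝓝, 2 * assignWeight B' * (bijCount ∅ 𝓡 : ℝ) =
            2 * (∑ B' ∈ 𝓝, assignWeight B') * bijCount ∅ 𝓡 := by
          rw [Finset.mul_sum, Finset.sum_mul]
        have : (0 : ℝ) ≤ bijCount ∅ 𝓡 := Nat.cast_nonneg _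
        nlinarith
    have := assignWeight_nonneg B
    nlinarith

lemma bijCount_empty_le_exp (hne : ∀ B ∈ 𝓑, B.Nonempty) (hinj : ∀ B ∈ 𝓑, PartialInj B)
    (hw : ∀ B ∈ 𝓑, touchWeight 𝓑 B ≤ 1 / 4) (𝓡 𝓝 : Finset (Finset (A × V)))
    (h : 𝓝 ∪ 𝓡 ⊆ 𝓑) :
    (bijCount ∅ 𝓡 : ℝ) ≤ Real.exp (4 * ∑ B ∈ 𝓝, assignWeight B) * bijCount ∅ (𝓝 ∪ 𝓡) := by
  classical
  induction 𝓝 using Finset.induction_on with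
  | empty => simp
  | insert B 𝓝 hB ih =>
    rw [Finset.insert_union] at h ⊢
    obtain ⟨hB𝓑, h⟩ := Finset.insert_subset_iff.1 h
    refine (ih h).trans ?_
    rw [Finset.sum_insert hB, mul_add, Real.exp_add, mul_comm (Real.exp _) (Real.exp _), mul_assoc]
    refine mul_le_mul_of_nonneg_left ?_ (Real.exp_pos _).le
    have h1 := bijCount_insert_right (𝓝 ∪ 𝓡) B
    have h1' : (bijCount ∅ (𝓝 ∪ 𝓡) : ℝ) =
      bijCount ∅ (insert B (𝓝 ∪ 𝓡)) + bijCount B (𝓝 ∪ 𝓡) := by exact_mod_cast h1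
    have h2 := bijCount_le_two_mul hinj hw _ _ h le_rfl B hB𝓑
    have h3 : assignWeight B ≤ 1 / 4 := by
      refine le_trans ?_ (hw B hB𝓑)
      refine Finset.single_le_sum (f := fun B => assignWeight B)
        (fun _ _ => assignWeight_nonneg _) ?_
      obtain ⟨x, hx⟩ := hne B hB𝓑
      exact Finset.mem_filter.2 ⟨hB𝓑, x, hx, x, hx, .inl rfl⟩
    have h0 := assignWeight_nonneg B
    set x := assignWeight B
    set y := (bijCount ∅ (𝓝 ∪ 𝓡) : ℝ)
    have hy : 0 ≤ y := Nat.cast_nonneg _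
    have h4 : 1 ≤ Real.exp (4 * x) * (1 - 2 * x) := by
      have := Real.add_one_le_exp (4 * x)
      nlinarith
    have h5 : (1 - 2 * x) * y ≤ bijCount ∅ (insert B (𝓝 ∪ 𝓡)) := by linarith
    calc y = 1 * y := (one_mul y).symm
      _ ≤ (Real.exp (4 * x) * (1 - 2 * x)) * y := by gcongr
      _ = Real.exp (4 * x) * ((1 - 2 * x) * y) := by ring
      _ ≤ _ := by gcongr

/-- There is a bijection avoiding all of `𝓑`. -/
lemma bijCount_empty_pos (hAV : Fintype.card A = Fintype.card V) (hne : ∀ B ∈ 𝓑, B.Nonempty)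
    (hinj : ∀ B ∈ 𝓑, PartialInj B) (hw : ∀ B ∈ 𝓑, touchWeight 𝓑 B ≤ 1 / 4) :
    (0 : ℝ) < bijCount ∅ 𝓑 := by
  classical
  have h := bijCount_empty_le_exp hne hinj hw ∅ 𝓑 (by simp)
  rw [Finset.union_empty] at h
  have h0 : (0 : ℝ) < bijCount ∅ (∅ : Finset (Finset (A × V))) := by
    obtain ⟨σ⟩ := Fintype.card_eq.1 hAV
    have : 0 < bijCount ∅ (∅ : Finset (Finset (A × V))) :=
      Finset.card_pos.2 ⟨σ, by simp [Agrees]⟩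
    exact_mod_cast this
  by_contra hcon
  have : Real.exp (4 * ∑ B ∈ 𝓑, assignWeight B) * bijCount ∅ 𝓑 ≤ 0 :=
    mul_nonpos_of_nonneg_of_nonpos (Real.exp_pos _).le (not_lt.1 hcon)
  linarith

/-- In the conditional space of bijections avoiding `𝓑`, extending `T` is not much more likely
than in the unconditional one. -/
lemma bijCount_le_exp (hne : ∀ B ∈ 𝓑, B.Nonempty) (hinj : ∀ B ∈ 𝓑, PartialInj B)
    (hw : ∀ B ∈ 𝓑, touchWeight 𝓑 B ≤ 1 / 4) {T : Finset (A × V)} (hT : PartialInj T) :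
    (bijCount T 𝓑 : ℝ) ≤
      assignWeight T * Real.exp (4 * touchWeight 𝓑 T) * bijCount ∅ 𝓑 := by
  classical
  set 𝓝 := 𝓑.filter fun B' => Touches T B' with h𝓝
  set 𝓡 := 𝓑.filter fun B' => ¬ Touches T B' with h𝓡
  have hunion : 𝓝 ∪ 𝓡 = 𝓑 := Finset.filter_union_filter_not_eq _ _
  have h1 : (bijCount T 𝓑 : ℝ) ≤ bijCount T 𝓡 := by
    exact_mod_cast bijCount_anti_right T (Finset.filter_subset _ _)
  have h2 := bijCount_le_assignWeight_mul (𝓑 := 𝓡) hT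
    (fun B' hB' => (Finset.mem_filter.1 hB').2)
  have h3 := bijCount_empty_le_exp hne hinj hw 𝓡 𝓝 hunion.le
  rw [hunion] at h3
  calc (bijCount T 𝓑 : ℝ) ≤ assignWeight T * bijCount ∅ 𝓡 := h1.trans h2
    _ ≤ assignWeight T * (Real.exp (4 * ∑ B ∈ 𝓝, assignWeight B) * bijCount ∅ 𝓑) :=
        mul_le_mul_of_nonneg_left h3 (assignWeight_nonneg _)
    _ = _ := by
        rw [touchWeight, mul_assoc]

end LocalLemma

end Bijections

/-! ### Concentration of functions with bounded differences -/

section BoundedDifferences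

variable {V : Type*} [Fintype V] [Nonempty V]

lemma Real.exp_le_one_add_add_sq {x : ℝ} (hx : |x| ≤ 1) : Real.exp x ≤ 1 + x + x ^ 2 := by
  have := (abs_le.1 (Real.abs_exp_sub_one_sub_id_le hx)).2
  linarith

lemma sum_exp_sub_mean_le_of_abs_sub_le (g : V → ℝ) {c l : ℝ} (hl : 0 ≤ l) (hlc : l * c ≤ 1)
    (hg : ∀ v w, |g v - g w| ≤ c) :
    ∑ v, Real.exp (l * (g v - (∑ w, g w) / Fintype.card V)) ≤
      Fintype.card V * Real.exp ((l * c) ^ 2) := by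
  have hn : (0 : ℝ) < Fintype.card V := by exact_mod_cast Fintype.card_pos
  set a := (∑ w, g w) / Fintype.card V with ha
  have hdev : ∀ v, |g v - a| ≤ c := by
    intro v
    have : g v - a = (∑ w, (g v - g w)) / Fintype.card V := by
      rw [Finset.sum_sub_distrib, Finset.sum_const, Finset.card_univ, nsmul_eq_mul, ha]
      field_simp
    rw [this, abs_div, abs_of_pos hn, div_le_iff₀ hn]
    refine (Finset.abs_sum_le_sum_abs _ _).trans ?_
    refine (Finset.sum_le_sum fun w _ => hg v w).trans ?_
    rw [Finset.sum_const, Finset.card_univ, nsmul_eq_mul, mul_comm]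
  have hterm : ∀ v, Real.exp (l * (g v - a)) ≤ 1 + l * (g v - a) + (l * c) ^ 2 := by
    intro v
    have h1 : |l * (g v - a)| ≤ l * c := by
      rw [abs_mul, abs_of_nonneg hl]
      exact mul_le_mul_of_nonneg_left (hdev v) hl
    refine (Real.exp_le_one_add_add_sq (h1.trans hlc)).trans ?_
    have : (l * (g v - a)) ^ 2 ≤ (l * c) ^ 2 := sq_le_sq' (abs_le.1 h1).1 (abs_le.1 h1).2
    linarith
  have hzero : ∑ v, (g v - a) = 0 := by
    rw [Finset.sum_sub_distrib, Finset.sum_const, Finset.card_univ, nsmul_eq_mul, ha]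
    field_simp
    ring
  calc ∑ v, Real.exp (l * (g v - a)) ≤ ∑ v, (1 + l * (g v - a) + (l * c) ^ 2) :=
        Finset.sum_le_sum fun v _ => hterm v
    _ = Fintype.card V * (1 + (l * c) ^ 2) := by
        rw [Finset.sum_add_distrib, Finset.sum_add_distrib, ← Finset.mul_sum, hzero]
        simp [Finset.card_univ]
        ring
    _ ≤ _ := by
        gcongr
        have := Real.add_one_le_exp ((l * c) ^ 2)
        linarith

open Classical in
/-- Exponential moments of a function of independent uniform variables with differences
bounded by `c`. -/
lemma sum_exp_sub_mean_le {ι : Type*} [Fintype ι] {c l : ℝ} (hl : 0 ≤ l) (hlc : l * c ≤ 1)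
    (f : (ι → V) → ℝ) (hf : ∀ y y' i, (∀ j, j ≠ i → y j = y' j) → |f y - f y'| ≤ c) :
    ∑ y, Real.exp (l * (f y - (∑ z, f z) / (Fintype.card V : ℝ) ^ Fintype.card ι)) ≤
      (Fintype.card V : ℝ) ^ Fintype.card ι * Real.exp (Fintype.card ι * (l * c) ^ 2) := by
  have hn : (0 : ℝ) < Fintype.card V := by exact_mod_cast Fintype.card_pos
  revert f
  refine Fintype.induction_empty_option (P := fun ι _ => ∀ f : (ι → V) → ℝ,
    (∀ y y' i, (∀ j, j ≠ i → y j = y' j) → |f y - f y'| ≤ c) →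
    ∑ y, Real.exp (l * (f y - (∑ z, f z) / (Fintype.card V : ℝ) ^ Fintype.card ι)) ≤
      (Fintype.card V : ℝ) ^ Fintype.card ι * Real.exp (Fintype.card ι * (l * c) ^ 2))
    ?_ ?_ ?_ ι
  · intro α β _ e ih f hf
    let _ := Fintype.ofEquiv β e.symm
    have hcard : Fintype.card α = Fintype.card β := Fintype.card_congr e
    set E : (α → V) ≃ (β → V) := e.arrowCongr (Equiv.refl V) with hE
    have := ih (fun y => f (E y)) (fun y y' i h => hf _ _ (e i) fun b hb => by
      simp only [hE, Equiv.arrowCongr_apply, Equiv.coe_refl, Function.comp, id]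
      exact h _ fun hbi => hb (e.symm_apply_eq.1 hbi))
    rw [E.sum_comp f, hcard] at this
    rwa [E.sum_comp (fun y => Real.exp (l * (f y - _)))] at this
  · intro f _
    simp
  · intro α _ ih f hf
    set E : (Option α → V) ≃ V × (α → V) := Equiv.piOptionEquivProd with hE
    set N := Fintype.card α
    set n := (Fintype.card V : ℝ)
    set g : V → ℝ := fun v => (∑ y, f (E.symm (v, y))) / n ^ N with hg
    have hsum : ∀ F : (Option α → V) → ℝ, ∑ y, F y = ∑ v, ∑ y, F (E.symm (v, y)) := by
      intro F
      rw [← E.symm.sum_comp, Fintype.sum_prod_type]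
    have hin : ∀ v, ∑ y, Real.exp (l * (f (E.symm (v, y)) - g v)) ≤
        n ^ N * Real.exp (N * (l * c) ^ 2) := fun v =>
      ih (fun y => f (E.symm (v, y))) fun y y' i h => hf _ _ (some i) fun o ho => by
        cases o with
        | none => rfl
        | some j => exact h j fun hj => ho (congrArg some hj)
    have hgd : ∀ v w, |g v - g w| ≤ c := by
      intro v w
      have hnN : (0 : ℝ) < n ^ N := by positivity
      rw [hg]
      simp only
      rw [← sub_div, ← Finset.sum_sub_distrib, abs_div, abs_of_pos hnN, div_le_iff₀ hnN]
      refine (Finset.abs_sum_le_sum_abs _ _).trans ?_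
      refine (Finset.sum_le_sum (g := fun _ => c) fun y _ => ?_).trans ?_
      · refine hf _ _ none fun o ho => ?_
        cases o with
        | none => exact absurd rfl ho
        | some j => rfl
      · simp [n, N, mul_comm]
    have hout := sum_exp_sub_mean_le_of_abs_sub_le g hl hlc hgd
    have hmean : (∑ z, f z) / n ^ Fintype.card (Option α) = (∑ w, g w) / n := by
      rw [hsum, Fintype.card_option, hg, ← Finset.sum_div, div_div, pow_succ]
    suffices hgoal : ∑ y, Real.exp (l * (f y - (∑ z, f z) / n ^ Fintype.card (Option α))) ≤
        n ^ Fintype.card (Option α) * Real.exp (Fintype.card (Option α) * (l * c) ^ 2) by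
      convert hgoal
    rw [hmean, hsum, Fintype.card_option]
    set a := (∑ w, g w) / n
    calc ∑ v, ∑ y, Real.exp (l * (f (E.symm (v, y)) - a))
        = ∑ v, Real.exp (l * (g v - a)) * ∑ y, Real.exp (l * (f (E.symm (v, y)) - g v)) := by
          refine Finset.sum_congr rfl fun v _ => ?_
          rw [Finset.mul_sum]
          refine Finset.sum_congr rfl fun y _ => ?_
          rw [← Real.exp_add]
          ring_nf
      _ ≤ ∑ v, Real.exp (l * (g v - a)) * (n ^ N * Real.exp (N * (l * c) ^ 2)) :=
          Finset.sum_le_sum fun v _ => mul_le_mul_of_nonneg_left (hin v) (Real.exp_pos _).le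
      _ = (∑ v, Real.exp (l * (g v - a))) * (n ^ N * Real.exp (N * (l * c) ^ 2)) := by
          rw [Finset.sum_mul]
      _ ≤ (n * Real.exp ((l * c) ^ 2)) * (n ^ N * Real.exp (N * (l * c) ^ 2)) := by gcongr
      _ = n ^ (N + 1) * Real.exp (((N + 1 : ℕ) : ℝ) * (l * c) ^ 2) := by
          push_cast
          rw [add_mul, one_mul, Real.exp_add]
          ring

open Classical in
/-- Lower tail of a function of independent uniform variables with bounded differences. -/
lemma card_le_of_bounded_differences {ι : Type*} [Fintype ι] {c l t a : ℝ} (hl : 0 ≤ l)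
    (hlc : l * c ≤ 1) (f : (ι → V) → ℝ)
    (hf : ∀ y y' i, (∀ j, j ≠ i → y j = y' j) → |f y - f y'| ≤ c)
    (ha : a * (Fintype.card V : ℝ) ^ Fintype.card ι ≤ ∑ z, f z) :
    ((Finset.univ.filter fun y => f y ≤ a - t).card : ℝ) ≤
      (Fintype.card V : ℝ) ^ Fintype.card ι * Real.exp (Fintype.card ι * (l * c) ^ 2 - l * t) := by
  have hn : (0 : ℝ) < (Fintype.card V : ℝ) ^ Fintype.card ι := by
    have : (0 : ℝ) < Fintype.card V := by exact_mod_cast Fintype.card_pos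
    positivity
  have h := sum_exp_sub_mean_le hl hlc (fun y => - f y) (fun y y' i h => by
    rw [neg_sub_neg, abs_sub_comm]; exact hf y y' i h)
  have h1 : ∑ y ∈ Finset.univ.filter fun y => f y ≤ a - t, Real.exp (l * t) ≤
      ∑ y, Real.exp (l * (- f y -
        (∑ z, - f z) / (Fintype.card V : ℝ) ^ Fintype.card ι)) := by
    refine (Finset.sum_le_sum fun y hy => ?_).trans
      (Finset.sum_le_sum_of_subset_of_nonneg (Finset.subset_univ _)
        fun _ _ _ => (Real.exp_pos _).le)
    refine Real.exp_le_exp.2 (mul_le_mul_of_nonneg_left ?_ hl)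
    have hy' := (Finset.mem_filter.1 hy).2
    rw [Finset.sum_neg_distrib, neg_div]
    have := (le_div_iff₀ hn).2 ha
    linarith
  rw [Finset.sum_const, nsmul_eq_mul] at h1
  rw [Real.exp_sub, ← mul_div_assoc, le_div_iff₀ (Real.exp_pos _)]
  exact h1.trans h

end BoundedDifferences

/-! ### Degrees in random induced subgraphs -/

section RandomPullback

open Classical in
lemma factorial_mul_pow_le_card_image_eq {ι V : Type*} [Fintype ι] [Fintype V]
    (f : Finset ι) (X : Finset V) (hX : f.card = X.card) :
    f.card.factorial * Fintype.card V ^ (Fintype.card ι - f.card) ≤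
      (Finset.univ.filter fun y : ι → V => f.image y = X).card := by
  have e₀ : f ≃ X := Fintype.equivOfCardEq (by simpa using hX)
  have h1 : Fintype.card (f ≃ X) = f.card.factorial := by
    rw [Fintype.card_equiv e₀, Fintype.card_coe]
  have h2 : Fintype.card ({j // j ∉ f} → V) = Fintype.card V ^ (Fintype.card ι - f.card) := by
    rw [Fintype.card_fun, Fintype.card_subtype_compl, Fintype.card_coe]
  rw [← h1, ← h2, ← Fintype.card_prod, ← Finset.card_univ]
  refine Finset.card_le_card_of_injOn
    (fun z j => if h : j ∈ f then (z.1 ⟨j, h⟩ : V) else z.2 ⟨j, h⟩) ?_ ?_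
  · rintro ⟨e, g⟩ -
    simp only [Finset.mem_coe, Finset.mem_filter, Finset.mem_univ, true_and]
    ext x
    simp only [Finset.mem_image]
    constructor
    · rintro ⟨j, hj, rfl⟩
      simp [hj]
    · intro hx
      refine ⟨e.symm ⟨x, hx⟩, (e.symm ⟨x, hx⟩).2, ?_⟩
      simp
  · rintro ⟨e, g⟩ - ⟨e', g'⟩ - h
    simp only at h
    refine Prod.ext (Equiv.ext fun j => Subtype.ext ?_) (funext fun j => ?_)
    · simpa using congrFun h j
    · simpa [j.2] using congrFun h j

variable {n : ℕ} {G : Finset (Finset (Fin n))}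

open Classical in
/-- The number of `h`-sets of positions that complete `A` to an edge. -/
noncomputable def completions {ι : Type*} [Fintype ι] (G : Finset (Finset (Fin n)))
    (A : Finset (Fin n)) (h : ℕ) (y : ι → Fin n) : ℝ :=
  (((Finset.univ : Finset ι).powersetCard h).filter fun f => A ∪ f.image y ∈ G).card

lemma abs_completions_sub_le {ι : Type*} [Fintype ι] (A : Finset (Fin n)) {h : ℕ} (hh : 0 < h)
    (y y' : ι → Fin n) (i : ι) (hy : ∀ j, j ≠ i → y j = y' j) :
    |completions G A h y - completions G A h y'| ≤
      ((Fintype.card ι - 1).choose (h - 1) : ℕ) := by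
  classical
  have hcount : (((Finset.univ : Finset ι).powersetCard h).filter fun f => i ∈ f).card =
      (Fintype.card ι - 1).choose (h - 1) := by
    rw [← Finset.card_univ, ← Finset.card_erase_of_mem (Finset.mem_univ i),
      ← Finset.card_powersetCard]
    refine Finset.card_bij' (fun f _ => f.erase i) (fun f _ => insert i f) ?_ ?_ ?_ ?_
    · intro f hf
      simp only [Finset.mem_filter, Finset.mem_powersetCard] at hf ⊢
      exact ⟨Finset.erase_subset_erase _ hf.1.1, by rw [Finset.card_erase_of_mem hf.2, hf.1.2]⟩
    · intro f hf
      simp only [Finset.mem_filter, Finset.mem_powersetCard] at hf ⊢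
      have hif : i ∉ f := fun hi => by simpa using hf.1 hi
      exact ⟨⟨Finset.subset_univ _, by rw [Finset.card_insert_of_notMem hif, hf.2]; omega⟩,
        Finset.mem_insert_self _ _⟩
    · intro f hf
      exact Finset.insert_erase (Finset.mem_filter.1 hf).2
    · intro f hf
      refine Finset.erase_insert fun hi => ?_
      simpa using (Finset.mem_powersetCard.1 hf).1 hi
  have key : ∀ z z' : ι → Fin n, (∀ j, j ≠ i → z j = z' j) →
      completions G A h z ≤ completions G A h z' + ((Fintype.card ι - 1).choose (h - 1) : ℕ) := by
    intro z z' hz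
    rw [← hcount, completions, completions]
    norm_cast
    refine le_trans (Finset.card_le_card fun f hf => ?_) (Finset.card_union_le _ _)
    simp only [Finset.mem_union, Finset.mem_filter] at hf ⊢
    by_cases hi : i ∈ f
    · exact .inr ⟨hf.1, hi⟩
    · refine .inl ⟨hf.1, ?_⟩
      rw [← Finset.image_congr (f := z) (fun j hj => hz j fun hji => hi (hji ▸ hj))]
      exact hf.2
  rw [abs_le]
  have h1 := key y y' hy
  have h2 := key y' y fun j hj => (hy j hj).symm
  constructor <;> linarith

lemma sum_completions_ge {ι : Type*} [Fintype ι] [Fintype (ι → Fin n)] {k : ℕ} (hG : IsHG k n G)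
    (A : Finset (Fin n)) :
    ((Fintype.card ι).choose (k - A.card) : ℝ) * ((G.filter fun e => A ⊆ e).card *
      ((k - A.card).factorial * (n : ℝ) ^ (Fintype.card ι - (k - A.card)))) ≤
      ∑ y : ι → Fin n, completions G A (k - A.card) y := by
  classical
  set h := k - A.card with hh
  have hsum : ∑ y : ι → Fin n, completions G A h y =
      ∑ f ∈ (Finset.univ : Finset ι).powersetCard h,
        ((Finset.univ.filter fun y : ι → Fin n => A ∪ f.image y ∈ G).card : ℝ) := by
    have := Finset.sum_card_bipartiteAbove_eq_sum_card_bipartiteBelow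
      (s := (Finset.univ : Finset (ι → Fin n))) (t := (Finset.univ : Finset ι).powersetCard h)
      (fun y f => A ∪ f.image y ∈ G)
    unfold Finset.bipartiteAbove Finset.bipartiteBelow at this
    unfold completions
    exact_mod_cast this
  rw [hsum, ← Finset.card_univ, ← Finset.card_powersetCard, ← nsmul_eq_mul]
  refine Finset.card_nsmul_le_sum _ _ _ fun f hf => ?_
  have hfc := (Finset.mem_powersetCard.1 hf).2
  have hdisj : (↑(G.filter fun e => A ⊆ e) : Set (Finset (Fin n))).PairwiseDisjoint
      (fun e => Finset.univ.filter fun y : ι → Fin n => f.image y = e \ A) := by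
    intro e he e' he' hne
    refine Finset.disjoint_left.2 fun y hy hy' => hne ?_
    simp only [Finset.mem_coe, Finset.mem_filter, Finset.mem_univ,
      true_and] at he he' hy hy'
    rw [← Finset.union_sdiff_of_subset he.2, ← Finset.union_sdiff_of_subset he'.2, ← hy, ← hy']
  have hsub : (G.filter fun e => A ⊆ e).biUnion
      (fun e => Finset.univ.filter fun y : ι → Fin n => f.image y = e \ A) ⊆
      Finset.univ.filter fun y : ι → Fin n => A ∪ f.image y ∈ G := by
    intro y hy
    simp only [Finset.mem_biUnion, Finset.mem_filter, Finset.mem_univ, true_and] at hy ⊢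
    obtain ⟨e, he, hye⟩ := hy
    rw [hye, Finset.union_sdiff_of_subset he.2]
    exact he.1
  have hle := Finset.card_le_card hsub
  rw [Finset.card_biUnion hdisj] at hle
  have hterm : (G.filter fun e => A ⊆ e).card • (h.factorial * n ^ (Fintype.card ι - h)) ≤
      ∑ e ∈ G.filter fun e => A ⊆ e,
        (Finset.univ.filter fun y : ι → Fin n => f.image y = e \ A).card := by
    refine Finset.card_nsmul_le_sum _ _ _ fun e he => ?_
    obtain ⟨heG, hAe⟩ := Finset.mem_filter.1 he
    have := factorial_mul_pow_le_card_image_eq f (e \ A) (by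
      rw [Finset.card_sdiff_of_subset hAe, hG e heG, hfc])
    rw [hfc, Fintype.card_fin] at this
    refine this.trans (le_of_eq ?_)
    congr!
  rw [smul_eq_mul] at hterm
  rw [Finset.card_univ]
  exact_mod_cast hterm.trans hle


/-- Rate of the exponential tail bound for `completions`. -/
noncomputable def tailRate (h : ℕ) (μ : ℝ) : ℝ := min (1 / (h : ℝ)) (μ / (8 * h ^ 2)) * μ / 8

lemma tailRate_pos {h : ℕ} (hh : 0 < h) {μ : ℝ} (hμ : 0 < μ) : 0 < tailRate h μ := by
  unfold tailRate
  have : (0 : ℝ) < h := by exact_mod_cast hh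
  positivity

lemma descFactorial_ge_mul_pow {d k : ℕ} (hdk : d ≤ k) (hkn : k ≤ n) :
    (1 - (k - d : ℕ) * (k / n : ℝ)) * (n : ℝ) ^ (k - d) ≤ ((n - d).descFactorial (k - d) : ℕ) := by
  rcases Nat.eq_zero_or_pos n with rfl | hn
  · obtain rfl : k = 0 := by omega
    simp
  have hn' : (0 : ℝ) < n := by exact_mod_cast hn
  have h1 := Nat.pow_sub_le_descFactorial (n - d) (k - d)
  have h2 : (n - k) ^ (k - d) ≤ (n - d + 1 - (k - d)) ^ (k - d) :=
    Nat.pow_le_pow_left (by omega) _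
  have h3 : ((n : ℝ) - k) ^ (k - d) ≤ ((n - d).descFactorial (k - d) : ℕ) := by
    rw [← Nat.cast_sub hkn]
    exact_mod_cast h2.trans h1
  refine le_trans ?_ h3
  have h4 : (k : ℝ) / n ≤ 1 := (div_le_one hn').2 (by exact_mod_cast hkn)
  have h5 := one_add_mul_le_pow (a := -(k / n : ℝ)) (by linarith) (k - d)
  have h6 : ((n : ℝ) - k) ^ (k - d) = (1 + -(k / n : ℝ)) ^ (k - d) * (n : ℝ) ^ (k - d) := by
    rw [← mul_pow]
    congr 1
    field_simp
    ring
  rw [h6]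
  refine mul_le_mul_of_nonneg_right ?_ (by positivity)
  linarith

open Classical in
lemma card_completions_le {ι : Type*} [Fintype ι] [hι : DecidableEq ι] {k d : ℕ}
    (hG : IsHG k n G) (hdk : d < k)
    {θ μ : ℝ} (hμ : 0 < μ) (hkn : k ≤ n) (hn : 4 * θ * (k - d : ℕ) * k ≤ μ * n)
    (hdeg : MinDegGE G d (θ * ((n - d).choose (k - d) : ℕ))) (A : Finset (Fin n))
    (hA : A.card = d) (hN : k - d ≤ Fintype.card ι) :
    ((Finset.univ.filter fun y : ι → Fin n => completions G A (k - d) y ≤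
        (θ - μ / 2) * ((Fintype.card ι).choose (k - d) : ℕ)).card : ℝ) ≤
      (n : ℝ) ^ Fintype.card ι * Real.exp (-(tailRate (k - d) μ * Fintype.card ι)) := by
  obtain rfl : hι = fun a b => Classical.propDecidable (a = b) := Subsingleton.elim _ _
  have hn0 : 0 < n := by omega
  have : Nonempty (Fin n) := ⟨⟨0, hn0⟩⟩
  have hnR : (0 : ℝ) < n := by exact_mod_cast hn0
  have hmean := sum_completions_ge (ι := ι) hG A
  rw [hA] at hmean
  set h := k - d with hh
  set N := Fintype.card ι with hNdef
  have hh0 : 0 < h := by omega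
  have hhR : (0 : ℝ) < h := by exact_mod_cast hh0
  have hN0 : 0 < N := by omega
  have hNR : (0 : ℝ) < N := by exact_mod_cast hN0
  have hb : (0 : ℝ) < (N.choose h : ℕ) := by exact_mod_cast Nat.choose_pos hN
  have hchoose : (N : ℝ) * ((N - 1).choose (h - 1) : ℕ) = h * (N.choose h : ℕ) := by
    obtain ⟨N', hN'⟩ : ∃ N', N = N' + 1 := ⟨N - 1, by omega⟩
    obtain ⟨h', hh'⟩ : ∃ h', h = h' + 1 := ⟨h - 1, by omega⟩
    rw [hN', hh', Nat.add_sub_cancel, Nat.add_sub_cancel]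
    have := Nat.add_one_mul_choose_eq N' h'
    rw [mul_comm ((h' + 1 : ℕ) : ℝ)]
    exact_mod_cast this
  set l0 := min (1 / (h : ℝ)) (μ / (8 * h ^ 2)) with hl0
  have hl0pos : 0 < l0 := by positivity
  have hl1 : l0 * h ≤ 1 := by
    calc l0 * h ≤ 1 / h * h := by gcongr; exact min_le_left _ _
      _ = 1 := by field_simp
  have hl2 : l0 * h ^ 2 ≤ μ / 8 := by
    calc l0 * h ^ 2 ≤ μ / (8 * h ^ 2) * h ^ 2 := by gcongr; exact min_le_right _ _
      _ = μ / 8 := by field_simp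
  set l := l0 * N / (N.choose h : ℕ) with hl
  have hlc : l * ((N - 1).choose (h - 1) : ℕ) = l0 * h := by
    rw [hl, div_mul_eq_mul_div, mul_assoc, hchoose]
    field_simp
  have key := card_le_of_bounded_differences (V := Fin n) (ι := ι) (l := l)
    (c := ((N - 1).choose (h - 1) : ℕ)) (t := μ / 4 * (N.choose h : ℕ))
    (a := (θ - μ / 4) * (N.choose h : ℕ)) (by positivity) (by rw [hlc]; exact hl1)
    (completions G A h) (fun y y' i hy => abs_completions_sub_le A hh0 y y' i hy) ?_
  · rw [Fintype.card_fin, hlc] at key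
    have e1 : (θ - μ / 4) * ((N.choose h : ℕ) : ℝ) - μ / 4 * (N.choose h : ℕ) =
      (θ - μ / 2) * (N.choose h : ℕ) := by ring
    rw [e1] at key
    refine key.trans ?_
    gcongr
    have e2 : l * (μ / 4 * (N.choose h : ℕ)) = l0 * N * (μ / 4) := by
      rw [hl]; field_simp
    rw [e2, tailRate, ← hl0]
    have : (N : ℝ) * l0 * (l0 * h ^ 2) ≤ N * l0 * (μ / 8) := by gcongr
    nlinarith
  · rw [Fintype.card_fin]
    refine le_trans ?_ (hmean.trans (le_of_eq ?_))
    · rcases le_or_gt θ (μ / 4) with hθ | hθ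
      · refine le_trans (b := 0) ?_ (by positivity)
        refine mul_nonpos_of_nonpos_of_nonneg ?_ (by positivity)
        exact mul_nonpos_of_nonpos_of_nonneg (by linarith) (by positivity)
      · have hd := hdeg A hA
        have hdf := descFactorial_ge_mul_pow hdk.le hkn
        rw [Nat.descFactorial_eq_factorial_mul_choose] at hdf
        push_cast at hdf
        have h7 : θ - μ / 4 ≤ θ * (1 - h * (k / n : ℝ)) := by
          have : θ * (h * (k / n : ℝ)) ≤ μ / 4 := by
            rw [← mul_div_assoc, ← mul_div_assoc, div_le_iff₀ hnR]
            linarith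
          linarith
        have hpow : (n : ℝ) ^ N = n ^ h * n ^ (N - h) := by
          rw [← pow_add]; congr 1; omega
        rw [mul_comm (θ - μ / 4), mul_assoc]
        refine mul_le_mul_of_nonneg_left ?_ hb.le
        have hθ0 : 0 < θ := by linarith
        calc (θ - μ / 4) * (n : ℝ) ^ N
            ≤ (θ * (1 - h * (k / n : ℝ))) * (n ^ h * n ^ (N - h)) := by rw [hpow]; gcongr
          _ = θ * ((1 - h * (k / n : ℝ)) * n ^ h) * n ^ (N - h) := by ring
          _ ≤ θ * (h.factorial * ((n - d).choose h : ℕ)) * n ^ (N - h) := by gcongr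
          _ = (θ * ((n - d).choose h : ℕ)) * (h.factorial * n ^ (N - h)) := by ring
          _ ≤ _ := by gcongr
    · rfl

open Classical in
/-- The sets of positions whose image under `τ` is an edge of `G`. -/
noncomputable def pullback {ι : Type*} [Fintype ι] (G : Finset (Finset (Fin n))) (τ : ι → Fin n) :
    Finset (Finset ι) :=
  Finset.univ.filter fun f => f.image τ ∈ G

lemma card_fixed_value {ι V : Type*} [Fintype ι] [Fintype V] [DecidableEq ι] [DecidableEq V]
    (i : ι) (v : V) : (Finset.univ.filter fun y : ι → V => y i = v).card =
      Fintype.card V ^ (Fintype.card ι - 1) := by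
  have : (Finset.univ.filter fun y : ι → V => y i = v) =
      Fintype.piFinset fun j => if j = i then {v} else Finset.univ := by
    ext y
    simp only [Finset.mem_filter, Finset.mem_univ, true_and, Fintype.mem_piFinset]
    constructor
    · rintro rfl j
      split_ifs with h
      · simp [h]
      · simp
    · intro h
      simpa using h i
  rw [this, Fintype.card_piFinset]
  have hc : ∀ j, (if j = i then ({v} : Finset V) else Finset.univ).card =
      if j = i then 1 else Fintype.card V := by
    intro j; split_ifs <;> simp
  simp only [hc]
  rw [Finset.prod_ite, Finset.prod_const_one, one_mul, Finset.prod_const, Finset.filter_ne',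
    Finset.card_erase_of_mem (Finset.mem_univ _), Finset.card_univ]

open Classical in
lemma completions_le_card_pullback {ι : Type*} [Fintype ι] [DecidableEq ι]
    (τ : ι → Fin n) (D D' : Finset ι)
    (hD : D ⊆ D') (h : ℕ) :
    completions G (D.image τ) h (fun j : {j // j ∉ D'} => τ j) ≤
      ((pullback G τ).filter fun e => D ⊆ e).card := by
  rw [completions]
  norm_cast
  refine Finset.card_le_card_of_injOn (fun f => D ∪ f.map (Function.Embedding.subtype _)) ?_ ?_
  · intro f hf
    simp only [Finset.mem_coe, Finset.mem_filter, pullback, Finset.mem_univ, true_and] at hf ⊢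
    refine ⟨?_, Finset.subset_union_left⟩
    rw [Finset.image_union, Finset.map_eq_image, Finset.image_image]
    exact hf.2
  · intro f _ f' _ hff
    simp only at hff
    refine Finset.map_injective (Function.Embedding.subtype _) ?_
    have hdisj : ∀ g : Finset {j // j ∉ D'}, Disjoint D (g.map (Function.Embedding.subtype _)) := by
      intro g
      rw [Finset.disjoint_left]
      intro j hj hj'
      obtain ⟨x, _, rfl⟩ := Finset.mem_map.1 hj'
      exact x.2 (hD hj)
    rw [← Finset.union_sdiff_cancel_left (hdisj f), hff, Finset.union_sdiff_cancel_left (hdisj f')]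

lemma mul_choose_le_of_slack {θ μ : ℝ} {s d h N : ℕ} (hμ : 0 < μ) (hhs : h + d + 1 ≤ s)
    (hs : 2 * θ * h ≤ μ * (s - d : ℕ)) (hNge : s - d - 1 ≤ N) (hθ : 0 ≤ θ - μ) :
    (θ - μ) * ((s - d).choose h : ℕ) ≤ (θ - μ / 2) * (N.choose h : ℕ) := by
  have h1 : ((s - d - 1).choose h : ℝ) ≤ (N.choose h : ℕ) := by
    exact_mod_cast Nat.choose_le_choose h hNge
  have h2 : ((s - d).choose h : ℝ) * ((s - d : ℕ) - h) = ((s - d - 1).choose h : ℕ) *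
      (s - d : ℕ) := by
    obtain ⟨t, ht⟩ : ∃ t, s - d = t + 1 := ⟨s - d - 1, by omega⟩
    rw [ht, Nat.add_sub_cancel, ← Nat.cast_sub (by omega)]
    have := Nat.choose_mul_succ_eq t h
    exact_mod_cast this.symm
  have hsd : (0 : ℝ) < (s - d : ℕ) := by
    have : 0 < s - d := by omega
    exact_mod_cast this
  have hc : (0 : ℝ) ≤ ((s - d).choose h : ℕ) := Nat.cast_nonneg _
  refine le_trans ?_ (mul_le_mul_of_nonneg_left h1 (by linarith))
  refine le_of_mul_le_mul_right ?_ hsd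
  rw [mul_assoc (θ - μ / 2), ← h2]
  have h3 : (θ - μ) * (s - d : ℕ) ≤ (θ - μ / 2) * ((s - d : ℕ) - h) := by
    have : (0 : ℝ) ≤ μ * h := by positivity
    nlinarith
  nlinarith

open Classical in
set_option maxHeartbeats 1000000 in
/-- Few maps into `G` have a given value at a given position and low degree at `D`. -/
lemma card_low_degree_le {k d s : ℕ} (hG : IsHG k n G) (hdk : d < k)
    {θ μ : ℝ} (hμ : 0 < μ) (hkn : k ≤ n) (hn : 4 * θ * (k - d : ℕ) * k ≤ μ * n)
    (hks : k + 1 ≤ s) (hs : 2 * θ * (k - d : ℕ) ≤ μ * (s - d : ℕ))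
    (hdeg : MinDegGE G d (θ * ((n - d).choose (k - d) : ℕ)))
    (D : Finset (Fin s)) (hD : D.card = d) (i : Fin s) (v : Fin n) :
    ((Finset.univ.filter fun τ : Fin s → Fin n => Function.Injective τ ∧ τ i = v ∧
        (((pullback G τ).filter fun e => D ⊆ e).card : ℝ) <
          (θ - μ) * ((s - d).choose (k - d) : ℕ)).card : ℝ) ≤
      (n : ℝ) ^ (s - 1) * Real.exp (-(tailRate (k - d) μ * (s - d - 1 : ℕ))) := by
  set D' := insert i D with hD'
  set h := k - d with hh
  have hh0 : 0 < h := by omega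
  set N := Fintype.card {j // j ∉ D'} with hN
  have hD'c : D'.card ≤ d + 1 := hD ▸ Finset.card_insert_le _ _
  have hD'c0 : 1 ≤ D'.card := Finset.card_pos.2 ⟨i, Finset.mem_insert_self _ _⟩
  have hD's : D'.card ≤ s := by simpa using Finset.card_le_univ D'
  have hNs : N = s - D'.card := by
    rw [hN, Fintype.card_subtype_compl, Fintype.card_fin, Fintype.card_coe]
  have hNge : s - d - 1 ≤ N := by omega
  set t := Finset.univ.filter fun τ₀ : {j // j ∈ D'} → Fin n =>
    τ₀ ⟨i, Finset.mem_insert_self _ _⟩ = v with ht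
  set S := Finset.univ.filter fun τ : Fin s → Fin n => Function.Injective τ ∧ τ i = v ∧
        (((pullback G τ).filter fun e => D ⊆ e).card : ℝ) <
          (θ - μ) * ((s - d).choose h : ℕ) with hS
  have hmaps : ∀ τ ∈ S, (fun j : {j // j ∈ D'} => τ j) ∈ t := by
    intro τ hτ
    rw [hS, Finset.mem_filter] at hτ
    rw [ht, Finset.mem_filter]
    exact ⟨Finset.mem_univ _, hτ.2.2.1⟩
  have htc : t.card = n ^ (D'.card - 1) := by
    rw [ht, card_fixed_value, Fintype.card_fin, Fintype.card_coe]
  have hfib : ∀ τ₀ ∈ t, ((S.filter fun τ => (fun j : {j // j ∈ D'} => τ j) = τ₀).card : ℝ) ≤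
      (n : ℝ) ^ N * Real.exp (-(tailRate h μ * (s - d - 1 : ℕ))) := by
    intro τ₀ _
    rcases Finset.eq_empty_or_nonempty (S.filter fun τ => (fun j : {j // j ∈ D'} => τ j) = τ₀)
      with he | ⟨τ₁, hτ₁⟩
    · rw [he]; simp; positivity
    rw [Finset.mem_filter, hS, Finset.mem_filter] at hτ₁
    have hA : (D.image τ₁).card = d := by
      rw [Finset.card_image_of_injective _ hτ₁.1.2.1, hD]
    have key := card_completions_le (ι := {j // j ∉ D'}) hG hdk hμ hkn hn hdeg _ hA (by omega)
    have hinj : (S.filter fun τ => (fun j : {j // j ∈ D'} => τ j) = τ₀).card ≤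
        (Finset.univ.filter fun y : {j // j ∉ D'} → Fin n => completions G (D.image τ₁) h y ≤
          (θ - μ / 2) * (N.choose h : ℕ)).card := by
      refine Finset.card_le_card_of_injOn (fun τ j => τ j) ?_ ?_
      · intro τ hτ
        simp only [Finset.mem_coe, Finset.mem_filter, hS, Finset.mem_univ, true_and] at hτ ⊢
        have himg : D.image τ₁ = D.image τ := by
          refine Finset.image_congr fun j hj => ?_
          have := (hτ₁.2.trans hτ.2.symm)
          exact congrFun this ⟨j, Finset.mem_insert_of_mem hj⟩
        rw [himg]
        refine (completions_le_card_pullback τ D D' (Finset.subset_insert _ _) h).trans ?_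
        refine hτ.1.2.2.le.trans (mul_choose_le_of_slack hμ (by omega) hs hNge ?_)
        by_contra hneg
        have h1 := hτ.1.2.2
        have h2 : (θ - μ) * ((s - d).choose h : ℕ) ≤ 0 :=
          mul_nonpos_of_nonpos_of_nonneg (by linarith) (by positivity)
        have h3 : (0 : ℝ) ≤ ((pullback G τ).filter fun e => D ⊆ e).card := Nat.cast_nonneg _
        linarith
      · intro τ hτ τ' hτ' hττ
        simp only [Finset.mem_coe, Finset.mem_filter] at hτ hτ'
        ext j : 1
        by_cases hj : j ∈ D'
        · exact congrFun (hτ.2.trans hτ'.2.symm) ⟨j, hj⟩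
        · exact congrFun hττ ⟨j, hj⟩
    refine (Nat.cast_le.2 hinj).trans (key.trans ?_)
    have h4 : ((s - d - 1 : ℕ) : ℝ) ≤ N := by exact_mod_cast hNge
    have := (tailRate_pos hh0 hμ).le
    gcongr
  have hsum := Finset.card_eq_sum_card_fiberwise hmaps
  have hsum' : (S.card : ℝ) = ∑ τ₀ ∈ t,
      ((S.filter fun τ => (fun j : {j // j ∈ D'} => τ j) = τ₀).card : ℝ) := by
    exact_mod_cast hsum
  rw [hsum']
  refine (Finset.sum_le_sum hfib).trans ?_
  rw [Finset.sum_const, htc, nsmul_eq_mul]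
  push_cast
  rw [← mul_assoc, ← pow_add]
  refine le_of_eq ?_
  congr 2
  omega

open Classical in
/-- Few maps into `G` have a given value at a given position and induce low minimum degree. -/
lemma card_low_minDegree_le {k d s : ℕ} (hG : IsHG k n G) (hdk : d < k)
    {θ μ : ℝ} (hμ : 0 < μ) (hkn : k ≤ n) (hn : 4 * θ * (k - d : ℕ) * k ≤ μ * n)
    (hks : k + 1 ≤ s) (hs : 2 * θ * (k - d : ℕ) ≤ μ * (s - d : ℕ))
    (hdeg : MinDegGE G d (θ * ((n - d).choose (k - d) : ℕ))) (i : Fin s) (v : Fin n) :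
    ((Finset.univ.filter fun τ : Fin s → Fin n => Function.Injective τ ∧ τ i = v ∧
        ¬ MinDegGE (pullback G τ) d ((θ - μ) * ((s - d).choose (k - d) : ℕ))).card : ℝ) ≤
      (s : ℝ) ^ d * Real.exp (-(tailRate (k - d) μ * (s - d - 1 : ℕ))) * (n : ℝ) ^ (s - 1) := by
  have hsub : (Finset.univ.filter fun τ : Fin s → Fin n => Function.Injective τ ∧ τ i = v ∧
      ¬ MinDegGE (pullback G τ) d ((θ - μ) * ((s - d).choose (k - d) : ℕ))) ⊆
      ((Finset.univ : Finset (Fin s)).powersetCard d).biUnion fun D =>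
        Finset.univ.filter fun τ : Fin s → Fin n => Function.Injective τ ∧ τ i = v ∧
        (((pullback G τ).filter fun e => D ⊆ e).card : ℝ) <
          (θ - μ) * ((s - d).choose (k - d) : ℕ) := by
    intro τ hτ
    simp only [Finset.mem_filter, Finset.mem_univ, true_and, MinDegGE, not_forall, not_le,
      Finset.mem_biUnion, Finset.mem_powersetCard_univ] at hτ ⊢
    obtain ⟨h1, h2, D, hD, hlt⟩ := hτ
    refine ⟨D, hD, h1, h2, ?_⟩
    convert hlt
  refine (Nat.cast_le.2 ((Finset.card_le_card hsub).trans Finset.card_biUnion_le)).trans ?_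
  rw [Nat.cast_sum]
  refine (Finset.sum_le_sum fun D hD => card_low_degree_le hG hdk hμ hkn hn hks hs hdeg D
    (Finset.mem_powersetCard_univ.1 hD) i v).trans ?_
  rw [Finset.sum_const, Finset.card_powersetCard, Finset.card_univ, Fintype.card_fin,
    nsmul_eq_mul]
  have : ((s.choose d : ℕ) : ℝ) ≤ (s : ℝ) ^ d := by exact_mod_cast Nat.choose_le_pow s d
  calc _ ≤ (s : ℝ) ^ d * ((n : ℝ) ^ (s - 1) *
        Real.exp (-(tailRate (k - d) μ * (s - d - 1 : ℕ)))) := by gcongr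
    _ = _ := by ring

end RandomPullback

/-! ### Strictly 1-balanced hypergraphs -/

section Balanced

variable {k m : ℕ} {F : Finset (Finset (Fin m))}

lemma StrictlyOneBalanced.card_mul_lt (hbal : StrictlyOneBalanced m F) (hk : 2 ≤ k)
    (hF : IsHG k m F) {V' : Finset (Fin m)} {E' : Finset (Finset (Fin m))} (hE : E' ⊆ F)
    (hV : ∀ f ∈ E', f ⊆ V') (hne : E'.Nonempty) (h : ¬ (V' = Finset.univ ∧ E' = F)) :
    E'.card * (m - 1) + F.card < F.card * V'.card := by
  obtain ⟨f, hf⟩ := hne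
  have hV2 : 2 ≤ V'.card := (hk.trans_eq (hF f (hE hf)).symm).trans (Finset.card_le_card (hV f hf))
  have hm : V'.card ≤ m := by simpa using Finset.card_le_univ V'
  have key := hbal V' E' hE hV ⟨f, hf⟩ h
  have h1 : (0 : ℝ) < (V'.card : ℝ) - 1 := by
    have : (2 : ℝ) ≤ V'.card := by exact_mod_cast hV2
    linarith
  have h2 : (0 : ℝ) < (m : ℝ) - 1 := by
    have : (2 : ℝ) ≤ m := by exact_mod_cast hV2.trans hm
    linarith
  rw [oneDensity, div_lt_div_iff₀ h1 h2] at key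
  have h3 : ((m - 1 : ℕ) : ℝ) = (m : ℝ) - 1 := by
    rw [Nat.cast_sub (by omega)]; simp
  rw [← Nat.cast_lt (α := ℝ)]
  push_cast
  rw [h3]
  linarith

lemma StrictlyOneBalanced.biUnion_eq_univ (hbal : StrictlyOneBalanced m F) (hk : 2 ≤ k)
    (hF : IsHG k m F) (hne : F.Nonempty) : F.biUnion id = Finset.univ := by
  by_contra h
  have h1 := hbal.card_mul_lt hk hF (subset_refl F)
    (fun f hf => Finset.subset_biUnion_of_mem id hf) hne (fun h' => h h'.1)
  have h2 : (F.biUnion id).card ≤ m := by simpa using Finset.card_le_univ (F.biUnion id)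
  have h3 : F.card * (F.biUnion id).card ≤ F.card * m := Nat.mul_le_mul_left _ h2
  obtain ⟨f, hf⟩ := hne
  have hm : 1 ≤ m := by
    have : f.card ≤ m := by simpa using Finset.card_le_univ f
    have := hF f hf
    omega
  have h4 : F.card * m = F.card * (m - 1) + F.card := by
    rw [← Nat.mul_succ, Nat.succ_eq_add_one, Nat.sub_add_cancel hm]
  omega

/-- Vertices are adjacent when they lie in a common edge. -/
def shadow (E' : Finset (Finset (Fin m))) : SimpleGraph (Fin m) :=
  SimpleGraph.fromRel fun x y => ∃ f ∈ E', x ∈ f ∧ y ∈ f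

lemma connectedComponentMk_shadow_eq {E' : Finset (Finset (Fin m))} {f : Finset (Fin m)}
    (hf : f ∈ E') {x y : Fin m} (hx : x ∈ f) (hy : y ∈ f) :
    (shadow E').connectedComponentMk x = (shadow E').connectedComponentMk y := by
  by_cases hxy : x = y
  · rw [hxy]
  · refine SimpleGraph.ConnectedComponent.connectedComponentMk_eq_of_adj ?_
    rw [shadow, SimpleGraph.fromRel_adj]
    exact ⟨hxy, Or.inl ⟨f, hf, hx, hy⟩⟩

open Classical in
lemma StrictlyOneBalanced.card_mul_add_components_lt (hbal : StrictlyOneBalanced m F) (hk : 2 ≤ k)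
    (hF : IsHG k m F) {E' : Finset (Finset (Fin m))} (hE : E' ⊂ F) (hne : E'.Nonempty) :
    E'.card * (m - 1) + F.card * Fintype.card (shadow E').ConnectedComponent < F.card * m := by
  set c := (shadow E').connectedComponentMk with hc
  have hfne : ∀ f ∈ E', f.Nonempty := fun f hf => Finset.card_pos.1 (by
    rw [hF f (hE.1 hf)]; omega)
  obtain ⟨f₀, hf₀⟩ := hne
  have hinh : Nonempty (Fin m) := ⟨(hfne f₀ hf₀).choose⟩
  set g : Finset (Fin m) → (shadow E').ConnectedComponent := fun f =>
    if h : f.Nonempty then c h.choose else c (Classical.arbitrary _) with hg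
  have hgc : ∀ f ∈ E', ∀ x ∈ f, c x = g f := by
    intro f hf x hx
    have h := hfne f hf
    simp only [hg, dif_pos h]
    exact connectedComponentMk_shadow_eq hf hx h.choose_spec
  have hsumE : E'.card = ∑ K, (E'.filter fun f => g f = K).card :=
    Finset.card_eq_sum_card_fiberwise fun f _ => Finset.mem_coe.2 (Finset.mem_univ _)
  have hsumV : m = ∑ K, (Finset.univ.filter fun x => c x = K).card := by
    rw [← Finset.card_eq_sum_card_fiberwise (f := c) (s := Finset.univ) (t := Finset.univ)
      fun f _ => Finset.mem_coe.2 (Finset.mem_univ _)]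
    simp
  have hlt : ∀ K, (E'.filter fun f => g f = K).Nonempty →
      (E'.filter fun f => g f = K).card * (m - 1) + F.card <
        F.card * (Finset.univ.filter fun x => c x = K).card := by
    intro K hK
    refine hbal.card_mul_lt hk hF ((Finset.filter_subset _ _).trans hE.1) ?_ hK ?_
    · intro f hf x hx
      rw [Finset.mem_filter] at hf ⊢
      exact ⟨Finset.mem_univ _, (hgc f hf.1 x hx).trans hf.2⟩
    · rintro ⟨-, h⟩
      exact hE.2 (h ▸ Finset.filter_subset _ _)
  have hle : ∀ K, (E'.filter fun f => g f = K).card * (m - 1) + F.card ≤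
        F.card * (Finset.univ.filter fun x => c x = K).card := by
    intro K
    rcases Finset.eq_empty_or_nonempty (E'.filter fun f => g f = K) with h | h
    · rw [h, Finset.card_empty, zero_mul, zero_add]
      refine Nat.le_mul_of_pos_right _ (Finset.card_pos.2 ?_)
      obtain ⟨x, hx⟩ := K.exists_rep
      exact ⟨x, Finset.mem_filter.2 ⟨Finset.mem_univ _, hx⟩⟩
    · exact (hlt K h).le
  have key : ∑ K, ((E'.filter fun f => g f = K).card * (m - 1) + F.card) <
      ∑ K, F.card * (Finset.univ.filter fun x => c x = K).card :=
    Finset.sum_lt_sum (fun K _ => hle K) ⟨g f₀, Finset.mem_univ _, hlt _ ⟨f₀, by simp [hf₀]⟩⟩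
  rw [Finset.sum_add_distrib, ← Finset.sum_mul, ← Finset.mul_sum, ← hsumE, ← hsumV,
    Finset.sum_const, smul_eq_mul, Finset.card_univ, mul_comm (Fintype.card _)] at key
  exact key

end Balanced

/-! ### Copies and their overlaps -/

section Copies

lemma card_maps_into_le {ι V : Type*} [Fintype ι] [DecidableEq ι] [Fintype V] [DecidableEq V]
    (D : Finset ι) (Y : ι → Finset V) {B : ℕ} (hY : ∀ x ∈ D, (Y x).card ≤ B) :
    (Finset.univ.filter fun φ : ι → V => ∀ x ∈ D, φ x ∈ Y x).card ≤
      B ^ D.card * Fintype.card V ^ (Fintype.card ι - D.card) := by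
  have : (Finset.univ.filter fun φ : ι → V => ∀ x ∈ D, φ x ∈ Y x) =
      Fintype.piFinset fun x => if x ∈ D then Y x else Finset.univ := by
    ext φ
    simp only [Finset.mem_filter, Finset.mem_univ, true_and, Fintype.mem_piFinset]
    refine forall_congr' fun x => ?_
    split_ifs with h <;> simp [h]
  rw [this, Fintype.card_piFinset]
  have hc : ∀ x, (if x ∈ D then Y x else (Finset.univ : Finset V)).card ≤
      if x ∈ D then B else Fintype.card V := by
    intro x
    split_ifs with h
    · exact hY x h
    · exact le_of_eq rfl
  refine (Finset.prod_le_prod' fun x _ => hc x).trans (le_of_eq ?_)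
  rw [Finset.prod_ite, Finset.prod_const, Finset.prod_const]
  congr 2
  · simp
  · rw [Finset.filter_not, Finset.card_sdiff_of_subset (Finset.filter_subset _ _)]
    simp

lemma card_range_superset_le {m n : ℕ} (X : Finset (Fin n)) :
    (Finset.univ.filter fun ψ : Fin m → Fin n => X ⊆ Finset.univ.image ψ).card ≤
      m ^ X.card * n ^ (m - X.card) := by
  classical
  have hsub : (Finset.univ.filter fun ψ : Fin m → Fin n => X ⊆ Finset.univ.image ψ) ⊆
      (Finset.univ : Finset (X → Fin m)).biUnion fun g =>
        Finset.univ.filter fun ψ : Fin m → Fin n => ∀ x : X, ψ (g x) = x := by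
    intro ψ hψ
    simp only [Finset.mem_filter, Finset.mem_univ, true_and, Finset.mem_biUnion] at hψ ⊢
    have : ∀ x : X, ∃ j, ψ j = x := fun x => by simpa using hψ x.2
    exact ⟨fun x => (this x).choose, fun x => (this x).choose_spec⟩
  have hpiece : ∀ g : X → Fin m,
      (Finset.univ.filter fun ψ : Fin m → Fin n => ∀ x : X, ψ (g x) = x).card ≤
        n ^ (m - X.card) := by
    intro g
    rcases Finset.eq_empty_or_nonempty
      (Finset.univ.filter fun ψ : Fin m → Fin n => ∀ x : X, ψ (g x) = x) with h | ⟨ψ₀, h₀⟩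
    · rw [h]; simp
    · simp only [Finset.mem_filter, Finset.mem_univ, true_and] at h₀
      have hinj : Function.Injective g := fun x y hxy => by
        apply Subtype.ext
        rw [← h₀ x, ← h₀ y, hxy]
      have := card_maps_into_le (Finset.univ.image g) (fun j => {ψ₀ j}) (B := 1) (by simp)
      rw [Finset.card_image_of_injective _ hinj, one_pow, one_mul] at this
      simp only [Fintype.card_fin, Finset.card_univ, Fintype.card_coe] at this
      refine le_trans (Finset.card_le_card ?_) this
      intro ψ hψ
      simp only [Finset.mem_filter, Finset.mem_univ, true_and, Finset.mem_image,
        Finset.mem_singleton] at hψ ⊢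
      rintro _ ⟨x, rfl⟩
      rw [hψ, h₀]
  refine (Finset.card_le_card hsub).trans (Finset.card_biUnion_le.trans ?_)
  refine (Finset.sum_le_sum fun g _ => hpiece g).trans (le_of_eq ?_)
  simp

variable {m n k : ℕ} {F : Finset (Finset (Fin m))} {G : Finset (Finset (Fin n))}

/-- The edge set of the copy of `F` along `φ`. -/
def copyOf (F : Finset (Finset (Fin m))) (φ : Fin m → Fin n) : Finset (Finset (Fin n)) :=
  F.image fun f => f.image φ

open Classical in
/-- The edge sets of copies of `F` in `G`. -/
noncomputable def copies (F : Finset (Finset (Fin m))) (G : Finset (Finset (Fin n))) :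
    Finset (Finset (Finset (Fin n))) :=
  (Finset.univ.filter fun φ : Fin m → Fin n =>
    Function.Injective φ ∧ ∀ f ∈ F, f.image φ ∈ G).image (copyOf F)

lemma mem_copies {c : Finset (Finset (Fin n))} : c ∈ copies F G ↔
    ∃ φ : Fin m → Fin n, (Function.Injective φ ∧ ∀ f ∈ F, f.image φ ∈ G) ∧ copyOf F φ = c := by
  simp [copies]

lemma biUnion_copyOf (F : Finset (Finset (Fin m))) (φ : Fin m → Fin n) :
    (copyOf F φ).biUnion id = (F.biUnion id).image φ := by
  rw [copyOf, Finset.image_biUnion, Finset.biUnion_image]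
  rfl

lemma card_copyOf {φ : Fin m → Fin n} (hφ : Function.Injective φ) :
    (copyOf F φ).card = F.card :=
  Finset.card_image_of_injective _ (Finset.image_injective hφ)

lemma subset_of_mem_copies {c : Finset (Finset (Fin n))} (hc : c ∈ copies F G) : c ⊆ G := by
  obtain ⟨φ, hφ, rfl⟩ := mem_copies.1 hc
  intro x hx
  obtain ⟨f, hf, rfl⟩ := Finset.mem_image.1 hx
  exact hφ.2 f hf

lemma card_of_mem_copies {c : Finset (Finset (Fin n))} (hc : c ∈ copies F G) :
    c.card = F.card := by
  obtain ⟨φ, hφ, rfl⟩ := mem_copies.1 hc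
  exact card_copyOf hφ.1

lemma card_biUnion_le_of_mem_copies {c : Finset (Finset (Fin n))} (hc : c ∈ copies F G) :
    (c.biUnion id).card ≤ m := by
  obtain ⟨φ, hφ, rfl⟩ := mem_copies.1 hc
  rw [biUnion_copyOf]
  exact Finset.card_image_le.trans (by simpa using Finset.card_le_univ (F.biUnion id))

lemma card_copies_le : (copies F G).card ≤ n ^ m := by
  refine Finset.card_image_le.trans ((Finset.card_le_univ _).trans (le_of_eq ?_))
  simp

/-- Few copies cover a given vertex set. -/
lemma card_copies_superset_le (X : Finset (Fin n)) :
    ((copies F G).filter fun b => X ⊆ b.biUnion id).card ≤ m ^ X.card * n ^ (m - X.card) := by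
  classical
  refine le_trans (Finset.card_le_card (t := (Finset.univ.filter fun ψ : Fin m → Fin n =>
    X ⊆ Finset.univ.image ψ).image (copyOf F)) ?_)
    (Finset.card_image_le.trans (card_range_superset_le X))
  intro b hb
  rw [Finset.mem_filter] at hb
  obtain ⟨φ, hφ, rfl⟩ := mem_copies.1 hb.1
  rw [biUnion_copyOf] at hb
  exact Finset.mem_image_of_mem _ (Finset.mem_filter.2 ⟨Finset.mem_univ _,
    hb.2.trans (Finset.image_subset_image (Finset.subset_univ _))⟩)

end Copies

/-! ### Weighted counts of covers -/

section Covers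

variable {β γ : Type*} [DecidableEq β] [DecidableEq γ]

open Classical in
/-- The families of members of `𝓒` of the form `{w f : f ∈ E}` where each `w f` contains `g f`. -/
noncomputable def covers (𝓒 : Finset (Finset β)) (g : γ → β) (E : Finset γ) :
    Finset (Finset (Finset β)) :=
  𝓒.powerset.filter fun W => ∃ w : γ → Finset β, (∀ f ∈ E, g f ∈ w f) ∧ W = E.image w

lemma mem_covers {𝓒 : Finset (Finset β)} {g : γ → β} {E : Finset γ} {W : Finset (Finset β)} :
    W ∈ covers 𝓒 g E ↔ W ⊆ 𝓒 ∧ ∃ w : γ → Finset β, (∀ f ∈ E, g f ∈ w f) ∧ W = E.image w := by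
  simp [covers]

lemma covers_empty_subset (𝓒 : Finset (Finset β)) (g : γ → β) : covers 𝓒 g ∅ ⊆ {∅} := by
  intro W hW
  obtain ⟨-, w, -, rfl⟩ := mem_covers.1 hW
  simp

/-- A cover of `E` consists of a member `b` containing `g f` for `f` in a nonempty part of `E`, and
a cover of the rest not using `b`. -/
lemma exists_of_mem_covers {𝓒 : Finset (Finset β)} {g : γ → β} {E : Finset γ}
    {W : Finset (Finset β)} (hW : W ∈ covers 𝓒 g E) (hE : E.Nonempty) :
    ∃ E₁ ⊆ E, E₁.Nonempty ∧ ∃ b ∈ 𝓒, (∀ f ∈ E₁, g f ∈ b) ∧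
      ∃ W' ∈ covers 𝓒 g (E \ E₁), b ∉ W' ∧ W = insert b W' := by
  obtain ⟨hWC, w, hw, rfl⟩ := mem_covers.1 hW
  obtain ⟨f₁, hf₁⟩ := hE
  have hsub : (E \ E.filter fun f => w f = w f₁).image w ⊆ 𝓒 :=
    (Finset.image_subset_image Finset.sdiff_subset).trans hWC
  refine ⟨E.filter fun f => w f = w f₁, Finset.filter_subset _ _, ⟨f₁, by simp [hf₁]⟩, w f₁,
    hWC (Finset.mem_image_of_mem _ hf₁), ?_, (E \ E.filter fun f => w f = w f₁).image w,
    mem_covers.2 ⟨hsub, w, fun f hf => hw f (Finset.mem_sdiff.1 hf).1, rfl⟩, ?_, ?_⟩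
  · intro f hf
    rw [Finset.mem_filter] at hf
    rw [← hf.2]
    exact hw f hf.1
  · intro h
    obtain ⟨f, hf, hff⟩ := Finset.mem_image.1 h
    rw [Finset.mem_sdiff, Finset.mem_filter] at hf
    exact hf.2 ⟨hf.1, hff⟩
  · ext x
    simp only [Finset.mem_image, Finset.mem_insert, Finset.mem_sdiff, Finset.mem_filter]
    constructor
    · rintro ⟨f, hf, rfl⟩
      by_cases h : w f = w f₁
      · exact Or.inl h
      · exact Or.inr ⟨f, ⟨hf, fun h' => h h'.2⟩, rfl⟩
    · rintro (rfl | ⟨f, hf, rfl⟩)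
      · exact ⟨f₁, hf₁, rfl⟩
      · exact ⟨f, hf.1, rfl⟩

lemma sum_image_le_sum {ι κ : Type*} [DecidableEq κ] (s : Finset ι) (h : ι → κ) (f : κ → ℝ)
    (hf : ∀ x, 0 ≤ f x) : ∑ x ∈ s.image h, f x ≤ ∑ i ∈ s, f (h i) := by
  rw [← Finset.sum_fiberwise_of_maps_to (g := h) (t := s.image h)
    (fun i hi => Finset.mem_image_of_mem _ hi)]
  refine Finset.sum_le_sum fun x hx => ?_
  obtain ⟨i, hi, rfl⟩ := Finset.mem_image.1 hx
  exact Finset.single_le_sum (f := fun j => f (h j)) (fun j _ => hf _)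
    (Finset.mem_filter.2 ⟨hi, rfl⟩)

lemma sum_biUnion_le_sum {ι κ : Type*} [DecidableEq κ] (s : Finset ι) (t : ι → Finset κ)
    (f : κ → ℝ) (hf : ∀ x, 0 ≤ f x) : ∑ x ∈ s.biUnion t, f x ≤ ∑ i ∈ s, ∑ x ∈ t i, f x := by
  classical
  induction s using Finset.induction_on with
  | empty => simp
  | insert a s ha ih =>
    rw [Finset.biUnion_insert, Finset.sum_insert ha]
    have := Finset.sum_union_inter (s₁ := t a) (s₂ := s.biUnion t) (f := f)
    have h0 : 0 ≤ ∑ x ∈ t a ∩ s.biUnion t, f x := Finset.sum_nonneg fun x _ => hf x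
    linarith

open Classical in
lemma sum_covers_le (𝓒 : Finset (Finset β)) (g : γ → β) {π L : ℝ} {e : ℕ} {wt : ℕ → ℝ}
    (hπ : 0 ≤ π) (hL : 1 ≤ L) (hwt0 : wt 0 = 1) (hwt : ∀ s, 0 ≤ wt s)
    (hmul : ∀ s t, wt s * wt t ≤ wt (s + t)) (E₀ : Finset γ) (he : E₀.card ≤ e)
    (hcount : ∀ E₁ ⊆ E₀, E₁.Nonempty →
      π * (𝓒.filter fun b => ∀ f ∈ E₁, g f ∈ b).card ≤ L * wt E₁.card) :
    ∀ E ⊆ E₀, ∑ W ∈ covers 𝓒 g E, π ^ W.card ≤ (2 ^ e * L) ^ E.card * wt E.card := by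
  intro E
  induction E using Finset.strongInduction with
  | H E ih =>
  intro hE
  have hpow : ∀ W : Finset (Finset β), 0 ≤ π ^ W.card := fun W => by positivity
  rcases Finset.eq_empty_or_nonempty E with rfl | hne
  · refine (Finset.sum_le_sum_of_subset_of_nonneg (covers_empty_subset 𝓒 g)
      fun W _ _ => hpow W).trans ?_
    simp [hwt0]
  set P := (2 ^ e * L : ℝ) with hP
  have hP1 : 1 ≤ P := by
    have : (1 : ℝ) ≤ 2 ^ e := one_le_pow₀ (by norm_num)
    nlinarith
  have hsub : covers 𝓒 g E ⊆ (E.powerset.filter Finset.Nonempty).biUnion fun E₁ =>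
      (𝓒.filter fun b => ∀ f ∈ E₁, g f ∈ b).biUnion fun b =>
        ((covers 𝓒 g (E \ E₁)).filter fun W' => b ∉ W').image fun W' => insert b W' := by
    intro W hW
    obtain ⟨E₁, h1, h2, b, hb, h3, W', hW', h4, rfl⟩ := exists_of_mem_covers hW hne
    simp only [Finset.mem_biUnion, Finset.mem_filter, Finset.mem_powerset, Finset.mem_image]
    exact ⟨E₁, ⟨h1, h2⟩, b, ⟨hb, h3⟩, W', ⟨hW', h4⟩, rfl⟩
  have hterm : ∀ E₁ ∈ E.powerset.filter Finset.Nonempty,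
      ∑ W ∈ (𝓒.filter fun b => ∀ f ∈ E₁, g f ∈ b).biUnion fun b =>
        ((covers 𝓒 g (E \ E₁)).filter fun W' => b ∉ W').image fun W' => insert b W',
        π ^ W.card ≤ L * P ^ (E.card - 1) * wt E.card := by
    intro E₁ hE₁
    rw [Finset.mem_filter, Finset.mem_powerset] at hE₁
    have hc1 : 0 < E₁.card := Finset.card_pos.2 hE₁.2
    have hcE : (E \ E₁).card + E₁.card = E.card := Finset.card_sdiff_add_card_eq_card hE₁.1
    have hih := ih (E \ E₁) (Finset.sdiff_ssubset hE₁.1 hE₁.2) (Finset.sdiff_subset.trans hE)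
    refine (sum_biUnion_le_sum _ _ _ hpow).trans ?_
    have hb : ∀ b ∈ 𝓒.filter fun b => ∀ f ∈ E₁, g f ∈ b,
        ∑ W ∈ ((covers 𝓒 g (E \ E₁)).filter fun W' => b ∉ W').image fun W' => insert b W',
          π ^ W.card ≤ π * (P ^ (E \ E₁).card * wt (E \ E₁).card) := by
      intro b _
      refine (sum_image_le_sum _ _ _ hpow).trans ?_
      have : ∀ W' ∈ (covers 𝓒 g (E \ E₁)).filter fun W' => b ∉ W',
          π ^ (insert b W').card = π * π ^ W'.card := by
        intro W' hW'
        rw [Finset.card_insert_of_notMem (Finset.mem_filter.1 hW').2, pow_succ']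
      rw [Finset.sum_congr rfl this, ← Finset.mul_sum]
      refine mul_le_mul_of_nonneg_left (le_trans ?_ hih) hπ
      exact Finset.sum_le_sum_of_subset_of_nonneg (Finset.filter_subset _ _) fun W _ _ => hpow W
    refine (Finset.sum_le_sum hb).trans ?_
    rw [Finset.sum_const, nsmul_eq_mul, ← mul_assoc, mul_comm _ π]
    have h0 := hwt (E \ E₁).card
    calc π * (𝓒.filter fun b => ∀ f ∈ E₁, g f ∈ b).card * (P ^ (E \ E₁).card * wt (E \ E₁).card)
        ≤ L * wt E₁.card * (P ^ (E.card - 1) * wt (E \ E₁).card) := by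
          have := hwt E₁.card
          refine mul_le_mul (hcount E₁ (hE₁.1.trans hE) hE₁.2) ?_ (by positivity) (by positivity)
          gcongr
          omega
      _ = L * P ^ (E.card - 1) * (wt (E \ E₁).card * wt E₁.card) := by ring
      _ ≤ L * P ^ (E.card - 1) * wt E.card := by
          gcongr
          rw [← hcE]
          exact hmul _ _
  refine (Finset.sum_le_sum_of_subset_of_nonneg hsub fun W _ _ => hpow W).trans ?_
  refine (sum_biUnion_le_sum _ _ _ hpow).trans ((Finset.sum_le_sum hterm).trans ?_)
  rw [Finset.sum_const, nsmul_eq_mul]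
  have hcard : ((E.powerset.filter Finset.Nonempty).card : ℝ) ≤ 2 ^ e := by
    have h1 := Finset.card_filter_le E.powerset Finset.Nonempty
    rw [Finset.card_powerset] at h1
    have h2 : 2 ^ E.card ≤ 2 ^ e :=
      Nat.pow_le_pow_right (by norm_num) ((Finset.card_le_card hE).trans he)
    exact_mod_cast h1.trans h2
  have h0 := hwt E.card
  calc ((E.powerset.filter Finset.Nonempty).card : ℝ) * (L * P ^ (E.card - 1) * wt E.card)
      ≤ 2 ^ e * (L * P ^ (E.card - 1) * wt E.card) := by gcongr
    _ = P * P ^ (E.card - 1) * wt E.card := by rw [hP]; ring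
    _ = P ^ E.card * wt E.card := by
        rw [← pow_succ', Nat.sub_add_cancel (Finset.card_pos.2 hne)]

end Covers

/-! ### Witnesses of conflicts between copies -/

section Witness

variable {m n k : ℕ} {F : Finset (Finset (Fin m))} {G : Finset (Finset (Fin n))}

/-- `W` consists of copies that together with `c` contain all edges of a further copy of `F`, which
meets `c` in at least one edge and is not contained in `c`. -/
def IsWitness (F : Finset (Finset (Fin m))) (G : Finset (Finset (Fin n)))
    (c : Finset (Finset (Fin n))) (W : Finset (Finset (Finset (Fin n)))) : Prop :=
  ∃ φ : Fin m → Fin n, Function.Injective φ ∧ ∃ E' ⊂ F, E'.Nonempty ∧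
    (∀ f ∈ E', f.image φ ∈ c) ∧ W ∈ covers (copies F G) (fun f => f.image φ) (F \ E')

lemma ceilDiv_mul_add_le {e : ℕ} (he : 0 < e) (a s t : ℕ) :
    ((s + t) * a) ⌈/⌉ e ≤ (s * a) ⌈/⌉ e + (t * a) ⌈/⌉ e := by
  rw [ceilDiv_le_iff_le_smul he, smul_add, add_mul]
  exact add_le_add (le_smul_ceilDiv he) (le_smul_ceilDiv he)

lemma card_biUnion_image {E : Finset (Finset (Fin m))} {φ : Fin m → Fin n}
    (hφ : Function.Injective φ) : ((E.biUnion id).image φ).card = (E.biUnion id).card :=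
  Finset.card_image_of_injective _ hφ

lemma image_biUnion_subset {E : Finset (Finset (Fin m))} {φ : Fin m → Fin n}
    {c : Finset (Finset (Fin n))} (h : ∀ f ∈ E, f.image φ ∈ c) :
    (E.biUnion id).image φ ⊆ c.biUnion id := by
  rw [← biUnion_copyOf]
  refine Finset.biUnion_subset_biUnion_of_subset_left _ fun x hx => ?_
  obtain ⟨f, hf, rfl⟩ := Finset.mem_image.1 hx
  exact h f hf

open Classical in
lemma sum_covers_copies_le (hk : 2 ≤ k) (hF : IsHG k m F) (hbal : StrictlyOneBalanced m F)
    (hne : F.Nonempty) {π : ℝ} (hπ : 0 ≤ π) (hn : 1 ≤ n) (hm : 1 ≤ m)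
    (hlam : 1 ≤ π * n ^ (m - 1)) {φ : Fin m → Fin n} (hφ : Function.Injective φ)
    {E' : Finset (Finset (Fin m))} (hE' : E' ⊂ F) (hE'ne : E'.Nonempty) :
    ∑ W ∈ covers (copies F G) (fun f => f.image φ) (F \ E'), π ^ W.card ≤
      (2 ^ F.card * (m ^ m * (π * n ^ (m - 1)))) ^ F.card *
        ((n : ℝ) ^ (((F.card - E'.card) * (m - 1)) ⌈/⌉ F.card))⁻¹ := by
  have he : 0 < F.card := Finset.card_pos.2 hne
  have hn1 : (1 : ℝ) ≤ n := by exact_mod_cast hn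
  have hm1 : (1 : ℝ) ≤ m ^ m := one_le_pow₀ (by exact_mod_cast hm)
  have hL : 1 ≤ (m : ℝ) ^ m * (π * n ^ (m - 1)) := by nlinarith
  have key := sum_covers_le (copies F G) (fun f : Finset (Fin m) => f.image φ) (π := π)
    (L := m ^ m * (π * n ^ (m - 1))) (e := F.card)
    (wt := fun t => ((n : ℝ) ^ ((t * (m - 1)) ⌈/⌉ F.card))⁻¹) hπ hL (by simp)
    (fun s => by positivity) ?_ (F \ E') (Finset.card_le_card Finset.sdiff_subset) ?_ _
    (subset_refl _)
  · refine key.trans ?_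
    rw [Finset.card_sdiff_of_subset hE'.1]
    have h1 : (1 : ℝ) ≤ 2 ^ F.card * (m ^ m * (π * n ^ (m - 1))) := by
      have : (1 : ℝ) ≤ 2 ^ F.card := one_le_pow₀ (by norm_num)
      nlinarith
    refine mul_le_mul_of_nonneg_right ?_ (by positivity)
    exact pow_le_pow_right₀ h1 (Nat.sub_le _ _)
  · intro s t
    rw [← mul_inv, ← pow_add]
    refine inv_anti₀ (by positivity) (pow_le_pow_right₀ hn1 (ceilDiv_mul_add_le he _ _ _))
  · intro E₁ hE₁ hE₁ne
    have hE₁F : E₁ ≠ F := by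
      rintro rfl
      obtain ⟨f, hf⟩ := hE'ne
      exact (Finset.mem_sdiff.1 (hE₁ (hE'.1 hf))).2 hf
    have hb := hbal.card_mul_lt hk hF (hE₁.trans Finset.sdiff_subset)
      (fun f hf => Finset.subset_biUnion_of_mem id hf) hE₁ne (fun h => hE₁F h.2)
    set s := (E₁.biUnion id).card with hs
    have hsm : s ≤ m := by simpa using Finset.card_le_univ (E₁.biUnion id)
    have hs1 : 1 ≤ s := by
      by_contra h
      have : s = 0 := by omega
      rw [this] at hb
      omega
    have hα : (E₁.card * (m - 1)) ⌈/⌉ F.card ≤ s - 1 := by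
      rw [ceilDiv_le_iff_le_smul he, smul_eq_mul]
      have : F.card * (s - 1) + F.card = F.card * s := by
        rw [← Nat.mul_succ, Nat.succ_eq_add_one, Nat.sub_add_cancel hs1]
      omega
    have hc : ((copies F G).filter fun b => ∀ f ∈ E₁, f.image φ ∈ b).card ≤
        m ^ m * n ^ (m - s) := by
      refine (Finset.card_le_card (Finset.monotone_filter_right _
        fun b _ hb => image_biUnion_subset hb)).trans
        ((card_copies_superset_le ((E₁.biUnion id).image φ)).trans ?_)
      rw [card_biUnion_image hφ]
      exact Nat.mul_le_mul_right _ (Nat.pow_le_pow_right hm hsm)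
    have hc' : (((copies F G).filter fun b => ∀ f ∈ E₁, f.image φ ∈ b).card : ℝ) ≤
        m ^ m * n ^ (m - s) := by exact_mod_cast hc
    have hnn : (n : ℝ) ^ (m - s) ≤ n ^ (m - 1) *
        ((n : ℝ) ^ ((E₁.card * (m - 1)) ⌈/⌉ F.card))⁻¹ := by
      rw [← div_eq_mul_inv, le_div_iff₀ (by positivity), ← pow_add]
      exact pow_le_pow_right₀ hn1 (by omega)
    have hfin : π * ((copies F G).filter fun b => ∀ f ∈ E₁, f.image φ ∈ b).card ≤
        m ^ m * (π * n ^ (m - 1)) * ((n : ℝ) ^ ((E₁.card * (m - 1)) ⌈/⌉ F.card))⁻¹ := by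
      refine (mul_le_mul_of_nonneg_left (hc'.trans
        (mul_le_mul_of_nonneg_left hnn (by positivity))) hπ).trans (le_of_eq ?_)
      generalize ((n : ℝ) ^ ((E₁.card * (m - 1)) ⌈/⌉ F.card))⁻¹ = x
      ring
    convert hfin

open Classical in
lemma sum_witness_le (hk : 2 ≤ k) (hF : IsHG k m F) (hbal : StrictlyOneBalanced m F)
    (hne : F.Nonempty) {π : ℝ} (hπ : 0 ≤ π) (hn : 1 ≤ n) (hm : 1 ≤ m)
    (hlam : 1 ≤ π * n ^ (m - 1)) {c : Finset (Finset (Fin n))} (hc : c ∈ copies F G) :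
    ∑ W ∈ (copies F G).powerset.filter (IsWitness F G c), π ^ W.card ≤
      2 ^ F.card * m ^ m * (2 ^ F.card * (m ^ m * (π * n ^ (m - 1)))) ^ F.card / n := by
  have he : 0 < F.card := Finset.card_pos.2 hne
  have hn1 : (1 : ℝ) ≤ n := by exact_mod_cast hn
  have hpow : ∀ W : Finset (Finset (Finset (Fin n))), 0 ≤ π ^ W.card := fun W => by positivity
  set P := (2 ^ F.card * ((m : ℝ) ^ m * (π * n ^ (m - 1)))) ^ F.card with hP
  have hP0 : 0 ≤ P := by positivity
  have hsub : (copies F G).powerset.filter (IsWitness F G c) ⊆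
      (F.powerset.filter fun E' => E' ⊂ F ∧ E'.Nonempty).biUnion fun E' =>
        (Finset.univ.filter fun φ : Fin m → Fin n => Function.Injective φ ∧
          ∀ f ∈ E', f.image φ ∈ c).biUnion fun φ =>
          covers (copies F G) (fun f => f.image φ) (F \ E') := by
    intro W hW
    obtain ⟨φ, hφ, E', hE', hE'ne, h1, h2⟩ := (Finset.mem_filter.1 hW).2
    simp only [Finset.mem_biUnion, Finset.mem_filter, Finset.mem_powerset, Finset.mem_univ,
      true_and]
    exact ⟨E', ⟨hE'.1, hE', hE'ne⟩, φ, ⟨hφ, h1⟩, h2⟩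
  have hterm : ∀ E' ∈ F.powerset.filter fun E' => E' ⊂ F ∧ E'.Nonempty,
      ∑ W ∈ (Finset.univ.filter fun φ : Fin m → Fin n => Function.Injective φ ∧
          ∀ f ∈ E', f.image φ ∈ c).biUnion fun φ =>
          covers (copies F G) (fun f => f.image φ) (F \ E'), π ^ W.card ≤ m ^ m * P / n := by
    intro E' hE'
    obtain ⟨-, hE', hE'ne⟩ := Finset.mem_filter.1 hE'
    refine (sum_biUnion_le_sum _ _ _ hpow).trans ?_
    refine (Finset.sum_le_sum fun φ hφ => sum_covers_copies_le hk hF hbal hne hπ hn hm hlam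
      (Finset.mem_filter.1 hφ).2.1 hE' hE'ne).trans ?_
    rw [Finset.sum_const, nsmul_eq_mul, ← hP]
    have hb := hbal.card_mul_lt hk hF hE'.1
      (fun f hf => Finset.subset_biUnion_of_mem id hf) hE'ne (fun h => hE'.ne h.2)
    set s := (E'.biUnion id).card with hs
    have hsm : s ≤ m := by simpa using Finset.card_le_univ (E'.biUnion id)
    have hcount : (Finset.univ.filter fun φ : Fin m → Fin n => Function.Injective φ ∧
          ∀ f ∈ E', f.image φ ∈ c).card ≤ m ^ m * n ^ (m - s) := by
      refine (Finset.card_le_card ?_).trans ((card_maps_into_le (V := Fin n) (E'.biUnion id)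
        (fun _ => c.biUnion id) (B := m) fun _ _ => card_biUnion_le_of_mem_copies hc).trans ?_)
      · intro φ hφ
        simp only [Finset.mem_filter, Finset.mem_univ, true_and] at hφ ⊢
        exact fun x hx => image_biUnion_subset hφ.2 (Finset.mem_image_of_mem _ hx)
      · rw [Fintype.card_fin, Fintype.card_fin]
        exact Nat.mul_le_mul_right _ (Nat.pow_le_pow_right hm hsm)
    have hcount' : ((Finset.univ.filter fun φ : Fin m → Fin n => Function.Injective φ ∧
          ∀ f ∈ E', f.image φ ∈ c).card : ℝ) ≤ m ^ m * n ^ (m - s) := by exact_mod_cast hcount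
    have hα : m - s + 1 ≤ ((F.card - E'.card) * (m - 1)) ⌈/⌉ F.card := by
      by_contra! h
      have h1 := (ceilDiv_le_iff_le_smul he).1 (Nat.le_of_lt_succ h)
      rw [smul_eq_mul] at h1
      have h2 : (F.card - E'.card) * (m - 1) + E'.card * (m - 1) = F.card * (m - 1) := by
        rw [← add_mul, Nat.sub_add_cancel (Finset.card_le_card hE'.1)]
      have h3 : F.card * (m - 1) + F.card = F.card * m := by
        rw [← Nat.mul_succ, Nat.succ_eq_add_one, Nat.sub_add_cancel hm]
      have h4 : F.card * (m - s) + F.card * s = F.card * m := by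
        rw [← mul_add, Nat.sub_add_cancel hsm]
      omega
    calc ((Finset.univ.filter fun φ : Fin m → Fin n => Function.Injective φ ∧
          ∀ f ∈ E', f.image φ ∈ c).card : ℝ) *
          (P * ((n : ℝ) ^ (((F.card - E'.card) * (m - 1)) ⌈/⌉ F.card))⁻¹)
        ≤ m ^ m * n ^ (m - s) * (P * ((n : ℝ) ^ (m - s + 1))⁻¹) := by
          gcongr
      _ = m ^ m * P / n := by
          rw [pow_succ]
          field_simp
  refine (Finset.sum_le_sum_of_subset_of_nonneg hsub fun W _ _ => hpow W).trans ?_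
  refine (sum_biUnion_le_sum _ _ _ hpow).trans ((Finset.sum_le_sum hterm).trans ?_)
  rw [Finset.sum_const, nsmul_eq_mul]
  have hcard : ((F.powerset.filter fun E' => E' ⊂ F ∧ E'.Nonempty).card : ℝ) ≤ 2 ^ F.card := by
    have h1 := Finset.card_filter_le F.powerset fun E' => E' ⊂ F ∧ E'.Nonempty
    rw [Finset.card_powerset] at h1
    exact_mod_cast h1
  calc _ ≤ 2 ^ F.card * (m ^ m * P / n) := by gcongr
    _ = _ := by ring

end Witness

/-! ### Random families of copies are locally sparse -/

section Good

variable {m n k : ℕ} {F : Finset (Finset (Fin m))} {G : Finset (Finset (Fin n))}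

/-- Every vertex is in at most `Δ` members of `S`, and no member of `S` has two disjoint witnesses
inside `S`. -/
def IsGood (F : Finset (Finset (Fin m))) (G : Finset (Finset (Fin n))) (Δ : ℕ)
    (S : Finset (Finset (Finset (Fin n)))) : Prop :=
  (∀ v, (S.filter fun c => v ∈ c.biUnion id).card ≤ Δ) ∧
    ∀ c ∈ S, ∀ W₁ ⊆ S, ∀ W₂ ⊆ S, c ∉ W₁ → c ∉ W₂ → Disjoint W₁ W₂ → IsWitness F G c W₁ →
      ¬ IsWitness F G c W₂

lemma IsGood.anti {Δ : ℕ} {S T : Finset (Finset (Finset (Fin n)))} (hST : S ⊆ T)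
    (hT : IsGood F G Δ T) : IsGood F G Δ S :=
  ⟨fun v => (Finset.card_le_card (Finset.filter_subset_filter _ hST)).trans (hT.1 v),
    fun c hc W₁ h₁ W₂ h₂ => hT.2 c (hST hc) W₁ (h₁.trans hST) W₂ (h₂.trans hST)⟩

open Classical in
lemma rexp_degree_gt_le {π : ℝ} (h0 : 0 ≤ π) (h1 : π ≤ 1) (Δ : ℕ) (v : Fin n) :
    rexp (copies F G) π (fun S => if Δ < (S.filter fun c => v ∈ c.biUnion id).card then 1 else 0) ≤
      (1 / 2) ^ Δ * Real.exp (m * (π * n ^ (m - 1))) := by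
  set A := (copies F G).filter fun c => v ∈ c.biUnion id with hA
  have hcard : (A.card : ℝ) ≤ m * n ^ (m - 1) := by
    have := card_copies_superset_le (F := F) (G := G) {v}
    simp only [Finset.singleton_subset_iff, Finset.card_singleton, pow_one] at this
    exact_mod_cast this
  calc _ ≤ rexp (copies F G) π (fun S => (1 / 2) ^ Δ * 2 ^ (S ∩ A).card) := by
        refine rexp_mono h0 h1 fun S hS => ?_
        have hSA : S ∩ A = S.filter fun c => v ∈ c.biUnion id := by
          rw [hA, Finset.inter_filter, Finset.inter_eq_left.2 hS]
        rw [hSA]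
        split_ifs with h
        · rw [div_pow, one_pow, one_div, inv_mul_eq_div, le_div_iff₀ (by positivity), one_mul]
          exact pow_le_pow_right₀ (by norm_num) h.le
        · positivity
    _ = (1 / 2) ^ Δ * (1 + π) ^ A.card := by
        rw [rexp_const_mul, rexp_two_pow_card _ _ (Finset.filter_subset _ _)]
    _ ≤ (1 / 2) ^ Δ * Real.exp (m * (π * n ^ (m - 1))) := by
        refine mul_le_mul_of_nonneg_left ?_ (by positivity)
        calc (1 + π) ^ A.card ≤ Real.exp π ^ A.card := by
              gcongr
              linarith [Real.add_one_le_exp π]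
          _ = Real.exp (A.card * π) := (Real.exp_nat_mul _ _).symm
          _ ≤ _ := by
            refine Real.exp_le_exp.2 ?_
            calc (A.card : ℝ) * π ≤ m * n ^ (m - 1) * π := by gcongr
              _ = _ := by ring

open Classical in
lemma rexp_not_isGood_le (hk : 2 ≤ k) (hF : IsHG k m F) (hbal : StrictlyOneBalanced m F)
    (hne : F.Nonempty) {π : ℝ} (h0 : 0 ≤ π) (h1 : π ≤ 1) (hn : 1 ≤ n) (hm : 1 ≤ m)
    (hlam : 1 ≤ π * n ^ (m - 1)) (Δ : ℕ) :
    rexp (copies F G) π (fun S => if IsGood F G Δ S then 0 else 1) ≤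
      n * ((1 / 2) ^ Δ * Real.exp (m * (π * n ^ (m - 1)))) +
        π * n ^ (m - 1) * (2 ^ F.card * m ^ m *
          (2 ^ F.card * (m ^ m * (π * n ^ (m - 1)))) ^ F.card) ^ 2 / n := by
  set K := 2 ^ F.card * (m : ℝ) ^ m * (2 ^ F.card * (m ^ m * (π * n ^ (m - 1)))) ^ F.card with hK
  have hnR : (1 : ℝ) ≤ n := by exact_mod_cast hn
  set 𝓦 := fun c => (copies F G).powerset.filter (IsWitness F G c) with h𝓦
  have hstep : rexp (copies F G) π (fun S => if IsGood F G Δ S then 0 else 1) ≤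
      rexp (copies F G) π (fun S =>
        (∑ v : Fin n, if Δ < (S.filter fun c => v ∈ c.biUnion id).card then (1 : ℝ) else 0) +
        ∑ c ∈ copies F G, ∑ W₁ ∈ 𝓦 c, ∑ W₂ ∈ 𝓦 c,
          if c ∉ W₁ ∧ c ∉ W₂ ∧ Disjoint W₁ W₂ ∧ insert c (W₁ ∪ W₂) ⊆ S then (1 : ℝ) else 0) := by
    refine rexp_mono h0 h1 fun S hS => ?_
    have hA : 0 ≤ ∑ v : Fin n, if Δ < (S.filter fun c => v ∈ c.biUnion id).card then
      (1 : ℝ) else 0 :=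
      Finset.sum_nonneg fun v _ => by positivity
    have hB : 0 ≤ ∑ c ∈ copies F G, ∑ W₁ ∈ 𝓦 c, ∑ W₂ ∈ 𝓦 c,
          if c ∉ W₁ ∧ c ∉ W₂ ∧ Disjoint W₁ W₂ ∧ insert c (W₁ ∪ W₂) ⊆ S then (1 : ℝ) else 0 :=
      Finset.sum_nonneg fun c _ => Finset.sum_nonneg fun W₁ _ => Finset.sum_nonneg fun W₂ _ => by
        positivity
    split_ifs with hgood
    · exact add_nonneg hA hB
    rw [IsGood, not_and_or] at hgood
    push Not at hgood
    rcases hgood with ⟨v, hv⟩ | ⟨c, hc, W₁, hW₁, W₂, hW₂, hc₁, hc₂, hd, hw₁, hw₂⟩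
    · refine le_add_of_le_of_nonneg ?_ hB
      have := Finset.single_le_sum (f := fun v => if Δ < (S.filter fun c => v ∈ c.biUnion id).card
        then (1 : ℝ) else 0) (fun v _ => by positivity) (Finset.mem_univ v)
      simp only [if_pos hv] at this
      exact this
    · refine le_add_of_nonneg_of_le hA ?_
      refine le_trans ?_ (Finset.single_le_sum (f := fun c => ∑ W₁ ∈ 𝓦 c, ∑ W₂ ∈ 𝓦 c,
          if c ∉ W₁ ∧ c ∉ W₂ ∧ Disjoint W₁ W₂ ∧ insert c (W₁ ∪ W₂) ⊆ S then (1 : ℝ) else 0)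
        (fun c _ => Finset.sum_nonneg fun W₁ _ => Finset.sum_nonneg fun W₂ _ => by positivity)
        (hS hc))
      refine le_trans ?_ (Finset.single_le_sum (f := fun W₁ => ∑ W₂ ∈ 𝓦 c,
          if c ∉ W₁ ∧ c ∉ W₂ ∧ Disjoint W₁ W₂ ∧ insert c (W₁ ∪ W₂) ⊆ S then (1 : ℝ) else 0)
        (fun W₁ _ => Finset.sum_nonneg fun W₂ _ => by positivity)
        (Finset.mem_filter.2 ⟨Finset.mem_powerset.2 (hW₁.trans hS), hw₁⟩))
      refine le_trans ?_ (Finset.single_le_sum (f := fun W₂ =>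
          if c ∉ W₁ ∧ c ∉ W₂ ∧ Disjoint W₁ W₂ ∧ insert c (W₁ ∪ W₂) ⊆ S then (1 : ℝ) else 0)
        (fun W₂ _ => by positivity)
        (Finset.mem_filter.2 ⟨Finset.mem_powerset.2 (hW₂.trans hS), hw₂⟩))
      rw [if_pos ⟨hc₁, hc₂, hd, Finset.insert_subset hc (Finset.union_subset hW₁ hW₂)⟩]
  refine hstep.trans ?_
  rw [rexp_add, rexp_sum, rexp_sum]
  refine add_le_add ?_ ?_
  · refine (Finset.sum_le_sum fun v _ => rexp_degree_gt_le h0 h1 Δ v).trans (le_of_eq ?_)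
    simp
  have hterm : ∀ c ∈ copies F G, ∀ W₁ ∈ 𝓦 c, ∀ W₂ ∈ 𝓦 c, rexp (copies F G) π (fun S =>
      if c ∉ W₁ ∧ c ∉ W₂ ∧ Disjoint W₁ W₂ ∧ insert c (W₁ ∪ W₂) ⊆ S then (1 : ℝ) else 0) ≤
      π * (π ^ W₁.card * π ^ W₂.card) := by
    intro c hc W₁ hW₁ W₂ hW₂
    by_cases h : c ∉ W₁ ∧ c ∉ W₂ ∧ Disjoint W₁ W₂
    · have hsub : insert c (W₁ ∪ W₂) ⊆ copies F G := Finset.insert_subset hc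
        (Finset.union_subset (Finset.mem_powerset.1 (Finset.mem_filter.1 hW₁).1)
          (Finset.mem_powerset.1 (Finset.mem_filter.1 hW₂).1))
      have := rexp_subset_prob (copies F G) π _ hsub
      rw [Finset.card_insert_of_notMem (by simp [h.1, h.2.1]),
        Finset.card_union_of_disjoint h.2.2, pow_succ', pow_add] at this
      rw [← this]
      refine le_of_eq (rexp_congr fun S _ => ?_)
      simp only [h.1, h.2.1, h.2.2, not_false_eq_true, true_and]
    · have : ∀ S, ¬ (c ∉ W₁ ∧ c ∉ W₂ ∧ Disjoint W₁ W₂ ∧ insert c (W₁ ∪ W₂) ⊆ S) :=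
        fun S hS => h ⟨hS.1, hS.2.1, hS.2.2.1⟩
      simp only [if_neg (this _)]
      rw [rexp_const]
      positivity
  have hc : ∀ c ∈ copies F G, rexp (copies F G) π (fun S => ∑ W₁ ∈ 𝓦 c, ∑ W₂ ∈ 𝓦 c,
      if c ∉ W₁ ∧ c ∉ W₂ ∧ Disjoint W₁ W₂ ∧ insert c (W₁ ∪ W₂) ⊆ S then (1 : ℝ) else 0) ≤
      π * (K / n) ^ 2 := by
    intro c hc
    rw [rexp_sum]
    have hsum := sum_witness_le (G := G) hk hF hbal hne h0 hn hm hlam hc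
    have hs0 : 0 ≤ ∑ W ∈ 𝓦 c, π ^ W.card := Finset.sum_nonneg fun W _ => by positivity
    calc _ ≤ ∑ W₁ ∈ 𝓦 c, ∑ W₂ ∈ 𝓦 c, π * (π ^ W₁.card * π ^ W₂.card) := by
          refine Finset.sum_le_sum fun W₁ hW₁ => ?_
          rw [rexp_sum]
          exact Finset.sum_le_sum fun W₂ hW₂ => hterm c hc W₁ hW₁ W₂ hW₂
      _ = π * (∑ W ∈ 𝓦 c, π ^ W.card) ^ 2 := by
          rw [sq, Finset.sum_mul_sum, Finset.mul_sum]
          exact Finset.sum_congr rfl fun W₁ _ => by rw [Finset.mul_sum]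
      _ ≤ π * (K / n) ^ 2 := by gcongr
  refine (Finset.sum_le_sum hc).trans ?_
  rw [Finset.sum_const, nsmul_eq_mul]
  have hcard : ((copies F G).card : ℝ) ≤ n ^ m := by
    exact_mod_cast card_copies_le (F := F) (G := G)
  have hnm : (n : ℝ) ^ m = n ^ (m - 1) * n := by rw [← pow_succ, Nat.sub_add_cancel hm]
  calc ((copies F G).card : ℝ) * (π * (K / n) ^ 2) ≤ n ^ m * (π * (K / n) ^ 2) := by gcongr
    _ = π * n ^ (m - 1) * K ^ 2 / n := by
      rw [hnm]
      field_simp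

end Good

/-! ### Bounding the interaction of a sparse family -/

section Interaction

variable {m n k : ℕ} {F : Finset (Finset (Fin m))} {G : Finset (Finset (Fin n))}

/-- The vertices in `A` or in a common copy of `S` with a vertex in `A`. -/
def nbhd (S : Finset (Finset (Finset (Fin n)))) (A : Finset (Fin n)) : Finset (Fin n) :=
  A ∪ A.biUnion fun v => (S.filter fun b => v ∈ b.biUnion id).biUnion fun b => b.biUnion id

lemma subset_nbhd (S : Finset (Finset (Finset (Fin n)))) (A : Finset (Fin n)) : A ⊆ nbhd S A :=
  Finset.subset_union_left

lemma card_nbhd_le {S : Finset (Finset (Finset (Fin n)))} {Δ : ℕ}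
    (hcard : ∀ b ∈ S, (b.biUnion id).card ≤ m)
    (hdeg : ∀ v, (S.filter fun c => v ∈ c.biUnion id).card ≤ Δ) (A : Finset (Fin n)) :
    (nbhd S A).card ≤ A.card * (1 + Δ * m) := by
  rw [nbhd, mul_add, mul_one]
  refine (Finset.card_union_le _ _).trans (Nat.add_le_add_left ?_ _)
  refine Finset.card_biUnion_le_card_mul _ _ _ fun v _ => ?_
  refine (Finset.card_biUnion_le_card_mul _ _ m
    fun b hb => hcard b (Finset.mem_filter.1 hb).1).trans
    (Nat.mul_le_mul_right _ (hdeg v))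

lemma card_iterate_nbhd_le {S : Finset (Finset (Finset (Fin n)))} {Δ : ℕ}
    (hcard : ∀ b ∈ S, (b.biUnion id).card ≤ m)
    (hdeg : ∀ v, (S.filter fun c => v ∈ c.biUnion id).card ≤ Δ) (A : Finset (Fin n)) (t : ℕ) :
    ((nbhd S)^[t] A).card ≤ A.card * (1 + Δ * m) ^ t := by
  induction t with
  | zero => simp
  | succ t ih =>
    rw [Function.iterate_succ_apply', pow_succ, ← mul_assoc]
    exact (card_nbhd_le hcard hdeg _).trans (Nat.mul_le_mul_right _ ih)

lemma iterate_nbhd_mono (S : Finset (Finset (Finset (Fin n)))) (A : Finset (Fin n)) {s t : ℕ}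
    (h : s ≤ t) : (nbhd S)^[s] A ⊆ (nbhd S)^[t] A := by
  induction t, h using Nat.le_induction with
  | base => exact subset_refl _
  | succ t _ ih =>
    rw [Function.iterate_succ_apply']
    exact ih.trans (subset_nbhd _ _)

lemma mem_iterate_nbhd_of_walk {S : Finset (Finset (Finset (Fin n)))}
    {E' : Finset (Finset (Fin m))} {φ : Fin m → Fin n}
    (hφ : ∀ f ∈ E', f.image φ ∈ S.biUnion id) {A : Finset (Fin n)} {x y : Fin m}
    (w : (shadow E').Walk x y) : ∀ t, φ x ∈ (nbhd S)^[t] A → φ y ∈ (nbhd S)^[t + w.length] A := by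
  induction w with
  | nil => intro t h; exact h
  | @cons x z y hadj w ih =>
    intro t h
    rw [SimpleGraph.Walk.length_cons, Nat.add_comm w.length, ← Nat.add_assoc]
    refine ih (t + 1) ?_
    rw [Function.iterate_succ_apply', nbhd]
    refine Finset.mem_union_right _ ?_
    rw [shadow, SimpleGraph.fromRel_adj] at hadj
    obtain ⟨f, hf, hx, hz⟩ : ∃ f ∈ E', x ∈ f ∧ z ∈ f := by
      rcases hadj.2 with ⟨f, hf, h1, h2⟩ | ⟨f, hf, h1, h2⟩
      · exact ⟨f, hf, h1, h2⟩
      · exact ⟨f, hf, h2, h1⟩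
    obtain ⟨b, hb, hfb⟩ := Finset.mem_biUnion.1 (hφ f hf)
    simp only [Finset.mem_biUnion, Finset.mem_filter, id]
    exact ⟨φ x, h, b, ⟨hb, _, hfb, Finset.mem_image_of_mem _ hx⟩, _, hfb,
      Finset.mem_image_of_mem _ hz⟩

open Classical in
/-- A map sending the edges `E'` into edges of copies from `S` is determined up to few choices by
its values on one vertex of each component, and a component that meets `A` is almost determined. -/
lemma card_maps_component_le {S : Finset (Finset (Finset (Fin n)))} {Δ : ℕ} (hm : 1 ≤ m)
    (hcard : ∀ b ∈ S, (b.biUnion id).card ≤ m)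
    (hdeg : ∀ v, (S.filter fun c => v ∈ c.biUnion id).card ≤ Δ) {A : Finset (Fin n)}
    (hA : A.card ≤ m) (E' : Finset (Finset (Fin m))) :
    (Finset.univ.filter fun φ : Fin m → Fin n =>
      (∀ f ∈ E', f.image φ ∈ S.biUnion id) ∧ ∃ x, φ x ∈ A).card ≤
      m * (n ^ (Fintype.card (shadow E').ConnectedComponent - 1) * (m * (1 + Δ * m) ^ m) ^ m) := by
  set comp := (shadow E').connectedComponentMk with hcomp
  set Y : (x₀ : Fin m) → ({K // K ≠ comp x₀} → Fin n) → Fin m → Finset (Fin n) := fun x₀ g x =>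
    if h : comp x = comp x₀ then (nbhd S)^[m] A else (nbhd S)^[m] {g ⟨comp x, h⟩} with hY
  have hreach : ∀ φ : Fin m → Fin n, (∀ f ∈ E', f.image φ ∈ S.biUnion id) → ∀ x y,
      comp x = comp y → ∀ B : Finset (Fin n), φ x ∈ B → φ y ∈ (nbhd S)^[m] B := by
    intro φ hφ x y hxy B hB
    obtain ⟨w, hw⟩ := (SimpleGraph.ConnectedComponent.exact hxy).exists_isPath
    have hlen : w.length < m := by simpa using hw.length_lt
    have := mem_iterate_nbhd_of_walk hφ (A := B) w 0 hB
    rw [zero_add] at this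
    exact iterate_nbhd_mono S B hlen.le this
  have hsub : (Finset.univ.filter fun φ : Fin m → Fin n =>
      (∀ f ∈ E', f.image φ ∈ S.biUnion id) ∧ ∃ x, φ x ∈ A) ⊆
      (Finset.univ : Finset (Fin m)).biUnion fun x₀ =>
        (Finset.univ : Finset ({K // K ≠ comp x₀} → Fin n)).biUnion fun g =>
          Finset.univ.filter fun φ : Fin m → Fin n => ∀ x ∈ Finset.univ, φ x ∈ Y x₀ g x := by
    intro φ hφ
    obtain ⟨-, hφ, x₀, hx₀⟩ := Finset.mem_filter.1 hφ
    simp only [Finset.mem_biUnion, Finset.mem_filter, Finset.mem_univ, true_and, forall_true_left]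
    refine ⟨x₀, fun K => φ K.1.out, fun x => ?_⟩
    simp only [hY]
    split_ifs with h
    · exact hreach φ hφ x₀ x h.symm A hx₀
    · exact hreach φ hφ _ x (Quot.out_eq (comp x)) _ (Finset.mem_singleton_self _)
  have hYcard : ∀ x₀ g x, (Y x₀ g x).card ≤ m * (1 + Δ * m) ^ m := by
    intro x₀ g x
    simp only [hY]
    split_ifs with h
    · exact (card_iterate_nbhd_le hcard hdeg _ _).trans (Nat.mul_le_mul_right _ hA)
    · exact (card_iterate_nbhd_le hcard hdeg _ _).trans (Nat.mul_le_mul_right _ (by simpa using hm))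
  refine (Finset.card_le_card hsub).trans ?_
  refine (Finset.card_biUnion_le_card_mul _ _
    (n ^ (Fintype.card (shadow E').ConnectedComponent - 1) * (m * (1 + Δ * m) ^ m) ^ m)
    fun x₀ _ => ?_).trans (by rw [Finset.card_univ, Fintype.card_fin])
  refine (Finset.card_biUnion_le_card_mul _ _ ((m * (1 + Δ * m) ^ m) ^ m) fun g _ => ?_).trans
    (le_of_eq ?_)
  · have h := card_maps_into_le Finset.univ (Y x₀ g) fun x _ => hYcard x₀ g x
    rw [Finset.card_univ, Nat.sub_self, pow_zero, mul_one, Fintype.card_fin] at h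
    convert h
  · rw [Finset.card_univ, Fintype.card_fun, Fintype.card_fin, Fintype.card_subtype_compl,
      Fintype.card_subtype_eq]

lemma exists_witness_of_subset {σ : Finset (Finset (Finset (Fin n)))}
    (hσ : σ ⊆ copies F G) {c : Finset (Finset (Fin n))} (hc : c ∈ copies F G)
    {φ : Fin m → Fin n} (hφ : Function.Injective φ) (hne : copyOf F φ ≠ c)
    (hinter : ¬ copyOf F φ ∩ c ⊆ σ.biUnion id)
    (hsub : ∀ f ∈ F, f.image φ ∈ σ.biUnion id ∪ c) : ∃ W ⊆ σ, IsWitness F G c W := by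
  classical
  have hw : ∀ f ∈ F \ F.filter fun f => f.image φ ∈ c, ∃ b ∈ σ, f.image φ ∈ b := by
    intro f hf
    rw [Finset.mem_sdiff, Finset.mem_filter] at hf
    rcases Finset.mem_union.1 (hsub f hf.1) with h | h
    · simpa using h
    · exact absurd ⟨hf.1, h⟩ hf.2
  choose! w hw1 hw2 using hw
  have hWσ : (F \ F.filter fun f => f.image φ ∈ c).image w ⊆ σ := by
    intro b hb
    obtain ⟨f, hf, rfl⟩ := Finset.mem_image.1 hb
    exact hw1 f hf
  refine ⟨_, hWσ, φ, hφ, F.filter fun f => f.image φ ∈ c, ?_, ?_,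
    fun f hf => (Finset.mem_filter.1 hf).2, mem_covers.2 ⟨hWσ.trans hσ, w, hw2, rfl⟩⟩
  · refine (Finset.filter_subset _ _).ssubset_of_ne fun h => hne ?_
    refine Finset.eq_of_subset_of_card_le ?_ (by rw [card_copyOf hφ, card_of_mem_copies hc])
    intro x hx
    obtain ⟨f, hf, rfl⟩ := Finset.mem_image.1 hx
    rw [← h] at hf
    exact (Finset.mem_filter.1 hf).2
  · obtain ⟨x, hx, -⟩ := Finset.not_subset.1 hinter
    obtain ⟨hx1, hx2⟩ := Finset.mem_inter.1 hx
    obtain ⟨f, hf, rfl⟩ := Finset.mem_image.1 hx1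
    exact ⟨f, Finset.mem_filter.2 ⟨hf, hx2⟩⟩

open Classical in
lemma interaction_le (hk : 2 ≤ k) (hF : IsHG k m F) (hbal : StrictlyOneBalanced m F)
    (hm : 1 ≤ m) {p η : ℝ} (hp0 : 0 ≤ p) (hη0 : 0 ≤ η)
    (hη : ∀ t r, F.card * r + 1 ≤ (m - 1) * t → t ≤ F.card → (n : ℝ) ^ r * p ^ t ≤ η) {Δ : ℕ}
    {σ : Finset (Finset (Finset (Fin n)))} (hσ : σ ⊆ copies F G) {c : Finset (Finset (Fin n))}
    (hc : c ∈ copies F G) (hdeg : ∀ v, ((insert c σ).filter fun b => v ∈ b.biUnion id).card ≤ Δ)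
    (hW : ∀ W ⊆ σ, ¬ IsWitness F G c W) :
    interaction (copies F G) p σ c ≤
      2 ^ F.card * (m * ((m * (1 + Δ * m) ^ m) ^ m * η)) := by
  set R := σ.biUnion id ∪ c with hR
  have hRS : (insert c σ).biUnion id = R := by
    rw [Finset.biUnion_insert, hR, Finset.union_comm]; rfl
  have hcard : ∀ b ∈ insert c σ, (b.biUnion id).card ≤ m := fun b hb =>
    card_biUnion_le_of_mem_copies (Finset.insert_subset hc hσ hb)
  set Φ : Finset (Finset (Fin m)) → Finset (Fin m → Fin n) := fun E' =>
    Finset.univ.filter fun φ => Function.Injective φ ∧ (F.filter fun f => f.image φ ∈ R) = E' ∧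
      ∃ x, φ x ∈ c.biUnion id with hΦ
  have hsub : ((copies F G).filter fun b => b ∉ σ ∧ b ≠ c ∧ ¬ b ∩ c ⊆ σ.biUnion id) ⊆
      (F.powerset.filter fun E' => E' ⊂ F ∧ E'.Nonempty).biUnion fun E' =>
        (Φ E').image (copyOf F) := by
    intro b hb
    obtain ⟨hbC, -, hbc, hinter⟩ := Finset.mem_filter.1 hb
    obtain ⟨φ, ⟨hφ, -⟩, rfl⟩ := mem_copies.1 hbC
    obtain ⟨x, hx, -⟩ := Finset.not_subset.1 hinter
    obtain ⟨hx1, hx2⟩ := Finset.mem_inter.1 hx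
    obtain ⟨f₀, hf₀, rfl⟩ := Finset.mem_image.1 hx1
    obtain ⟨v, hv⟩ : f₀.Nonempty := Finset.card_pos.1 (by rw [hF f₀ hf₀]; omega)
    simp only [Finset.mem_biUnion, Finset.mem_filter, Finset.mem_powerset]
    refine ⟨F.filter fun f => f.image φ ∈ R, ⟨Finset.filter_subset _ _, ?_, f₀, ?_⟩,
      Finset.mem_image_of_mem _ (Finset.mem_filter.2 ⟨Finset.mem_univ _, hφ, rfl, v, ?_⟩)⟩
    · refine (Finset.filter_subset _ _).ssubset_of_ne fun h => ?_
      obtain ⟨W, hWσ, hWw⟩ := exists_witness_of_subset hσ hc hφ hbc hinter fun f hf => by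
        rw [← h] at hf
        exact (Finset.mem_filter.1 hf).2
      exact hW W hWσ hWw
    · exact Finset.mem_filter.2 ⟨hf₀, Finset.mem_union_right _ hx2⟩
    · exact Finset.mem_biUnion.2 ⟨_, hx2, Finset.mem_image_of_mem _ hv⟩
  have hpow : ∀ b : Finset (Finset (Fin n)), 0 ≤ p ^ (b \ R).card := fun b => by positivity
  have hterm : ∀ E' ∈ F.powerset.filter fun E' => E' ⊂ F ∧ E'.Nonempty,
      ∑ b ∈ (Φ E').image (copyOf F), p ^ (b \ R).card ≤
        m * ((m * (1 + Δ * m) ^ m) ^ m * η) := by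
    intro E' hE'
    obtain ⟨-, hE', hE'ne⟩ := Finset.mem_filter.1 hE'
    refine (sum_image_le_sum _ _ _ hpow).trans ?_
    have hval : ∀ φ ∈ Φ E', p ^ (copyOf F φ \ R).card = p ^ (F.card - E'.card) := by
      intro φ hφ
      obtain ⟨-, hφ, hφE, -⟩ := Finset.mem_filter.1 hφ
      have : copyOf F φ \ R = (F \ E').image fun f => f.image φ := by
        ext x
        simp only [copyOf, Finset.mem_sdiff, Finset.mem_image, ← hφE, Finset.mem_filter]
        constructor
        · rintro ⟨⟨f, hf, rfl⟩, hx⟩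
          exact ⟨f, ⟨hf, fun h => hx h.2⟩, rfl⟩
        · rintro ⟨f, ⟨hf, hx⟩, rfl⟩
          exact ⟨⟨f, hf, rfl⟩, fun h => hx ⟨hf, h⟩⟩
      rw [this, Finset.card_image_of_injective _ (Finset.image_injective hφ),
        Finset.card_sdiff_of_subset hE'.1]
    rw [Finset.sum_congr rfl hval, Finset.sum_const, nsmul_eq_mul]
    set C := Fintype.card (shadow E').ConnectedComponent with hC
    have hcount : (Φ E').card ≤ m * (n ^ (C - 1) * (m * (1 + Δ * m) ^ m) ^ m) := by
      refine (Finset.card_le_card ?_).trans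
        (card_maps_component_le hm hcard hdeg (card_biUnion_le_of_mem_copies hc) E')
      intro φ hφ
      obtain ⟨-, -, hφE, hx⟩ := Finset.mem_filter.1 hφ
      refine Finset.mem_filter.2 ⟨Finset.mem_univ _, fun f hf => ?_, hx⟩
      rw [← hφE] at hf
      rw [hRS]
      exact (Finset.mem_filter.1 hf).2
    have hcount' : ((Φ E').card : ℝ) ≤ m * (n ^ (C - 1) * (m * (1 + Δ * m) ^ m) ^ m) := by
      exact_mod_cast hcount
    have hC1 : 1 ≤ C := by
      have : Nonempty (shadow E').ConnectedComponent :=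
        ⟨(shadow E').connectedComponentMk ⟨0, hm⟩⟩
      exact Fintype.card_pos
    have hcomp : E'.card * (m - 1) + F.card * C < F.card * m := by
      rw [hC]
      exact hbal.card_mul_add_components_lt hk hF hE' hE'ne
    have hexp := hη (F.card - E'.card) (C - 1) (by
      have h2 : (m - 1) * (F.card - E'.card) + E'.card * (m - 1) = F.card * (m - 1) := by
        rw [mul_comm (m - 1), ← add_mul, Nat.sub_add_cancel (Finset.card_le_card hE'.1)]
      have h3 : F.card * (m - 1) + F.card = F.card * m := by
        rw [← Nat.mul_succ, Nat.succ_eq_add_one, Nat.sub_add_cancel hm]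
      have h4 : F.card * (C - 1) + F.card = F.card * C := by
        rw [← Nat.mul_succ, Nat.succ_eq_add_one, Nat.sub_add_cancel hC1]
      omega) (Nat.sub_le _ _)
    calc ((Φ E').card : ℝ) * p ^ (F.card - E'.card)
        ≤ m * (n ^ (C - 1) * (m * (1 + Δ * m) ^ m) ^ m) * p ^ (F.card - E'.card) := by gcongr
      _ = m * ((m * (1 + Δ * m) ^ m) ^ m * (n ^ (C - 1) * p ^ (F.card - E'.card))) := by ring
      _ ≤ _ := by gcongr
  have hinter : interaction (copies F G) p σ c =
      ∑ b ∈ (copies F G).filter fun b => b ∉ σ ∧ b ≠ c ∧ ¬ b ∩ c ⊆ σ.biUnion id,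
        p ^ (b \ R).card := by
    rw [interaction, hR]
  rw [hinter]
  refine (Finset.sum_le_sum_of_subset_of_nonneg hsub fun b _ _ => hpow b).trans ?_
  refine (sum_biUnion_le_sum _ _ _ hpow).trans ((Finset.sum_le_sum hterm).trans ?_)
  rw [Finset.sum_const, nsmul_eq_mul]
  have hcard : ((F.powerset.filter fun E' => E' ⊂ F ∧ E'.Nonempty).card : ℝ) ≤ 2 ^ F.card := by
    have h1 := Finset.card_filter_le F.powerset fun E' => E' ⊂ F ∧ E'.Nonempty
    rw [Finset.card_powerset] at h1
    exact_mod_cast h1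
  gcongr

end Interaction

/-! ### Partitions into chunks avoiding bad chunks -/

section Chunks

variable {n : ℕ} {ι : Type*} [Fintype ι] [DecidableEq ι] {sz : ι → ℕ}

/-- The event that the positions of the chunk `j` are mapped by `τ`. -/
def chunkEvent (j : ι) (τ : Fin (sz j) → Fin n) : Finset ((Σ j, Fin (sz j)) × Fin n) :=
  Finset.univ.image fun i => (⟨j, i⟩, τ i)

lemma mem_chunkEvent {j : ι} {τ : Fin (sz j) → Fin n} {x : (Σ j, Fin (sz j)) × Fin n} :
    x ∈ chunkEvent j τ ↔ ∃ i, (⟨j, i⟩, τ i) = x := by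
  simp [chunkEvent]

lemma card_chunkEvent (j : ι) (τ : Fin (sz j) → Fin n) : (chunkEvent j τ).card = sz j := by
  rw [chunkEvent, Finset.card_image_of_injective, Finset.card_univ, Fintype.card_fin]
  intro i i' h
  simpa using (Prod.mk.inj h).1

lemma agrees_chunkEvent {j : ι} {τ : Fin (sz j) → Fin n} {σ : (Σ j, Fin (sz j)) ≃ Fin n} :
    Agrees (chunkEvent j τ) σ ↔ (fun i => σ ⟨j, i⟩) = τ := by
  simp [Agrees, chunkEvent, funext_iff]

lemma partialInj_chunkEvent (j : ι) (τ : Fin (sz j) → Fin n) : PartialInj (chunkEvent j τ) := by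
  intro x hx y hy h
  obtain ⟨i, rfl⟩ := mem_chunkEvent.1 hx
  obtain ⟨i', rfl⟩ := mem_chunkEvent.1 hy
  obtain rfl : i = i' := by simpa using h
  rfl

/-- The events that some chunk `j` is mapped by an element of `bad j`. -/
def badEvents (bad : ∀ j, Finset (Fin (sz j) → Fin n)) :
    Finset (Finset ((Σ j, Fin (sz j)) × Fin n)) :=
  Finset.univ.biUnion fun j => (bad j).image (chunkEvent j)

lemma mem_badEvents {bad : ∀ j, Finset (Fin (sz j) → Fin n)}
    {B : Finset ((Σ j, Fin (sz j)) × Fin n)} :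
    B ∈ badEvents bad ↔ ∃ j, ∃ τ ∈ bad j, chunkEvent j τ = B := by
  simp [badEvents]

lemma assignWeight_chunkEvent_le (hsum : ∑ j, sz j = n)
    (hdesc : ∀ j, (n : ℝ) ^ sz j ≤ 2 * n.descFactorial (sz j)) (j : ι) (τ : Fin (sz j) → Fin n) :
    assignWeight (chunkEvent j τ) ≤ 2 / (n : ℝ) ^ sz j := by
  have hle : sz j ≤ n := hsum ▸ Finset.single_le_sum (fun _ _ => Nat.zero_le _) (Finset.mem_univ j)
  have hpos : (0 : ℝ) < n.descFactorial (sz j) := by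
    exact_mod_cast Nat.pos_of_ne_zero fun h =>
      absurd (Nat.descFactorial_eq_zero_iff_lt.1 h) (by omega)
  rw [assignWeight, card_chunkEvent, Fintype.card_sigma]
  simp only [Fintype.card_fin]
  rw [hsum]
  rcases Nat.eq_zero_or_pos (sz j) with h | h
  · simp [h]
  · have hn : (0 : ℝ) < (n : ℝ) ^ sz j := by
      have : 0 < n := by omega
      positivity
    rw [inv_eq_one_div, div_le_div_iff₀ hpos hn, one_mul]
    exact hdesc j

lemma touchWeight_badEvents_le (hsum : ∑ j, sz j = n)
    (hdesc : ∀ j, (n : ℝ) ^ sz j ≤ 2 * n.descFactorial (sz j))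
    {bad : ∀ j, Finset (Fin (sz j) → Fin n)} {ε : ℝ}
    (hbad : ∀ j i v, (((bad j).filter fun τ => τ i = v).card : ℝ) ≤ ε * (n : ℝ) ^ (sz j - 1))
    (T : Finset ((Σ j, Fin (sz j)) × Fin n)) :
    touchWeight (badEvents bad) T ≤ 4 * ε * T.card := by
  classical
  have hw : ∀ B : Finset ((Σ j, Fin (sz j)) × Fin n), 0 ≤ assignWeight B := fun B => by
    unfold assignWeight; positivity
  have hfix : ∀ j i v, ∑ τ ∈ (bad j).filter fun τ => τ i = v, assignWeight (chunkEvent j τ) ≤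
      2 * ε / n := by
    intro j i v
    have hj : 0 < sz j := i.pos
    have hn : 0 < n := v.pos
    refine (Finset.sum_le_sum fun τ _ => assignWeight_chunkEvent_le hsum hdesc j τ).trans ?_
    rw [Finset.sum_const, nsmul_eq_mul]
    refine (mul_le_mul_of_nonneg_right (hbad j i v) (by positivity)).trans (le_of_eq ?_)
    obtain ⟨t, ht⟩ : ∃ t, sz j = t + 1 := ⟨sz j - 1, by omega⟩
    rw [ht, Nat.add_sub_cancel, pow_succ]
    field_simp
  have hone : ∀ x : (Σ j, Fin (sz j)) × Fin n,
      ∑ B ∈ (badEvents bad).filter fun B => ∃ y ∈ B, x.1 = y.1 ∨ x.2 = y.2, assignWeight B ≤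
        4 * ε := by
    rintro ⟨⟨j, i⟩, v⟩
    have hn : 0 < n := v.pos
    have hsub : (badEvents bad).filter (fun B =>
        ∃ y ∈ B, (⟨j, i⟩ : Σ j, Fin (sz j)) = y.1 ∨ v = y.2) ⊆
        ((Finset.univ : Finset (Fin n)).biUnion fun u =>
          ((bad j).filter fun τ => τ i = u).image (chunkEvent j)) ∪
        ((Finset.univ : Finset (Σ j, Fin (sz j))).biUnion fun z =>
          ((bad z.1).filter fun τ => τ z.2 = v).image (chunkEvent z.1)) := by
      intro B hB
      obtain ⟨hB, y, hy, hxy⟩ := Finset.mem_filter.1 hB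
      obtain ⟨j', τ, hτ, rfl⟩ := mem_badEvents.1 hB
      obtain ⟨i', rfl⟩ := mem_chunkEvent.1 hy
      rcases hxy with h | h
      · refine Finset.mem_union_left _ ?_
        obtain rfl : j = j' := congrArg Sigma.fst h
        exact Finset.mem_biUnion.2 ⟨τ i, Finset.mem_univ _, Finset.mem_image_of_mem _
          (Finset.mem_filter.2 ⟨hτ, rfl⟩)⟩
      · refine Finset.mem_union_right _ ?_
        exact Finset.mem_biUnion.2 ⟨⟨j', i'⟩, Finset.mem_univ _, Finset.mem_image_of_mem _
          (Finset.mem_filter.2 ⟨hτ, h.symm⟩)⟩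
    refine (Finset.sum_le_sum_of_subset_of_nonneg hsub fun B _ _ => hw B).trans ?_
    rw [← Finset.union_sdiff_self_eq_union, Finset.sum_union Finset.disjoint_sdiff]
    refine (add_le_add_right (Finset.sum_le_sum_of_subset_of_nonneg Finset.sdiff_subset
      fun B _ _ => hw B) _).trans ?_
    have h1 := (sum_biUnion_le_sum (Finset.univ : Finset (Fin n)) (fun u =>
      ((bad j).filter fun τ => τ i = u).image (chunkEvent j)) assignWeight hw).trans
      (Finset.sum_le_sum fun u _ => (sum_image_le_sum _ _ _ hw).trans (hfix j i u))
    have h2 := (sum_biUnion_le_sum (Finset.univ : Finset (Σ j, Fin (sz j))) (fun z =>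
      ((bad z.1).filter fun τ => τ z.2 = v).image (chunkEvent z.1)) assignWeight hw).trans
      (Finset.sum_le_sum fun z _ => (sum_image_le_sum _ _ _ hw).trans (hfix z.1 z.2 v))
    have hcard : (Finset.univ : Finset (Σ j, Fin (sz j))).card = n := by
      rw [Finset.card_univ, Fintype.card_sigma]
      simpa using hsum
    rw [Finset.sum_const, nsmul_eq_mul, Finset.card_univ, Fintype.card_fin] at h1
    rw [Finset.sum_const, nsmul_eq_mul, hcard] at h2
    have h3 : (n : ℝ) * (2 * ε / n) = 2 * ε := by field_simp
    rw [h3] at h1 h2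
    linarith
  have hT : (badEvents bad).filter (fun B => Touches T B) ⊆ T.biUnion fun x =>
      (badEvents bad).filter fun B => ∃ y ∈ B, x.1 = y.1 ∨ x.2 = y.2 := by
    intro B hB
    obtain ⟨hB, x, hx, hB'⟩ := Finset.mem_filter.1 hB
    exact Finset.mem_biUnion.2 ⟨x, hx, Finset.mem_filter.2 ⟨hB, hB'⟩⟩
  have h := (Finset.sum_le_sum_of_subset_of_nonneg hT fun B _ _ => hw B).trans
    ((sum_biUnion_le_sum _ _ _ hw).trans (Finset.sum_le_sum fun x _ => hone x))
  rw [Finset.sum_const, nsmul_eq_mul] at h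
  rw [touchWeight, mul_comm (4 * ε)]
  convert h

lemma pow_le_exp_mul_descFactorial {n t : ℕ} (h : t ≤ n) :
    (n : ℝ) ^ t ≤ Real.exp t * n.descFactorial t := by
  induction t generalizing n with
  | zero => simp
  | succ t ih =>
    obtain ⟨n, rfl⟩ : ∃ n', n = n' + 1 := ⟨n - 1, by omega⟩
    have ih := ih (n := n) (by omega)
    rw [Nat.succ_descFactorial_succ]
    push_cast
    have key : ((n : ℝ) + 1) ^ t ≤ Real.exp 1 * (n : ℝ) ^ t := by
      rcases Nat.eq_zero_or_pos n with rfl | hn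
      · obtain rfl : t = 0 := by omega
        simp
      have hn' : (0 : ℝ) < n := by exact_mod_cast hn
      have h1 : ((n : ℝ) + 1) ^ t = (1 / (n : ℝ) + 1) ^ t * (n : ℝ) ^ t := by
        rw [← mul_pow]
        congr 1
        field_simp
        ring
      rw [h1]
      refine mul_le_mul_of_nonneg_right ?_ (by positivity)
      refine (pow_le_pow_left₀ (by positivity) (Real.add_one_le_exp _) t).trans ?_
      rw [← Real.exp_nat_mul]
      refine Real.exp_le_exp.2 ?_
      rw [mul_one_div, div_le_one hn']
      exact_mod_cast (by omega : t ≤ n)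
    calc ((n : ℝ) + 1) ^ (t + 1) = ((n : ℝ) + 1) ^ t * (n + 1) := pow_succ _ _
      _ ≤ Real.exp 1 * (Real.exp t * n.descFactorial t) * (n + 1) := by
        gcongr
        exact key.trans (by gcongr)
      _ = _ := by rw [Real.exp_add]; ring

lemma bijCount_badEvents_le (hsum : ∑ j, sz j = n)
    (hdesc : ∀ j, (n : ℝ) ^ sz j ≤ 2 * n.descFactorial (sz j)) {L : ℕ} (hpos : ∀ j, 0 < sz j)
    (hL : ∀ j, sz j ≤ L) (hL1 : 1 ≤ L)
    {bad : ∀ j, Finset (Fin (sz j) → Fin n)}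
    (hbad : ∀ j i v, (((bad j).filter fun τ => τ i = v).card : ℝ) ≤
      1 / (16 * L) * (n : ℝ) ^ (sz j - 1)) :
    (0 : ℝ) < bijCount ∅ (badEvents bad) ∧ ∀ T : Finset ((Σ j, Fin (sz j)) × Fin n),
      (bijCount T (badEvents bad) : ℝ) ≤
        (Real.exp 2 / n) ^ T.card * bijCount ∅ (badEvents bad) := by
  classical
  have hL0 : (1 : ℝ) ≤ L := by exact_mod_cast hL1
  have hA : Fintype.card (Σ j, Fin (sz j)) = n := by
    rw [Fintype.card_sigma]
    simpa using hsum
  have htouch := touchWeight_badEvents_le hsum hdesc hbad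
  have hne : ∀ B ∈ badEvents bad, B.Nonempty := by
    intro B hB
    obtain ⟨j, τ, -, rfl⟩ := mem_badEvents.1 hB
    exact Finset.card_pos.1 ((card_chunkEvent j τ).symm ▸ hpos j)
  have hinj : ∀ B ∈ badEvents bad, PartialInj B := by
    intro B hB
    obtain ⟨j, τ, -, rfl⟩ := mem_badEvents.1 hB
    exact partialInj_chunkEvent j τ
  have hw : ∀ B ∈ badEvents bad, touchWeight (badEvents bad) B ≤ 1 / 4 := by
    intro B hB
    obtain ⟨j, τ, -, rfl⟩ := mem_badEvents.1 hB
    refine (htouch _).trans ?_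
    rw [card_chunkEvent]
    have : (sz j : ℝ) ≤ L := by exact_mod_cast hL j
    calc 4 * (1 / (16 * (L : ℝ))) * sz j ≤ 4 * (1 / (16 * (L : ℝ))) * L := by gcongr
      _ = 1 / 4 := by field_simp; norm_num
  refine ⟨bijCount_empty_pos (by rw [hA, Fintype.card_fin]) hne hinj hw, fun T => ?_⟩
  by_cases hT : PartialInj T
  · have hTn : T.card ≤ n := by
      refine le_of_le_of_eq (Finset.card_le_card_of_injOn Prod.fst (fun _ _ => Finset.mem_univ _)
        fun x hx y hy h => hT x hx y hy h) (Finset.card_univ.trans hA)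
    refine (bijCount_le_exp hne hinj hw hT).trans (mul_le_mul_of_nonneg_right ?_ (by positivity))
    have hd : (0 : ℝ) < n.descFactorial T.card := by
      exact_mod_cast Nat.pos_of_ne_zero fun h =>
        absurd (Nat.descFactorial_eq_zero_iff_lt.1 h) (by omega)
    have h1 : Real.exp (4 * touchWeight (badEvents bad) T) ≤ Real.exp T.card := by
      refine Real.exp_le_exp.2 ?_
      calc 4 * touchWeight (badEvents bad) T ≤ 4 * (4 * (1 / (16 * (L : ℝ))) * T.card) := by
            gcongr; exact htouch T
        _ = T.card / L := by field_simp; norm_num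
        _ ≤ T.card := div_le_self (by positivity) hL0
    have h2 := pow_le_exp_mul_descFactorial hTn
    rcases Nat.eq_zero_or_pos T.card with h0 | h0
    · rw [h0, Nat.cast_zero] at h1
      rw [assignWeight, h0]
      simpa using h1
    have hn : (0 : ℝ) < n := by exact_mod_cast (by omega : 0 < n)
    rw [assignWeight, hA, div_pow, ← Real.exp_nat_mul, le_div_iff₀ (by positivity),
      inv_mul_eq_div, div_mul_eq_mul_div, div_le_iff₀ hd]
    calc Real.exp (4 * touchWeight (badEvents bad) T) * (n : ℝ) ^ T.card
        ≤ Real.exp T.card * (Real.exp T.card * n.descFactorial T.card) := by gcongr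
      _ = _ := by
        rw [← mul_assoc, ← Real.exp_add]
        congr 2
        ring
  · have : bijCount T (badEvents bad) = 0 := by
      refine Finset.card_eq_zero.2 (Finset.eq_empty_of_forall_notMem fun σ h => hT ?_)
      simp only [Finset.mem_filter] at h
      obtain ⟨-, hσ, -⟩ := h
      refine fun x hx y hy h => Prod.ext h ?_
      rw [← hσ x hx, ← hσ y hy, h]
    rw [this, Nat.cast_zero]
    positivity

end Chunks

/-! ### Spread measures on tilings from chunks -/

section SpreadTilings

variable {m n : ℕ} {F : Finset (Finset (Fin m))} {G : Finset (Finset (Fin n))}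
  {ι : Type*} [Fintype ι] [DecidableEq ι] {sz : ι → ℕ}

/-- Perfect tilings of the chunks combine to a perfect tiling. -/
lemma exists_tiling_of_chunks (hFu : F.biUnion id = Finset.univ)
    (σ : (Σ j, Fin (sz j)) ≃ Fin n)
    (hσ : ∀ j, HasPerfectTiling m (sz j) F (pullback G fun i => σ ⟨j, i⟩)) :
    ∃ M ⊆ copies F G, HasPerfectTiling m n F (M.biUnion id) ∧
      (∀ c ∈ M, ∀ u ∈ c.biUnion id, ∀ v ∈ c.biUnion id, (σ.symm u).1 = (σ.symm v).1) ∧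
      ∀ c ∈ M, ∀ c' ∈ M, c ≠ c' → Disjoint (c.biUnion id) (c'.biUnion id) := by
  choose T hT hcover hdisj using hσ
  set T' : Finset (Fin m → Fin n) :=
    Finset.univ.biUnion fun j => (T j).image fun φ x => σ ⟨j, φ x⟩ with hT'
  have hmem : ∀ ψ, ψ ∈ T' ↔ ∃ j, ∃ φ ∈ T j, (fun x => σ ⟨j, φ x⟩) = ψ := by
    intro ψ
    simp [hT']
  have hdisj' : ∀ φ ∈ T', ∀ ψ ∈ T', φ ≠ ψ →
      Disjoint (Finset.image φ Finset.univ) (Finset.image ψ Finset.univ) := by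
    intro φ hφ ψ hψ hne
    obtain ⟨j, φ, hφ', rfl⟩ := (hmem _).1 hφ
    obtain ⟨j', ψ, hψ', rfl⟩ := (hmem _).1 hψ
    rw [Finset.disjoint_left]
    intro v hv hv'
    obtain ⟨x, -, rfl⟩ := Finset.mem_image.1 hv
    obtain ⟨y, -, hy⟩ := Finset.mem_image.1 hv'
    have hxy := σ.injective hy
    obtain rfl : j' = j := congrArg Sigma.fst hxy
    have hxy' : ψ y = φ x := by simpa using hxy
    refine Finset.disjoint_left.1 (hdisj j' φ hφ' ψ hψ' fun h => hne (by rw [h]))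
      (Finset.mem_image_of_mem φ (Finset.mem_univ x)) ?_
    rw [← hxy']
    exact Finset.mem_image_of_mem ψ (Finset.mem_univ y)
  have hcop : ∀ ψ ∈ T', Function.Injective ψ ∧ ∀ f ∈ F, f.image ψ ∈ G := by
    intro ψ hψ
    obtain ⟨j, φ, hφ, rfl⟩ := (hmem _).1 hψ
    refine ⟨fun x y h => (hT j φ hφ).1 (by simpa using σ.injective h), fun f hf => ?_⟩
    have h := (Finset.mem_filter.1 ((hT j φ hφ).2 f hf)).2
    rwa [Finset.image_image] at h
  have hverts : ∀ ψ : Fin m → Fin n, (copyOf F ψ).biUnion id = Finset.univ.image ψ := fun ψ => by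
    rw [biUnion_copyOf, hFu]
  refine ⟨T'.image (copyOf F), ?_, ⟨T', ?_, ?_, hdisj'⟩, ?_, ?_⟩
  · intro c hc
    obtain ⟨ψ, hψ, rfl⟩ := Finset.mem_image.1 hc
    exact mem_copies.2 ⟨ψ, hcop ψ hψ, rfl⟩
  · intro ψ hψ
    refine ⟨(hcop ψ hψ).1, fun f hf => ?_⟩
    exact Finset.mem_biUnion.2 ⟨copyOf F ψ, Finset.mem_image_of_mem _ hψ,
      Finset.mem_image_of_mem _ hf⟩
  · intro v
    obtain ⟨⟨j, i⟩, rfl⟩ := σ.surjective v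
    obtain ⟨φ, hφ, hi⟩ := hcover j i
    obtain ⟨x, -, rfl⟩ := Finset.mem_image.1 hi
    exact ⟨_, (hmem _).2 ⟨j, φ, hφ, rfl⟩, Finset.mem_image.2 ⟨x, Finset.mem_univ _, rfl⟩⟩
  · intro c hc u hu v hv
    obtain ⟨ψ, hψ, rfl⟩ := Finset.mem_image.1 hc
    rw [hverts] at hu hv
    obtain ⟨j, φ, hφ, rfl⟩ := (hmem _).1 hψ
    obtain ⟨x, -, rfl⟩ := Finset.mem_image.1 hu
    obtain ⟨y, -, rfl⟩ := Finset.mem_image.1 hv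
    simp
  · intro c hc c' hc' hne
    obtain ⟨ψ, hψ, rfl⟩ := Finset.mem_image.1 hc
    obtain ⟨ψ', hψ', rfl⟩ := Finset.mem_image.1 hc'
    rw [hverts, hverts]
    exact hdisj' ψ hψ ψ' hψ' fun h => hne (by rw [h])

lemma card_maps_into_chunk_le (hsum : ∑ j, sz j = n) {L : ℕ} (hL : ∀ j, sz j ≤ L) (hm : 1 ≤ m) :
    (Finset.univ.filter fun x : Fin m → Σ j, Fin (sz j) => ∀ i i', (x i).1 = (x i').1).card ≤
      n * L ^ m := by
  classical
  have hsub : (Finset.univ.filter fun x : Fin m → Σ j, Fin (sz j) => ∀ i i', (x i).1 = (x i').1) ⊆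
      (Finset.univ : Finset (Σ j, Fin (sz j))).biUnion fun a =>
        Fintype.piFinset fun _ : Fin m =>
          (Finset.univ : Finset (Fin (sz a.1))).image fun i => (⟨a.1, i⟩ : Σ j, Fin (sz j)) := by
    intro x hx
    refine Finset.mem_biUnion.2 ⟨x ⟨0, hm⟩, Finset.mem_univ _, Fintype.mem_piFinset.2 fun i => ?_⟩
    rw [(Finset.mem_filter.1 hx).2 ⟨0, hm⟩ i]
    exact Finset.mem_image_of_mem _ (Finset.mem_univ (x i).2)
  refine (Finset.card_le_card hsub).trans ((Finset.card_biUnion_le_card_mul _ _ (L ^ m) ?_).trans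
    ?_)
  · intro a _
    rw [Fintype.card_piFinset, Finset.prod_const, Finset.card_univ, Fintype.card_fin]
    refine Nat.pow_le_pow_left (Finset.card_image_le.trans ?_) _
    rw [Finset.card_univ, Fintype.card_fin]
    exact hL _
  · rw [Finset.card_univ, Fintype.card_sigma]
    simp [hsum]

open Classical in
/-- A minimum-degree hypothesis on most chunks gives a spread measure on perfect tilings. -/
lemma exists_spread_tilings_of_chunks (hFu : F.biUnion id = Finset.univ) (hm : 1 ≤ m) (hn : 1 ≤ n)
    (hsum : ∑ j, sz j = n) (hdesc : ∀ j, (n : ℝ) ^ sz j ≤ 2 * n.descFactorial (sz j)) {L : ℕ}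
    (hpos : ∀ j, 0 < sz j) (hL : ∀ j, sz j ≤ L) (hL1 : 1 ≤ L)
    {bad : ∀ j, Finset (Fin (sz j) → Fin n)}
    (hbad : ∀ j i v, (((bad j).filter fun τ => τ i = v).card : ℝ) ≤
      1 / (16 * L) * (n : ℝ) ^ (sz j - 1))
    (htil : ∀ j τ, Function.Injective τ → τ ∉ bad j → HasPerfectTiling m (sz j) F (pullback G τ)) :
    ∃ (I : Finset ((Σ j, Fin (sz j)) ≃ Fin n))
      (M : ((Σ j, Fin (sz j)) ≃ Fin n) → Finset (Finset (Finset (Fin n)))), I.Nonempty ∧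
      (∀ σ ∈ I, M σ ⊆ copies F G ∧ HasPerfectTiling m n F ((M σ).biUnion id)) ∧
      ∀ S ⊆ copies F G, ∑ σ ∈ I with S ⊆ M σ, (1 / (I.card : ℝ)) ≤
        ((L * Real.exp 2) ^ m / (n : ℝ) ^ (m - 1)) ^ S.card := by
  obtain ⟨hI0, hcount⟩ := bijCount_badEvents_le hsum hdesc hpos hL hL1 hbad
  set I : Finset ((Σ j, Fin (sz j)) ≃ Fin n) :=
    Finset.univ.filter fun σ => ∀ B ∈ badEvents bad, ¬ Agrees B σ with hI
  have hIcard : bijCount ∅ (badEvents bad) = I.card := by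
    rw [bijCount, hI]
    congr 1
    ext σ
    simp [Agrees]
  have hgood : ∀ σ ∈ I, ∀ j, HasPerfectTiling m (sz j) F (pullback G fun i => σ ⟨j, i⟩) := by
    intro σ hσ j
    refine htil j _ (fun x y h => by simpa using σ.injective h) fun h => ?_
    exact (Finset.mem_filter.1 hσ).2 _ (mem_badEvents.2 ⟨j, _, h, rfl⟩) (agrees_chunkEvent.2 rfl)
  choose! M hMsub hMtil hMchunk hMdisj using fun σ hσ => exists_tiling_of_chunks hFu σ (hgood σ hσ)
  rw [hIcard] at hI0
  refine ⟨I, M, Finset.card_pos.1 (by exact_mod_cast hI0), fun σ hσ => ⟨hMsub σ hσ, hMtil σ hσ⟩,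
    fun S hS => ?_⟩
  have hn0 : (0 : ℝ) < n := by exact_mod_cast hn
  rw [Finset.sum_const, nsmul_eq_mul, mul_one_div, div_le_iff₀ hI0]
  rcases Finset.eq_empty_or_nonempty (I.filter fun σ => S ⊆ M σ) with h | ⟨σ₀, hσ₀⟩
  · rw [h, Finset.card_empty, Nat.cast_zero]
    positivity
  obtain ⟨hσ₀, hS₀⟩ := Finset.mem_filter.1 hσ₀
  have : Nonempty (Fin m → Fin n) := ⟨fun _ => ⟨0, hn⟩⟩
  choose! ψ hψ hψc using fun c (hc : c ∈ S) => mem_copies.1 (hS hc)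
  have hverts : ∀ c ∈ S, c.biUnion id = Finset.univ.image (ψ c) := fun c hc => by
    conv_lhs => rw [← hψc c hc]
    rw [biUnion_copyOf, hFu]
  have hmemv : ∀ c ∈ S, ∀ i, ψ c i ∈ c.biUnion id := fun c hc i => by
    rw [hverts c hc]
    exact Finset.mem_image_of_mem _ (Finset.mem_univ i)
  set P := Finset.univ.filter fun x : Fin m → Σ j, Fin (sz j) => ∀ i i', (x i).1 = (x i').1 with hP
  set T : ({c // c ∈ S} → Fin m → Σ j, Fin (sz j)) → Finset ((Σ j, Fin (sz j)) × Fin n) := fun x =>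
    Finset.univ.image fun z : {c // c ∈ S} × Fin m => (x z.1 z.2, ψ z.1 z.2) with hT
  have hTcard : ∀ x, (T x).card = m * S.card := by
    intro x
    rw [hT, Finset.card_image_of_injective, Finset.card_univ, Fintype.card_prod, Fintype.card_fin,
      Fintype.card_coe, mul_comm]
    rintro ⟨⟨c, hc⟩, i⟩ ⟨⟨c', hc'⟩, i'⟩ h
    have h2 : ψ c i = ψ c' i' := (Prod.mk.inj h).2
    obtain rfl : c = c' := by
      by_contra hne
      refine Finset.disjoint_left.1 (hMdisj σ₀ hσ₀ c (hS₀ hc) c' (hS₀ hc') hne) (hmemv c hc i) ?_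
      rw [h2]
      exact hmemv c' hc' i'
    rw [(hψ c hc).1 h2]
  have hsub : (I.filter fun σ => S ⊆ M σ) ⊆
      (Fintype.piFinset fun _ : {c // c ∈ S} => P).biUnion fun x => Finset.univ.filter
        fun σ => Agrees (T x) σ ∧ ∀ B ∈ badEvents bad, ¬ Agrees B σ := by
    intro σ hσ
    obtain ⟨hσ, hSσ⟩ := Finset.mem_filter.1 hσ
    simp only [Finset.mem_biUnion, Fintype.mem_piFinset, Finset.mem_filter, Finset.mem_univ,
      true_and]
    refine ⟨fun c i => σ.symm (ψ c i), fun c => ?_, ?_, (Finset.mem_filter.1 hσ).2⟩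
    · rw [hP, Finset.mem_filter]
      exact ⟨Finset.mem_univ _, fun i i' => hMchunk σ hσ c (hSσ c.2) _ (hmemv c c.2 i) _
        (hmemv c c.2 i')⟩
    · intro z hz
      obtain ⟨⟨c, i⟩, -, rfl⟩ := Finset.mem_image.1 hz
      simp
  have hcard : ((I.filter fun σ => S ⊆ M σ).card : ℝ) ≤
      ∑ x ∈ Fintype.piFinset fun _ : {c // c ∈ S} => P, (bijCount (T x) (badEvents bad) : ℝ) := by
    have h := (Finset.card_le_card hsub).trans Finset.card_biUnion_le
    rw [← Nat.cast_sum, Nat.cast_le]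
    refine h.trans (le_of_eq (Finset.sum_congr rfl fun x _ => ?_))
    rw [bijCount]
    congr
  refine hcard.trans ((Finset.sum_le_sum fun x _ => (hcount (T x)).trans_eq
    (by rw [hTcard, hIcard])).trans ?_)
  rw [Finset.sum_const, nsmul_eq_mul, ← mul_assoc]
  refine mul_le_mul_of_nonneg_right ?_ hI0.le
  rw [Fintype.card_piFinset, Finset.prod_const, Finset.card_univ, Fintype.card_coe, pow_mul,
    Nat.cast_pow, ← mul_pow]
  refine pow_le_pow_left₀ (by positivity) ?_ _
  have hPcard : (P.card : ℝ) ≤ n * L ^ m := by exact_mod_cast card_maps_into_chunk_le hsum hL hm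
  refine (mul_le_mul_of_nonneg_right hPcard (by positivity)).trans (le_of_eq ?_)
  obtain ⟨t, rfl⟩ : ∃ t, m = t + 1 := ⟨m - 1, by omega⟩
  rw [Nat.add_sub_cancel, div_pow, mul_pow]
  field_simp
  ring

end SpreadTilings

/-! ### Spread measures from the minimum degree -/

section SpreadMeasure

variable {k d m n : ℕ} {F : Finset (Finset (Fin m))}

lemma MinDegGE.mono {G : Finset (Finset (Fin n))} {a b : ℝ} (h : MinDegGE G d b) (hab : a ≤ b) :
    MinDegGE G d a := fun S hS => hab.trans (h S hS)

lemma IsHG.pullback {s : ℕ} {G : Finset (Finset (Fin n))}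
    (hG : IsHG k n G) {τ : Fin s → Fin n} (hτ : Function.Injective τ) :
    IsHG k s (pullback G τ) := by
  intro f hf
  rw [← Finset.card_image_of_injective f hτ]
  exact hG _ (Finset.mem_filter.1 hf).2

lemma IsHG.card_filter_superset_le {G : Finset (Finset (Fin n))} (hG : IsHG k n G)
    (S : Finset (Fin n)) :
    (G.filter fun e => S ⊆ e).card ≤ (n - S.card).choose (k - S.card) := by
  have h : ((Finset.univ \ S).powersetCard (k - S.card)).card =
      (n - S.card).choose (k - S.card) := by
    rw [Finset.card_powersetCard, Finset.card_univ_sdiff, Fintype.card_fin]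
  rw [← h]
  refine Finset.card_le_card_of_injOn (fun e => e \ S) ?_ ?_
  · intro e he
    obtain ⟨he, hS⟩ := Finset.mem_filter.1 he
    refine Finset.mem_coe.2 (Finset.mem_powersetCard.2
      ⟨Finset.sdiff_subset_sdiff (Finset.subset_univ _) (Finset.Subset.refl _), ?_⟩)
    rw [Finset.card_sdiff_of_subset hS, hG e he]
  · intro e he e' he' h
    have hS := (Finset.mem_filter.1 he).2
    have hS' := (Finset.mem_filter.1 he').2
    have h' : e \ S = e' \ S := h
    rw [← Finset.sdiff_union_of_subset hS, ← Finset.sdiff_union_of_subset hS', h']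

lemma exists_tiling_minDegree_lt (hdk : d ≤ k) {μ : ℝ} (hμ : 0 < μ) :
    0 ≤ tilingThreshold k d m F ∧
    ∃ n₀ : ℕ, ∀ n, n₀ ≤ n → m ∣ n → ∀ G : Finset (Finset (Fin n)), IsHG k n G →
      MinDegGE G d ((tilingThreshold k d m F + μ) * (((n - d).choose (k - d) : ℕ) : ℝ)) →
      HasPerfectTiling m n F G := by
  refine ⟨Real.sInf_nonneg fun x hx => hx.1, ?_⟩
  have hne : {δ : ℝ | 0 ≤ δ ∧ δ ≤ 1 ∧ ∀ μ : ℝ, 0 < μ → ∃ n₀ : ℕ, ∀ n, n₀ ≤ n → m ∣ n →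
      ∀ G : Finset (Finset (Fin n)), IsHG k n G →
      MinDegGE G d ((δ + μ) * (((n - d).choose (k - d) : ℕ) : ℝ)) →
      HasPerfectTiling m n F G}.Nonempty := by
    refine ⟨1, zero_le_one, le_rfl, fun μ hμ => ⟨k, fun n hn _ G hG hdeg => ?_⟩⟩
    exfalso
    obtain ⟨S, -, hS⟩ := Finset.exists_subset_card_eq
      (show d ≤ (Finset.univ : Finset (Fin n)).card by
         rw [Finset.card_univ, Fintype.card_fin]; omega)
    have h1 := hdeg S hS
    have h2 : ((G.filter fun e => S ⊆ e).card : ℝ) ≤ ((n - d).choose (k - d) : ℕ) := by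
      rw [← hS]
      exact_mod_cast hG.card_filter_superset_le S
    have h3 : (0 : ℝ) < ((n - d).choose (k - d) : ℕ) := by
      exact_mod_cast Nat.choose_pos (by omega)
    nlinarith
  obtain ⟨δ, hδ, hlt⟩ := exists_lt_of_csInf_lt hne
    (show tilingThreshold k d m F < tilingThreshold k d m F + μ / 2 by linarith)
  obtain ⟨n₀, hn₀⟩ := hδ.2.2 (μ / 2) (by positivity)
  refine ⟨n₀, fun n hn hmn G hG hdeg => hn₀ n hn hmn G hG (hdeg.mono ?_)⟩
  exact mul_le_mul_of_nonneg_right (by linarith) (by positivity)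

lemma pow_le_two_mul_descFactorial {t : ℕ} (h : 2 * t ^ 2 ≤ n) :
    (n : ℝ) ^ t ≤ 2 * n.descFactorial t := by
  rcases Nat.eq_zero_or_pos t with rfl | ht
  · simp
  have htn : t ≤ n := by nlinarith
  have hn : (0 : ℝ) < n := by exact_mod_cast (by omega : 0 < n)
  have h1 : ((n : ℝ) - t) ^ t ≤ n.descFactorial t := by
    have h := (Nat.pow_le_pow_left (show n - t ≤ n + 1 - t by omega) t).trans
      (Nat.pow_sub_le_descFactorial n t)
    rw [← Nat.cast_sub htn]
    exact_mod_cast h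
  have h2 : (1 : ℝ) + t * (-(t / n)) ≤ (1 + -(t / n)) ^ t := by
    refine one_add_mul_le_pow ?_ t
    have : (t : ℝ) / n ≤ 1 := (div_le_one hn).2 (by exact_mod_cast htn)
    linarith
  have h3 : ((n : ℝ) - t) ^ t = (n : ℝ) ^ t * (1 + -(t / n)) ^ t := by
    rw [← mul_pow]
    congr 1
    field_simp
    ring
  have h4 : (1 : ℝ) / 2 ≤ 1 + t * (-(t / n)) := by
    have : (t : ℝ) * (t / n) ≤ 1 / 2 := by
      rw [mul_div_assoc', div_le_iff₀ hn]
      have h' : (2 : ℝ) * t ^ 2 ≤ n := by exact_mod_cast h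
      nlinarith
    linarith
  have h5 : (n : ℝ) ^ t * (1 / 2) ≤ (n : ℝ) ^ t * (1 + -(t / n)) ^ t :=
    mul_le_mul_of_nonneg_left (h4.trans h2) (by positivity)
  linarith

open Filter Topology in
lemma eventually_pow_mul_exp_le (d : ℕ) {κ δ : ℝ} (hκ : 0 < κ) (hδ : 0 < δ) :
    ∀ᶠ s : ℕ in atTop, (s : ℝ) ^ (d + 1) * Real.exp (-(κ * (s - d - 1 : ℕ))) ≤ δ := by
  have h1 : Tendsto (fun s : ℕ => κ * (s : ℝ)) atTop atTop :=
    tendsto_natCast_atTop_atTop.const_mul_atTop hκ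
  have h2 := ((Real.tendsto_pow_mul_exp_neg_atTop_nhds_zero (d + 1)).comp h1).const_mul
    (Real.exp (κ * (d + 1)) / κ ^ (d + 1))
  rw [mul_zero] at h2
  filter_upwards [h2.eventually_le_const hδ] with s hs
  refine le_trans ?_ hs
  have h3 : (s : ℝ) - d - 1 ≤ (s - d - 1 : ℕ) := by
    have : s ≤ (s - d - 1 : ℕ) + d + 1 := by omega
    have : (s : ℝ) ≤ (s - d - 1 : ℕ) + d + 1 := by exact_mod_cast this
    linarith
  have h4 : Real.exp (-(κ * (s - d - 1 : ℕ))) ≤ Real.exp (κ * (d + 1)) * Real.exp (-(κ * s)) := by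
    rw [← Real.exp_add]
    refine Real.exp_le_exp.2 ?_
    nlinarith
  refine (mul_le_mul_of_nonneg_left h4 (by positivity)).trans (le_of_eq ?_)
  simp only [Function.comp_apply, mul_pow]
  field_simp

open Filter in
/-- A hypergraph with large minimum degree carries a spread measure on perfect tilings. -/
lemma exists_spread_tilings (hk : 2 ≤ k) (hdk : d ≤ k - 1) {μ : ℝ} (hμ : 0 < μ)
    (hF : IsHG k m F) (hbal : StrictlyOneBalanced m F) (hne : F.Nonempty) :
    ∃ K : ℝ, 0 < K ∧ ∃ n₀ : ℕ, ∀ n, n₀ ≤ n → ∀ G : Finset (Finset (Fin n)), IsHG k n G →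
      MinDegGE G d ((tilingThreshold k d m F + μ) * (((n - d).choose (k - d) : ℕ) : ℝ)) →
      m ∣ n → ∃ (ι : Type) (I : Finset ι) (M : ι → Finset (Finset (Finset (Fin n)))), I.Nonempty ∧
        (∀ σ ∈ I, M σ ⊆ copies F G ∧ HasPerfectTiling m n F ((M σ).biUnion id)) ∧
        ∀ S ⊆ copies F G, ∑ σ ∈ I with S ⊆ M σ, (1 / (I.card : ℝ)) ≤
          (K / (n : ℝ) ^ (m - 1)) ^ S.card := by
  classical
  have hm : 1 ≤ m := by
    obtain ⟨f, hf⟩ := hne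
    have h1 := Finset.card_le_univ f
    rw [hF f hf, Fintype.card_fin] at h1
    omega
  obtain ⟨hth, n₁, hn₁⟩ := exists_tiling_minDegree_lt (F := F) (m := m) (show d ≤ k by omega)
    (half_pos hμ)
  set θ := tilingThreshold k d m F + μ with hθ
  have hμ2 := half_pos hμ
  have hrate : 0 < tailRate (k - d) (μ / 2) := tailRate_pos (by omega) hμ2
  have hev : ∀ᶠ s : ℕ in atTop, k + 1 ≤ s ∧ n₁ ≤ s ∧
      2 * θ * (k - d : ℕ) ≤ μ / 2 * (s - d : ℕ) ∧
      (s : ℝ) ^ (d + 1) * Real.exp (-(tailRate (k - d) (μ / 2) * (s - d - 1 : ℕ))) ≤ 1 / 32 := by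
    have h1 : Tendsto (fun s : ℕ => μ / 2 * ((s - d : ℕ) : ℝ)) atTop atTop :=
      (tendsto_natCast_atTop_atTop.comp (tendsto_sub_atTop_nat d)).const_mul_atTop hμ2
    exact (eventually_ge_atTop _).and ((eventually_ge_atTop _).and
      ((h1.eventually_ge_atTop _).and (eventually_pow_mul_exp_le d hrate (by norm_num))))
  obtain ⟨s₀, hs₀⟩ := eventually_atTop.1 hev
  set s := m * (s₀ + 1) with hs
  have hs1 : s₀ + 1 ≤ s := Nat.le_mul_of_pos_left _ hm
  have hspos : (0 : ℝ) < s := by exact_mod_cast (by omega : 0 < s)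
  obtain ⟨n₂, hn₂⟩ := eventually_atTop.1 (show ∀ᶠ n : ℕ in atTop,
      4 * θ * (k - d : ℕ) * k ≤ μ / 2 * n from
    (tendsto_natCast_atTop_atTop.const_mul_atTop hμ2).eventually_ge_atTop _)
  refine ⟨((2 * s : ℕ) * Real.exp 2) ^ m, by positivity, max (max n₂ k) (2 * (2 * s) ^ 2),
    fun n hn G hG hdeg hmn => ?_⟩
  simp only [max_le_iff] at hn
  have hsn : s ≤ n := by nlinarith
  obtain ⟨q, hq⟩ : ∃ q, n / s = q + 1 := by
    have := Nat.div_pos hsn (by omega)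
    exact ⟨n / s - 1, by omega⟩
  set sz : Fin (q + 1) → ℕ := fun j => s + if j = 0 then n % s else 0 with hsz
  have hmod : n % s < s := Nat.mod_lt _ (by omega)
  have hsz1 : ∀ j, s ≤ sz j := fun j => Nat.le_add_right _ _
  have hsz2 : ∀ j, sz j ≤ 2 * s := fun j => by
    simp only [hsz]
    split_ifs <;> omega
  have hszm : ∀ j, m ∣ sz j := fun j => by
    simp only [hsz]
    refine dvd_add (Dvd.intro _ rfl) ?_
    split_ifs
    · exact (Nat.dvd_mod_iff (Dvd.intro _ rfl)).2 hmn
    · exact dvd_zero m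
  have hsum : ∑ j, sz j = n := by
    have h := Nat.div_add_mod n s
    rw [hq] at h
    simp only [hsz, Finset.sum_add_distrib, Finset.sum_const, Finset.card_univ, Fintype.card_fin,
      smul_eq_mul, Finset.sum_ite_eq', Finset.mem_univ, if_true]
    rw [mul_comm]
    exact h
  set bad : ∀ j, Finset (Fin (sz j) → Fin n) := fun j => Finset.univ.filter fun τ =>
    Function.Injective τ ∧
      ¬ MinDegGE (pullback G τ) d ((θ - μ / 2) * ((sz j - d).choose (k - d) : ℕ)) with hbad
  have hbadle : ∀ j i v, (((bad j).filter fun τ => τ i = v).card : ℝ) ≤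
      1 / (16 * (2 * s : ℕ)) * (n : ℝ) ^ (sz j - 1) := by
    intro j i v
    obtain ⟨h1, h2, h3, h4⟩ := hs₀ (sz j) (by have := hsz1 j; omega)
    have h := card_low_minDegree_le hG (show d < k by omega) hμ2 hn.1.2
        (hn₂ n hn.1.1) h1 h3 hdeg i v
    refine le_trans ?_ (h.trans (mul_le_mul_of_nonneg_right ?_ (by positivity)))
    · rw [Nat.cast_le]
      refine Finset.card_le_card fun τ hτ => ?_
      simp only [hbad, Finset.mem_filter, Finset.mem_univ, true_and] at hτ ⊢
      exact ⟨hτ.1.1, hτ.2, hτ.1.2⟩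
    · have h5 : (s : ℝ) ≤ sz j := by exact_mod_cast hsz1 j
      rw [le_div_iff₀ (by positivity)]
      push_cast
      rw [pow_succ] at h4
      set X := Real.exp (-(tailRate (k - d) (μ / 2) * (sz j - d - 1 : ℕ)))
      have hX : 0 ≤ (sz j : ℝ) ^ d * X := by positivity
      nlinarith
  have htil : ∀ j τ, Function.Injective τ → τ ∉ bad j →
      HasPerfectTiling m (sz j) F (pullback G τ) := by
    intro j τ hτ hτb
    refine hn₁ (sz j) (hs₀ (sz j) (by have := hsz1 j; omega)).2.1 (hszm j) _ (hG.pullback hτ) ?_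
    have h : MinDegGE (pullback G τ) d ((θ - μ / 2) * ((sz j - d).choose (k - d) : ℕ)) := by
      by_contra hcon
      exact hτb (Finset.mem_filter.2 ⟨Finset.mem_univ _, hτ, hcon⟩)
    refine h.mono (le_of_eq ?_)
    rw [hθ]
    ring
  obtain ⟨I, M, hI, hM, hspread⟩ := exists_spread_tilings_of_chunks (F := F) (G := G) (sz := sz)
    (hbal.biUnion_eq_univ hk hF hne) hm (by omega) hsum
    (fun j => pow_le_two_mul_descFactorial
      (le_trans (Nat.mul_le_mul_left 2 (Nat.pow_le_pow_left (hsz2 j) 2)) hn.2))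
    (fun j => by have := hsz1 j; omega) hsz2 (by omega) hbadle htil
  refine ⟨_, I, M, hI, hM, fun S hS => ?_⟩
  convert hspread S hS

end SpreadMeasure

/-! ### Quantitative bounds for the sparsification -/

section Finite

variable {k m n : ℕ} {F : Finset (Finset (Fin m))} {G : Finset (Finset (Fin n))}

lemma HasPerfectTiling.mono {E E' : Finset (Finset (Fin n))} (h : HasPerfectTiling m n F E)
    (hE : E ⊆ E') : HasPerfectTiling m n F E' := by
  obtain ⟨T, h1, h2, h3⟩ := h
  exact ⟨T, fun φ hφ => ⟨(h1 φ hφ).1, fun e he => hE ((h1 φ hφ).2 e he)⟩, h2, h3⟩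

/-- The edge density at which a spread measure with `λ` copies per vertex is realised. -/
lemma pow_mul_rpow_pow_le {e : ℕ} (he : 1 ≤ e) (hn : 1 ≤ n) {lam : ℝ} (hlam : 1 ≤ lam) (t r : ℕ)
    (htr : e * r + 1 ≤ (m - 1) * t) (hte : t ≤ e) :
    (n : ℝ) ^ r * ((lam / (n : ℝ) ^ (m - 1)) ^ (1 / (e : ℝ))) ^ t ≤
      lam * (n : ℝ) ^ (-(1 / (e : ℝ))) := by
  have hn0 : (1 : ℝ) ≤ n := by exact_mod_cast hn
  have hnpos : (0 : ℝ) < n := by linarith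
  have he0 : (0 : ℝ) < e := by exact_mod_cast he
  have h1 : (lam / (n : ℝ) ^ (m - 1)) ^ (1 / (e : ℝ)) =
      lam ^ (1 / (e : ℝ)) * (n : ℝ) ^ (-((m - 1 : ℕ) : ℝ) / e) := by
    rw [Real.div_rpow (by positivity) (by positivity), ← Real.rpow_natCast,
      ← Real.rpow_mul hnpos.le,
      div_eq_mul_inv, ← Real.rpow_neg hnpos.le]
    congr 2
    ring
  rw [h1, mul_pow, ← Real.rpow_natCast (lam ^ _), ← Real.rpow_mul (by positivity),
    ← Real.rpow_natCast ((n : ℝ) ^ (_ : ℝ)), ← Real.rpow_mul hnpos.le, mul_left_comm,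
    ← Real.rpow_natCast (n : ℝ) r, ← Real.rpow_add hnpos]
  refine mul_le_mul ?_ ?_ (by positivity) (by positivity)
  · refine (Real.rpow_le_rpow_of_exponent_le hlam ?_).trans_eq (Real.rpow_one lam)
    rw [one_div, inv_mul_eq_div, div_le_one he0]
    exact_mod_cast hte
  · refine Real.rpow_le_rpow_of_exponent_le hn0 ?_
    have h2 : (e : ℝ) * r + 1 ≤ ((m - 1 : ℕ) : ℝ) * t := by exact_mod_cast htr
    have h3 : (r : ℝ) + -((m - 1 : ℕ) : ℝ) / e * t = (e * r - ((m - 1 : ℕ) : ℝ) * t) / e := by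
      field_simp
      ring
    rw [h3, ← neg_div, div_le_div_iff_of_pos_right he0]
    linarith

lemma sparsProb_ge (hk : 2 ≤ k) (hF : IsHG k m F) (hbal : StrictlyOneBalanced m F)
    (hne : F.Nonempty) (hn : 1 ≤ n) (hm : 1 ≤ m) {ι : Type*} {I : Finset ι}
    {M : ι → Finset (Finset (Finset (Fin n)))} (hI : I.Nonempty)
    (hM : ∀ i ∈ I, M i ⊆ copies F G ∧ HasPerfectTiling m n F ((M i).biUnion id))
    {K : ℝ} (hK : 0 < K)
    (hspread : ∀ S ⊆ copies F G, (open Classical in ∑ i ∈ I with S ⊆ M i, (1 / (I.card : ℝ))) ≤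
      (K / (n : ℝ) ^ (m - 1)) ^ S.card)
    {J Δ : ℕ} (hJ : 0 < J) (hJn : n ^ m ≤ 2 ^ J) {lam : ℝ} (hlam : 1 ≤ lam)
    (hlamJ : 17 * J * K ≤ lam) (hlamn : 2 * lam ≤ (n : ℝ) ^ (m - 1))
    (hinter : 2 ^ F.card * (m * ((m * (1 + Δ * m) ^ m) ^ m *
      (2 * lam * (n : ℝ) ^ (-(1 / (F.card : ℝ)))))) ≤ 1 / 2) {p : ℝ}
    (hp : 2 * (2 * lam / (n : ℝ) ^ (m - 1)) ^ (1 / (F.card : ℝ)) ≤ p) (hp1 : p ≤ 1) :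
    1 - (J * (1 / 2) ^ Nat.sqrt J + ((1 + 1 / (J : ℝ)) ^ Nat.sqrt J - 1)) -
      (n * ((1 / 2) ^ Δ * Real.exp (m * lam)) +
        lam * (2 ^ F.card * m ^ m * (2 ^ F.card * (m ^ m * lam)) ^ F.card) ^ 2 / n) ≤
    sparsProb G p (fun E => HasPerfectTiling m n F E) := by
  classical
  have he : 1 ≤ F.card := hne.card_pos
  have he0 : (F.card : ℝ) ≠ 0 := by positivity
  have hn0 : (0 : ℝ) < (n : ℝ) ^ (m - 1) := by
    have : (0 : ℝ) < n := by exact_mod_cast hn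
    positivity
  set q := lam / (n : ℝ) ^ (m - 1) with hq
  have hq0 : 0 ≤ q := by positivity
  have hq1 : q ≤ 1 := by rw [hq, div_le_one hn0]; linarith
  have hlamq : q * (n : ℝ) ^ (m - 1) = lam := div_mul_cancel₀ _ hn0.ne'
  set p₁ := (2 * lam / (n : ℝ) ^ (m - 1)) ^ (1 / (F.card : ℝ)) with hp₁
  have hp₁0 : 0 ≤ p₁ := by positivity
  have hp₁1 : p₁ ≤ 1 := by linarith
  have hp₁q : p₁ ^ F.card / 2 = q := by
    rw [hp₁, ← Real.rpow_natCast, ← Real.rpow_mul (by positivity), one_div_mul_cancel he0,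
      Real.rpow_one, hq]
    ring
  set Q : Finset (Finset (Finset (Fin n))) → Prop := fun S =>
    HasPerfectTiling m n F (S.biUnion id) with hQ
  have hspread' := spread_lemma (copies F G) (K / (n : ℝ) ^ (m - 1)) q J hJ (by positivity)
    (by rw [hq, mul_div_assoc', div_le_div_iff_of_pos_right hn0]; exact hlamJ) hq1 I
    (fun _ => 1 / (I.card : ℝ)) M (fun i _ => by positivity)
    (by
      have : (I.card : ℝ) ≠ 0 := by exact_mod_cast hI.card_pos.ne'
      rw [Finset.sum_const, nsmul_eq_mul, mul_one_div_cancel this])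
    (fun i hi => (hM i hi).1)
    (fun i hi => (Finset.card_le_card (hM i hi).1).trans (card_copies_le.trans hJn)) hspread
  have h1 : rexp (copies F G) q (fun S => if ∃ i ∈ I, M i ⊆ S then 1 else 0) ≤
      rexp (copies F G) q (fun S => if Q S ∧ IsGood F G Δ S then 1 else 0) +
        rexp (copies F G) q (fun S => if IsGood F G Δ S then 0 else 1) := by
    rw [← rexp_add]
    refine rexp_mono hq0 hq1 fun S _ => ?_
    by_cases h : ∃ i ∈ I, M i ⊆ S
    · obtain ⟨i, hi, hS⟩ := h
      have hQS : Q S := (hM i hi).2.mono (Finset.biUnion_subset_biUnion_of_subset_left _ hS)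
      by_cases hg : IsGood F G Δ S
      · simp only [hQS, hg, and_self, if_true, add_zero]
        split_ifs <;> norm_num
      · simp only [hg, and_false, if_false, zero_add]
        split_ifs <;> norm_num
    · rw [if_neg h]
      split_ifs <;> norm_num
  have h2 := rexp_not_isGood_le (G := G) hk hF hbal hne hq0 hq1 hn hm (by rw [hlamq]; exact hlam) Δ
  rw [hlamq] at h2
  have h3 := rexp_copies_le_rexp_edges (G := G) (𝓒 := copies F G) hp₁0 hp₁1 (e := F.card)
    (fun b hb => subset_of_mem_copies hb) (fun b hb => card_of_mem_copies hb) Q (IsGood F G Δ)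
    (fun S T hST hT => hT.anti hST) (fun σ₁ σ₂ c hσ₁ hσ₂ hdisj hc hc₁ hc₂ hgood => by
      have hbound : ∀ σ ⊆ σ₁ ∪ σ₂, (∀ W ⊆ σ, ¬ IsWitness F G c W) →
          interaction (copies F G) p₁ σ c ≤ 1 / 2 := fun σ hσ hW =>
        (interaction_le hk hF hbal hm hp₁0 (by positivity)
          (fun t r htr hte => pow_mul_rpow_pow_le he hn (by linarith) t r htr hte)
          (hσ.trans (Finset.union_subset hσ₁ hσ₂)) hc
          (hgood.anti (Finset.insert_subset_insert c hσ)).1 hW).trans hinter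
      by_cases hW₁ : ∀ W ⊆ σ₁, ¬ IsWitness F G c W
      · exact Or.inl (hbound σ₁ Finset.subset_union_left hW₁)
      · refine Or.inr (hbound σ₂ Finset.subset_union_right fun W₂ hW₂ hw₂ =>
          hW₁ fun W₁ hW₁' hw₁ => ?_)
        exact hgood.2 c (Finset.mem_insert_self _ _) W₁
          ((hW₁'.trans Finset.subset_union_left).trans (Finset.subset_insert _ _)) W₂
          ((hW₂.trans Finset.subset_union_right).trans (Finset.subset_insert _ _))
          (fun h => hc₁ (hW₁' h)) (fun h => hc₂ (hW₂ h))
          (Finset.disjoint_of_subset_left hW₁' (Finset.disjoint_of_subset_right hW₂ hdisj)) hw₁ hw₂)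
  rw [hp₁q] at h3
  have h4 : rexp G (2 * p₁ - p₁ ^ 2) (fun W => if ∃ S, Q S ∧ ∀ c ∈ S, c ⊆ W then (1 : ℝ) else 0) ≤
      rexp G (2 * p₁ - p₁ ^ 2) (fun W => if HasPerfectTiling m n F W then 1 else 0) := by
    refine rexp_mono (by nlinarith) (by nlinarith) fun W _ => ?_
    by_cases h : ∃ S, Q S ∧ ∀ c ∈ S, c ⊆ W
    · obtain ⟨S, hS, hSW⟩ := h
      have : HasPerfectTiling m n F W := hS.mono (Finset.biUnion_subset.2 hSW)
      rw [if_pos this]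
      split_ifs <;> norm_num
    · rw [if_neg h]
      split_ifs <;> norm_num
  have h5 : rexp G (2 * p₁ - p₁ ^ 2) (fun W => if HasPerfectTiling m n F W then (1 : ℝ) else 0) ≤
      rexp G p (fun W => if HasPerfectTiling m n F W then 1 else 0) := by
    refine rexp_mono_prob (by nlinarith) (by nlinarith) hp1 fun W W' hW => ?_
    by_cases h : HasPerfectTiling m n F W
    · simp only [if_pos h, if_pos (h.mono hW), le_refl]
    · simp only [if_neg h]
      split_ifs <;> norm_num
  rw [sparsProb_eq_rexp]
  have h3' : rexp (copies F G) q (fun S => if Q S ∧ IsGood F G Δ S then 1 else 0) ≤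
      rexp G (2 * p₁ - p₁ ^ 2) (fun W => if ∃ S, Q S ∧ ∀ c ∈ S, c ⊆ W then (1 : ℝ) else 0) := by
    convert h3
  have h1' : 1 - (J * (1 / 2) ^ Nat.sqrt J + ((1 + 1 / (J : ℝ)) ^ Nat.sqrt J - 1)) ≤
      rexp (copies F G) q (fun S => if ∃ i ∈ I, M i ⊆ S then 1 else 0) := by
    convert hspread'
  have h2' : rexp (copies F G) q (fun S => if IsGood F G Δ S then 0 else 1) ≤
      n * ((1 / 2) ^ Δ * Real.exp (m * lam)) +
        lam * (2 ^ F.card * m ^ m * (2 ^ F.card * (m ^ m * lam)) ^ F.card) ^ 2 / n := by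
    convert h2
  linarith

end Finite

/-! ### Asymptotic estimates -/

section Asymptotics

open Filter Topology

lemma tendsto_log_pow_mul_rpow_neg (a : ℕ) {s : ℝ} (hs : 0 < s) (c : ℝ) :
    Tendsto (fun n : ℕ => c * (Real.log n ^ a * (n : ℝ) ^ (-s))) atTop (𝓝 0) := by
  have h1 := (isLittleO_log_rpow_rpow_atTop (a : ℝ) hs).tendsto_div_nhds_zero.comp
    tendsto_natCast_atTop_atTop
  have h2 : Tendsto (fun n : ℕ => Real.log n ^ a * (n : ℝ) ^ (-s)) atTop (𝓝 0) := by
    refine h1.congr fun n => ?_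
    simp only [Function.comp_apply, Real.rpow_natCast]
    rw [Real.rpow_neg (Nat.cast_nonneg n), div_eq_mul_inv]
  simpa using h2.const_mul c

lemma tendsto_nat_sqrt_atTop : Tendsto Nat.sqrt atTop atTop :=
  tendsto_atTop.2 fun b => by
    filter_upwards [eventually_ge_atTop (b * b)] with a ha
    exact Nat.le_sqrt.2 ha

lemma tendsto_rounding_error :
    Tendsto (fun J : ℕ => (J : ℝ) * (1 / 2) ^ Nat.sqrt J + ((1 + 1 / (J : ℝ)) ^ Nat.sqrt J - 1))
      atTop (𝓝 0) := by
  have h1 : Tendsto (fun r : ℕ => 4 * ((r : ℝ) ^ 2 * (1 / 2) ^ r) + (Real.exp (1 / (r : ℝ)) - 1))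
      atTop (𝓝 0) := by
    have h2 := (tendsto_pow_const_mul_const_pow_of_lt_one 2
      (show (0 : ℝ) ≤ 1 / 2 by norm_num) (by norm_num)).const_mul 4
    have h3 := ((Real.continuous_exp.tendsto 0).comp
      (tendsto_one_div_atTop_nhds_zero_nat (𝕜 := ℝ))).sub_const 1
    simpa using h2.add h3
  refine squeeze_zero' ?_ ?_ (h1.comp tendsto_nat_sqrt_atTop)
  · filter_upwards with J
    have : (1 : ℝ) ≤ (1 + 1 / (J : ℝ)) ^ Nat.sqrt J :=
      one_le_pow₀ (le_add_of_nonneg_right (by positivity))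
    have : (0 : ℝ) ≤ (J : ℝ) * (1 / 2) ^ Nat.sqrt J := by positivity
    linarith
  · filter_upwards [eventually_ge_atTop 1] with J hJ
    simp only [Function.comp_apply]
    set r := Nat.sqrt J with hr
    have hr1 : 1 ≤ r := Nat.le_sqrt.2 (by simpa using hJ)
    have hr0 : (1 : ℝ) ≤ r := by exact_mod_cast hr1
    have hJ0 : (1 : ℝ) ≤ J := by exact_mod_cast hJ
    have hlo : (r : ℝ) * r ≤ J := by exact_mod_cast Nat.sqrt_le J
    have hup : (J : ℝ) ≤ 4 * r ^ 2 := by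
      have h : (J : ℝ) ≤ (r + 1) * (r + 1) := by exact_mod_cast (Nat.lt_succ_sqrt J).le
      nlinarith
    have h4 : (1 + 1 / (J : ℝ)) ^ r ≤ Real.exp (1 / (r : ℝ)) := by
      have h5 : (1 + 1 / (J : ℝ)) ^ r ≤ Real.exp (1 / (J : ℝ)) ^ r :=
        pow_le_pow_left₀ (by positivity) (by linarith [Real.add_one_le_exp (1 / (J : ℝ))]) _
      refine h5.trans ?_
      rw [← Real.exp_nat_mul, Real.exp_le_exp, mul_one_div, div_le_div_iff₀ (by linarith)
        (by linarith)]
      linarith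
    have h6 : (J : ℝ) * (1 / 2) ^ r ≤ 4 * (r : ℝ) ^ 2 * (1 / 2) ^ r :=
      mul_le_mul_of_nonneg_right hup (by positivity)
    linarith

/-- With `Δ` a large multiple of `log n`, a union bound over `n` vertices is summable. -/
lemma mul_half_pow_mul_exp_le {n Δ : ℕ} (hn : 1 ≤ n) {a : ℝ}
    (hΔ : (2 + a) / Real.log 2 * Real.log n ≤ Δ) :
    (n : ℝ) * ((1 / 2) ^ Δ * Real.exp (a * Real.log n)) ≤ 1 / n := by
  have hn0 : (0 : ℝ) < n := by exact_mod_cast hn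
  have hlog2 : 0 < Real.log 2 := Real.log_pos (by norm_num)
  have h1 : ((1 : ℝ) / 2) ^ Δ = Real.exp (-(Δ * Real.log 2)) := by
    rw [Real.exp_neg, Real.exp_nat_mul, Real.exp_log (by norm_num), one_div, inv_pow]
  have h2 : (2 + a) * Real.log n ≤ Δ * Real.log 2 := by
    have := mul_le_mul_of_nonneg_right hΔ hlog2.le
    rwa [div_mul_eq_mul_div, div_mul_cancel₀ _ hlog2.ne'] at this
  rw [h1, ← Real.exp_add]
  calc (n : ℝ) * Real.exp (-(Δ * Real.log 2) + a * Real.log n)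
      ≤ n * Real.exp (-(Real.log n) + -(Real.log n)) := by
        refine mul_le_mul_of_nonneg_left (Real.exp_le_exp.2 ?_) hn0.le
        linarith
    _ = 1 / n := by
        rw [Real.exp_add, Real.exp_neg, Real.exp_log hn0]
        field_simp

lemma eventually_intersections_le (m e : ℕ) {s : ℝ} (hs : 0 < s) {D Λ : ℝ} (hD : 0 ≤ D)
    (hΛ : 0 ≤ Λ) :
    ∀ᶠ n : ℕ in atTop, (2 : ℝ) ^ e * (m * ((m * (1 + (⌈D * Real.log n⌉₊ : ℝ) * m) ^ m) ^ m *
      (2 * (Λ * Real.log n) * (n : ℝ) ^ (-s)))) ≤ 1 / 2 := by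
  have h1 := tendsto_log_pow_mul_rpow_neg (m * m + 1) hs
    ((2 : ℝ) ^ e * (m * ((m * (1 + (D + 1) * m) ^ m) ^ m * (2 * Λ))))
  filter_upwards [h1.eventually_le_const (show (0 : ℝ) < 1 / 2 by norm_num),
    (Real.tendsto_log_atTop.comp tendsto_natCast_atTop_atTop).eventually_ge_atTop (1 : ℝ)]
    with n hn hL
  simp only [Function.comp_apply] at hL
  have hc : (⌈D * Real.log n⌉₊ : ℝ) ≤ (D + 1) * Real.log n := by
    have := (Nat.ceil_lt_add_one (show 0 ≤ D * Real.log n by positivity)).le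
    linarith
  have h2 : 1 + (⌈D * Real.log n⌉₊ : ℝ) * m ≤ (1 + (D + 1) * m) * Real.log n := by
    have := mul_le_mul_of_nonneg_right hc (Nat.cast_nonneg m)
    linarith
  refine le_trans ?_ hn
  calc (2 : ℝ) ^ e * (m * ((m * (1 + (⌈D * Real.log n⌉₊ : ℝ) * m) ^ m) ^ m *
        (2 * (Λ * Real.log n) * (n : ℝ) ^ (-s))))
      ≤ (2 : ℝ) ^ e * (m * ((m * ((1 + (D + 1) * m) * Real.log n) ^ m) ^ m *
        (2 * (Λ * Real.log n) * (n : ℝ) ^ (-s)))) := by gcongr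
    _ = _ := by
        simp only [mul_pow, ← pow_mul]
        ring

lemma eventually_union_error_le (m e : ℕ) {D Λ a : ℝ} (hD : D = (2 + a) / Real.log 2) {ε : ℝ}
    (hε : 0 < ε) :
    ∀ᶠ n : ℕ in atTop,
      (n : ℝ) * ((1 / 2) ^ ⌈D * Real.log n⌉₊ * Real.exp (a * Real.log n)) +
        Λ * Real.log n * (2 ^ e * m ^ m * (2 ^ e * (m ^ m * (Λ * Real.log n))) ^ e) ^ 2 / n
        ≤ ε := by
  have h1 := tendsto_log_pow_mul_rpow_neg (1 + 2 * e) one_pos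
    (Λ * (2 ^ e * m ^ m * (2 ^ e * (m ^ m * Λ)) ^ e) ^ 2)
  subst hD
  have h2 : Tendsto (fun n : ℕ => 1 / (n : ℝ)) atTop (𝓝 0) := tendsto_one_div_atTop_nhds_zero_nat
  filter_upwards [h1.eventually_le_const (half_pos hε), h2.eventually_le_const (half_pos hε),
    eventually_ge_atTop 1] with n hn hn' hn1
  have h3 := mul_half_pow_mul_exp_le (a := a) hn1 (Nat.le_ceil _)
  rw [Real.rpow_neg_one] at hn
  have h4 : Λ * Real.log n * (2 ^ e * m ^ m * (2 ^ e * (m ^ m * (Λ * Real.log n))) ^ e) ^ 2 / n =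
      Λ * (2 ^ e * m ^ m * (2 ^ e * (m ^ m * Λ)) ^ e) ^ 2 *
        (Real.log n ^ (1 + 2 * e) * (n : ℝ)⁻¹) := by
    simp only [mul_pow, ← pow_mul, pow_add, div_eq_mul_inv]
    ring
  rw [h4]
  linarith

end Asymptotics

/-- The edge density needed by the random sparsification, expressed through `oneDensity`. -/
lemma two_mul_rpow_eq {m n : ℕ} {F : Finset (Finset (Fin m))} (hm : 2 ≤ m) (hn : 1 ≤ n)
    {Λ : ℝ} (hΛ : 0 ≤ Λ) :
    2 * (2 * (Λ * Real.log n) / (n : ℝ) ^ (m - 1)) ^ (1 / (F.card : ℝ)) =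
      2 * (2 * Λ) ^ (1 / (F.card : ℝ)) * Real.log n ^ (1 / (F.card : ℝ)) *
        (n : ℝ) ^ (-(1 / oneDensity m F)) := by
  have hn0 : (1 : ℝ) ≤ n := by exact_mod_cast hn
  have hL := Real.log_nonneg hn0
  rw [Real.div_rpow (by positivity) (by positivity), ← mul_assoc 2 Λ,
    Real.mul_rpow (by positivity) hL, ← Real.rpow_natCast, ← Real.rpow_mul (by positivity),
    Real.rpow_neg (by positivity), oneDensity, Nat.cast_sub (by omega), Nat.cast_one, one_div_div,
    mul_one_div]
  ring

lemma pow_le_two_pow_log (m n : ℕ) : n ^ m ≤ 2 ^ (m * (Nat.log 2 n + 1)) := by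
  rw [mul_comm, pow_mul]
  exact Nat.pow_le_pow_left (Nat.lt_pow_succ_log_self one_lt_two n).le m

lemma mul_nat_log_add_one_le (m : ℕ) {n : ℕ} (hn : 1 ≤ Real.log n) :
    ((m * (Nat.log 2 n + 1) : ℕ) : ℝ) ≤ 3 * m * Real.log n := by
  have hlog2 : 1 / 2 ≤ Real.log 2 := by linarith [Real.log_two_gt_d9]
  have h1 : (Nat.log 2 n : ℝ) ≤ 2 * Real.log n := by
    have hn0 : n ≠ 0 := by
      rintro rfl
      simp at hn
      linarith
    have h2 : ((2 : ℝ) ^ Nat.log 2 n) ≤ n := by exact_mod_cast Nat.pow_log_le_self 2 hn0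
    have h3 := Real.log_le_log (by positivity) h2
    rw [Real.log_pow] at h3
    nlinarith [Nat.cast_nonneg (α := ℝ) (Nat.log 2 n)]
  push_cast
  nlinarith [Nat.cast_nonneg (α := ℝ) m]

/-- **Perfect tilings — minimum degree.**
For all `k ≥ 2`, `1 ≤ d ≤ k-1`, `μ > 0` and every strictly 1-balanced `k`-graph `F`,
there is `C > 0` such that: whenever `G` is an `n`-vertex `k`-graph with
`δ_d(G) ≥ (th_d(til_F)+μ)·C(n-d, k-d)`, `p ≥ C (log n)^{1/e(F)} n^{-1/d₁(F)}` and
`v(F) ∣ n`, the sparsification `G_p` contains a perfect `F`-tiling with high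
probability (probability at least `1 - ε` for all large `n`). -/
theorem perfect_tilings_minimum_degree
    (k d : ℕ) (hk : 2 ≤ k) (hd1 : 1 ≤ d) (hdk : d ≤ k - 1)
    (μ : ℝ) (hμ : 0 < μ)
    (m : ℕ) (F : Finset (Finset (Fin m))) (hF : IsHG k m F)
    (hbal : StrictlyOneBalanced m F) :
    ∃ C : ℝ, 0 < C ∧
      ∀ ε : ℝ, 0 < ε → ∃ n₀ : ℕ, ∀ n, n₀ ≤ n →
        ∀ G : Finset (Finset (Fin n)), IsHG k n G →
          MinDegGE G d
            ((tilingThreshold k d m F + μ) * (((n - d).choose (k - d) : ℕ) : ℝ)) →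
          ∀ p : ℝ, 0 ≤ p → p ≤ 1 →
            C * (Real.log n) ^ ((1 : ℝ) / (F.card : ℝ))
              * (n : ℝ) ^ (-(1 / oneDensity m F)) ≤ p →
            m ∣ n →
            1 - ε ≤ sparsProb G p (fun E => HasPerfectTiling m n F E) := by
  classical
  rcases F.eq_empty_or_nonempty with rfl | hne
  · refine ⟨2, by norm_num, fun ε _ => ⟨0, fun n _ G _ _ p _ hp1 hp _ => ?_⟩⟩
    norm_num [oneDensity] at hp
    linarith
  have hm : 2 ≤ m := by
    obtain ⟨f, hf⟩ := hne
    have h1 := Finset.card_le_univ f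
    rw [hF f hf, Fintype.card_fin] at h1
    omega
  have he : (0 : ℝ) < 1 / (F.card : ℝ) := by
    have := hne.card_pos
    positivity
  obtain ⟨K, hK, n₁, hspread⟩ := exists_spread_tilings hk hdk hμ hF hbal hne
  set Λ : ℝ := 51 * m * K + 1 with hΛ
  have hΛ1 : 1 ≤ Λ := by
    have : 0 ≤ 51 * m * K := by positivity
    linarith
  set D : ℝ := (2 + m * Λ) / Real.log 2 with hD
  have hD0 : 0 ≤ D := by
    have := Real.log_nonneg (show (1 : ℝ) ≤ 2 by norm_num)
    positivity
  refine ⟨2 * (2 * Λ) ^ (1 / (F.card : ℝ)), by positivity, fun ε hε => ?_⟩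
  have hlog : Filter.Tendsto (fun n : ℕ => Real.log n) Filter.atTop Filter.atTop :=
    Real.tendsto_log_atTop.comp tendsto_natCast_atTop_atTop
  have hJ : Filter.Tendsto (fun n : ℕ => m * (Nat.log 2 n + 1)) Filter.atTop Filter.atTop := by
    refine Filter.tendsto_atTop_mono (f := fun n => Nat.log 2 n) (fun n => ?_) ?_
    · exact (Nat.le_succ _).trans (Nat.le_mul_of_pos_left _ (by omega))
    · refine Filter.tendsto_atTop.2 fun b => ?_
      filter_upwards [Filter.eventually_ge_atTop (2 ^ b)] with n hn
      exact Nat.le_log_of_pow_le one_lt_two hn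
  have hlin := tendsto_log_pow_mul_rpow_neg 1 one_pos (2 * Λ)
  obtain ⟨n₀, hn₀⟩ := Filter.eventually_atTop.1 <| (Filter.eventually_ge_atTop n₁).and <|
    (Filter.eventually_ge_atTop 1).and <| (hlog.eventually_ge_atTop 1).and <|
    ((tendsto_rounding_error.comp hJ).eventually_le_const (half_pos hε)).and <|
    (eventually_union_error_le m F.card (Λ := Λ) hD (half_pos hε)).and <|
    (eventually_intersections_le m F.card he hD0 (by linarith : 0 ≤ Λ)).and <|
    hlin.eventually_le_const one_pos
  refine ⟨n₀, fun n hn G hG hdeg p _ hp1 hp hmn => ?_⟩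
  obtain ⟨h1, hn1, hL, herr, hunion, hinter, hsmall⟩ := hn₀ n hn
  obtain ⟨ι, I, M, hI, hM, hS⟩ := hspread n h1 G hG hdeg hmn
  have hn0 : (1 : ℝ) ≤ n := by exact_mod_cast hn1
  have key := sparsProb_ge (p := p) (lam := Λ * Real.log n) (J := m * (Nat.log 2 n + 1))
    (Δ := ⌈D * Real.log n⌉₊) hk hF hbal hne hn1 (by omega) hI hM hK
    (fun S hS' => by convert hS S hS') (by positivity) (pow_le_two_pow_log m n)
    (by nlinarith) ?_ ?_ hinter ?_ hp1
  · simp only [Function.comp_apply] at herr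
    rw [← mul_assoc (m : ℝ) Λ] at key
    linarith
  · have h3 := mul_le_mul_of_nonneg_left (mul_nat_log_add_one_le m hL)
      (show 0 ≤ 17 * K by positivity)
    nlinarith
  · rw [pow_one, Real.rpow_neg_one, ← mul_assoc, ← div_eq_mul_inv,
      div_le_one (by linarith)] at hsmall
    rw [← mul_assoc]
    exact hsmall.trans (le_self_pow₀ hn0 (by omega))
  · rwa [two_mul_rpow_eq hm hn1 (by linarith)]
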